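/- There exists a positive integer n₀ such that for every n ≥ n₀ the following holds: if P is a set of n points in the Euclidean plane ℝ², then the number of 3-rich lines of P is at most ⌊n(n−3)/6⌋ + 1. -/

import Mathlib

/-- A line in the Euclidean plane `ℝ × ℝ`: a one-dimensional affine subspace. -/
def IsLine (L : AffineSubspace ℝ (ℝ × ℝ)) : Prop :=
  (L : Set (ℝ × ℝ)).Nonempty ∧ Module.finrank ℝ L.direction = 1

/-- The number of 3-rich lines of a planar point set `P`, i.e. lines
containing exactly three points of `P`. -/
noncomputable def numThreeRichLines (P : Set (ℝ × ℝ)) : ℕ :=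
  {L : AffineSubspace ℝ (ℝ × ℝ) | IsLine L ∧ (P ∩ (L : Set (ℝ × ℝ))).ncard = 3}.ncard


namespace Orch
open scoped Classical

/-- points of the plane -/
abbrev Pt := ℝ × ℝ

/-- collinearity -/
def Col (p q r : Pt) : Prop := (q.1-p.1)*(r.2-p.2) = (q.2-p.2)*(r.1-p.1)

/-- the points of `P` on the line `pq` -/
noncomputable def lin (P : Finset Pt) (p q : Pt) : Finset Pt := P.filter (fun r => Col p q r)

/-- ordered pairs whose line is not 3-rich -/
noncomputable def bad (P : Finset Pt) : Finset (Pt × Pt) :=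
  P.offDiag.filter (fun x => (lin P x.1 x.2).card ≠ 3)

theorem mem_lin {P : Finset Pt} {p q r : Pt} : r ∈ lin P p q ↔ r ∈ P ∧ Col p q r := by
  simp [lin]

theorem mem_bad {P : Finset Pt} {p q : Pt} :
    (p, q) ∈ bad P ↔ p ∈ P ∧ q ∈ P ∧ p ≠ q ∧ (lin P p q).card ≠ 3 := by
  simp [bad, and_assoc]

theorem col_left (p q : Pt) : Col p q p := by unfold Col; ring
theorem col_right (p q : Pt) : Col p q q := by unfold Col; ring
theorem Col.swap12 {p q r : Pt} (h : Col p q r) : Col q p r := by unfold Col at *; linarith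
theorem Col.swap23 {p q r : Pt} (h : Col p q r) : Col p r q := by unfold Col at *; linarith
theorem Col.rot {p q r : Pt} (h : Col p q r) : Col q r p := by unfold Col at *; linarith

theorem Pt.ne_iff {p q : Pt} : p ≠ q ↔ q.1 - p.1 ≠ 0 ∨ q.2 - p.2 ≠ 0 := by
  constructor
  · intro h
    by_contra hh
    push Not at hh
    exact h (Prod.ext (by linarith [hh.1]) (by linarith [hh.2]))
  · rintro h rfl
    simp at h

/-- collinearity is transitive -/
theorem Col.trans {p q r s : Pt} (hpq : p ≠ q) (h1 : Col p q r) (h2 : Col p q s) : Col p r s := by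
  unfold Col at *
  rcases Pt.ne_iff.1 hpq with h | h
  · apply mul_left_cancel₀ h
    linear_combination (r.1 - p.1) * h2 - (s.1-p.1) * h1
  · apply mul_left_cancel₀ h
    linear_combination (r.2 - p.2) * h2 - (s.2-p.2) * h1

theorem Col.trans4 {p q r s t : Pt} (hpq : p ≠ q) (h1 : Col p q r) (h2 : Col p q s)
    (h3 : Col p q t) : Col r s t := by
  by_cases hpr : p = r
  · subst hpr; exact Col.trans hpq h2 h3
  · have a := Col.trans hpq h1 h2
    have b := Col.trans hpq h1 h3
    exact Col.trans (Ne.symm hpr) a.swap12 b.swap12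

theorem lin_eq {P : Finset Pt} {p q r s : Pt} (hpq : p ≠ q) (h1 : Col p q r) (h2 : Col p q s)
    (hrs : r ≠ s) : lin P p q = lin P r s := by
  ext t
  rw [mem_lin, mem_lin]
  refine and_congr_right fun _ => ⟨fun h => Col.trans4 hpq h1 h2 h, fun h => ?_⟩
  have a : Col r s p := Col.trans4 hpq h1 h2 (col_left _ _)
  have b : Col r s q := Col.trans4 hpq h1 h2 (col_right _ _)
  exact Col.trans4 hrs a b h

/-- main claim -/
def MainClaim : Prop := ∃ n₀ : ℕ, ∀ P : Finset Pt, Set.InjOn Prod.fst (P : Set Pt) →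
  n₀ ≤ P.card → 2 * P.card ≤ (bad P).card + 6

/-- shear -/
noncomputable def shear (c : ℝ) : Pt ↪ Pt := ⟨fun z => (z.1 + c * z.2, z.2), by
  intro a b h
  simp only [Prod.mk.injEq] at h
  obtain ⟨h1, h2⟩ := h
  rw [h2] at h1
  exact Prod.ext (by linarith) h2⟩

theorem shear_fst (c : ℝ) (z : Pt) : (shear c z).1 = z.1 + c * z.2 := rfl
theorem shear_snd (c : ℝ) (z : Pt) : (shear c z).2 = z.2 := rfl

theorem shear_col (c : ℝ) (p q r : Pt) : Col (shear c p) (shear c q) (shear c r) ↔ Col p q r := by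
  simp only [Col, shear_fst, shear_snd]
  constructor <;> intro h <;> linear_combination h

theorem bad_shear (c : ℝ) (P : Finset Pt) : (bad (P.map (shear c))).card = (bad P).card := by
  have hl : ∀ p q, lin (P.map (shear c)) (shear c p) (shear c q) = (lin P p q).map (shear c) := by
    intro p q
    ext r
    simp only [mem_lin, Finset.mem_map]
    constructor
    · rintro ⟨⟨s, hs, rfl⟩, h⟩
      exact ⟨s, ⟨hs, (shear_col _ _ _ _).1 h⟩, rfl⟩
    · rintro ⟨s, ⟨hs, h⟩, rfl⟩
      exact ⟨⟨s, hs, rfl⟩, (shear_col _ _ _ _).2 h⟩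
  have : bad (P.map (shear c)) = (bad P).map ((shear c).prodMap (shear c)) := by
    ext ⟨x, y⟩
    rw [mem_bad, Finset.mem_map, Finset.mem_map, Finset.mem_map]
    constructor
    · rintro ⟨⟨p, hp, rfl⟩, ⟨q, hq, rfl⟩, hne, h⟩
      rw [hl, Finset.card_map] at h
      exact ⟨(p, q), mem_bad.2 ⟨hp, hq, fun e => hne (e ▸ rfl), h⟩, rfl⟩
    · rintro ⟨⟨p, q⟩, h, he⟩
      obtain ⟨hp, hq, hne, h⟩ := mem_bad.1 h
      have he1 : shear c p = x := congrArg Prod.fst he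
      have he2 : shear c q = y := congrArg Prod.snd he
      subst he1 he2
      exact ⟨⟨p, hp, rfl⟩, ⟨q, hq, rfl⟩, fun e => hne ((shear c).injective e), by rwa [hl, Finset.card_map]⟩
  rw [this, Finset.card_map]

theorem exists_shear (P : Finset Pt) : ∃ c, Set.InjOn Prod.fst ((P.map (shear c) : Finset Pt) : Set Pt) := by
  obtain ⟨c, hc⟩ := (((P ×ˢ P).image (fun x : Pt × Pt => -(x.1.1 - x.2.1) / (x.1.2 - x.2.2)))).exists_notMem
  refine ⟨c, ?_⟩
  rintro x hx y hy h
  simp only [Finset.coe_map, Set.mem_image, Finset.mem_coe] at hx hy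
  obtain ⟨p, hp, rfl⟩ := hx
  obtain ⟨q, hq, rfl⟩ := hy
  simp only [shear_fst] at h
  by_cases h2 : p.2 - q.2 = 0
  · have h2' : p.2 = q.2 := by linarith
    have : p = q := Prod.ext (by rw [h2'] at h; linarith) h2'
    rw [this]
  · exfalso
    apply hc
    rw [Finset.mem_image]
    refine ⟨(p, q), Finset.mem_product.2 ⟨hp, hq⟩, ?_⟩
    simp only
    rw [div_eq_iff h2]
    linarith

open Module in
theorem line_mem {L : AffineSubspace ℝ (ℝ × ℝ)} (hL : IsLine L) {p q r : Pt} (hp : p ∈ L) (hq : q ∈ L)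
    (hpq : p ≠ q) : r ∈ L ↔ Col p q r := by
  obtain ⟨_, hfin⟩ := hL
  have hv : q -ᵥ p ∈ L.direction := AffineSubspace.vsub_mem_direction hq hp
  have hv0 : (⟨q -ᵥ p, hv⟩ : L.direction) ≠ 0 := by
    intro h
    have := congrArg Subtype.val h
    simp only [vsub_eq_sub] at this
    exact hpq (sub_eq_zero.1 this).symm
  have key := (finrank_eq_one_iff_of_nonzero' _ hv0).1 hfin
  constructor
  · intro hr
    obtain ⟨c, hc⟩ := key ⟨r -ᵥ p, AffineSubspace.vsub_mem_direction hr hp⟩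
    have hc' := congrArg Subtype.val hc
    simp only [vsub_eq_sub] at hc'
    have h1 := congrArg Prod.fst hc'
    have h2 := congrArg Prod.snd hc'
    simp at h1 h2
    unfold Col
    rw [← h1, ← h2]; ring
  · intro h
    have : ∃ c : ℝ, r = (c • (q -ᵥ p)) +ᵥ p := by
      unfold Col at h
      rcases Pt.ne_iff.1 hpq with h0 | h0
      · refine ⟨(r.1 - p.1)/(q.1-p.1), ?_⟩
        ext
        · simp; field_simp; ring
        · simp; field_simp; linarith
      · refine ⟨(r.2 - p.2)/(q.2-p.2), ?_⟩
        ext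
        · simp; field_simp; linarith
        · simp; field_simp; ring
    obtain ⟨c, rfl⟩ := this
    exact AffineSubspace.vadd_mem_of_mem_direction (Submodule.smul_mem _ _ hv) hp

theorem line_ext {L L' : AffineSubspace ℝ (ℝ × ℝ)} (hL : IsLine L) (hL' : IsLine L') {p q : Pt} (hp : p ∈ L) (hq : q ∈ L)
    (hp' : p ∈ L') (hq' : q ∈ L') (hpq : p ≠ q) : L = L' := by
  ext r
  rw [line_mem hL hp hq hpq, line_mem hL' hp' hq' hpq]

theorem rich_le (P : Finset Pt) : 6 * numThreeRichLines (P : Set Pt) + (bad P).card ≤ P.card * (P.card - 1) := by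
  set S := {L : AffineSubspace ℝ (ℝ × ℝ) | IsLine L ∧ ((P : Set Pt) ∩ (L : Set (ℝ × ℝ))).ncard = 3} with hS
  -- finset on each line
  have hfil : ∀ L ∈ S, (P.filter (fun r => r ∈ L)).card = 3 := by
    intro L hL
    have := hL.2
    rw [← Set.ncard_coe_finset]
    convert this using 2
    ext r; simp
  have hfin : S.Finite := by
    apply Set.Finite.of_finite_image (f := fun L => P.filter (fun r => r ∈ L))
    · exact (P.powerset.finite_toSet).subset (by
        rintro _ ⟨L, hL, rfl⟩
        exact Finset.mem_coe.2 (Finset.mem_powerset.2 (Finset.filter_subset _ _)))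
    · intro L hL L' hL' h
      simp only at h
      have h3 := hfil L hL
      obtain ⟨p, q, hp, hq, hpq⟩ := Finset.one_lt_card_iff.1 (by rw [h3]; norm_num : 1 < (P.filter (fun r => r ∈ L)).card)
      have hp' := hp; have hq' := hq
      rw [h] at hp' hq'
      exact line_ext hL.1 hL'.1 (Finset.mem_filter.1 hp).2 (Finset.mem_filter.1 hq).2 (Finset.mem_filter.1 hp').2 (Finset.mem_filter.1 hq').2 hpq
  have hcard : numThreeRichLines (P : Set Pt) = hfin.toFinset.card := by
    unfold numThreeRichLines
    exact Set.ncard_eq_toFinset_card _ hfin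
  rw [hcard]
  set good := P.offDiag.filter (fun x => ¬ (lin P x.1 x.2).card ≠ 3) with hgood
  have hsum : (bad P).card + good.card = P.offDiag.card := by
    exact Finset.card_filter_add_card_filter_not _
  have hbig : 6 * hfin.toFinset.card ≤ good.card := by
    have hdisj : ∀ L ∈ hfin.toFinset, ∀ L' ∈ hfin.toFinset, L ≠ L' →
        Disjoint ((P.filter (fun r => r ∈ L)).offDiag) ((P.filter (fun r => r ∈ L')).offDiag) := by
      intro L hL L' hL' hne
      rw [Finset.disjoint_left]
      rintro ⟨p, q⟩ h h'
      simp only [Finset.mem_offDiag, Finset.mem_filter] at h h'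
      rw [Set.Finite.mem_toFinset] at hL hL'
      exact hne (line_ext hL.1 hL'.1 h.1.2 h.2.1.2 h'.1.2 h'.2.1.2 h.2.2)
    have h1 := Finset.card_biUnion hdisj
    have h2 : ∑ L ∈ hfin.toFinset, ((P.filter (fun r => r ∈ L)).offDiag).card = ∑ L ∈ hfin.toFinset, 6 := by
      apply Finset.sum_congr rfl
      intro L hL
      rw [Finset.offDiag_card, hfil L (by simpa using hL)]
    rw [h2, Finset.sum_const, smul_eq_mul] at h1
    rw [mul_comm, ← h1]
    apply Finset.card_le_card
    rintro ⟨p, q⟩ h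
    simp only [Finset.mem_biUnion, Set.Finite.mem_toFinset] at h
    obtain ⟨L, hL, h⟩ := h
    simp only [Finset.mem_offDiag, Finset.mem_filter] at h
    simp only [hgood, Finset.mem_filter, Finset.mem_offDiag, ne_eq, not_not]
    refine ⟨⟨h.1.1, h.2.1.1, h.2.2⟩, ?_⟩
    rw [← hfil L hL]
    congr 1
    ext r
    rw [mem_lin, Finset.mem_filter, line_mem hL.1 h.1.2 h.2.1.2 h.2.2]
  have : P.offDiag.card = P.card * (P.card - 1) := by
    rw [Finset.offDiag_card, Nat.mul_sub, mul_one]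
  omega

theorem reduction (h : MainClaim) : ∃ n₀ : ℕ, 0 < n₀ ∧ ∀ n : ℕ, n₀ ≤ n →
      ∀ P : Set (ℝ × ℝ), P.Finite → P.ncard = n →
        numThreeRichLines P ≤ n * (n - 3) / 6 + 1 := by
  obtain ⟨n₀, h⟩ := h
  refine ⟨n₀ + 3, by omega, ?_⟩
  intro n hn P hP hc
  lift P to Finset Pt using hP
  rw [Set.ncard_coe_finset] at hc
  obtain ⟨c, hc2⟩ := exists_shear P
  have h1 := h _ hc2 (by rw [Finset.card_map]; omega)
  rw [bad_shear, Finset.card_map, hc] at h1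
  have h2 := rich_le P
  rw [hc] at h2
  obtain ⟨m, rfl⟩ : ∃ m, n = m + 3 := ⟨n - 3, by omega⟩
  rw [show m + 3 - 1 = m + 2 by omega] at h2
  rw [show m + 3 - 3 = m by omega]
  have h3 : (m+3)*(m+2) = (m+3)*m + 2*(m+3) := by ring
  omega
end Orch

namespace Orch
open scoped Classical

/-- the dual line of `p` evaluated at `z` -/
def g (p z : Pt) : ℝ := z.2 - p.1 * z.1 - p.2

/-- dual lines through `z` -/
noncomputable def LL (P : Finset Pt) (z : Pt) : Finset Pt := P.filter (fun p => g p z = 0)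

/-- intersection of two dual lines -/
noncomputable def meet (p q : Pt) : Pt :=
  ((q.2 - p.2) / (p.1 - q.1), p.1 * ((q.2 - p.2) / (p.1 - q.1)) + p.2)

/-- vertices of the dual arrangement -/
noncomputable def VV (P : Finset Pt) : Finset Pt := P.offDiag.image (fun x => meet x.1 x.2)

abbrev Inj (P : Finset Pt) : Prop := Set.InjOn Prod.fst (P : Set Pt)

theorem mem_LL {P : Finset Pt} {z p : Pt} : p ∈ LL P z ↔ p ∈ P ∧ g p z = 0 := by simp [LL]

theorem meet_left (p q : Pt) : g p (meet p q) = 0 := by simp only [g, meet]; ring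
theorem meet_right {p q : Pt} (h : p.1 ≠ q.1) : g q (meet p q) = 0 := by
  have : p.1 - q.1 ≠ 0 := sub_ne_zero.2 h
  simp only [g, meet]; field_simp; ring

/-- key identity -/
theorem g_key {p q O A : Pt} (h1 : g p O = 0) (h2 : g q O = 0) (h3 : g p A = 0) :
    g q A = (p.1 - q.1) * (A.1 - O.1) := by
  unfold g at *; linear_combination h3 - h1 + h2

theorem Inj.ne {P : Finset Pt} (hP : Inj P) {p q : Pt} (hp : p ∈ P) (hq : q ∈ P) (h : p ≠ q) : p.1 ≠ q.1 :=
  fun e => h (hP hp hq e)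

theorem pt_eq_of_g {p z w : Pt} (h1 : g p z = 0) (h2 : g p w = 0) (h : z.1 = w.1) : z = w := by
  refine Prod.ext h ?_
  unfold g at *; rw [h] at h1; linarith

theorem line_eq_of_g {p q z w : Pt} (h1 : g p z = 0) (h2 : g p w = 0) (h3 : g q z = 0) (h4 : g q w = 0)
    (h : z ≠ w) : p = q := by
  have hx : z.1 - w.1 ≠ 0 := fun e => h (pt_eq_of_g h1 h2 (sub_eq_zero.1 e))
  have : p.1 = q.1 := by
    apply mul_right_cancel₀ hx
    unfold g at *; linear_combination -h1 + h2 + h3 - h4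
  refine Prod.ext this ?_
  unfold g at *; rw [this] at h1; linarith

theorem pt_eq_of_lines {P : Finset Pt} (hP : Inj P) {p q z w : Pt} (hp : p ∈ P) (hq : q ∈ P) (hpq : p ≠ q)
    (h1 : g p z = 0) (h2 : g p w = 0) (h3 : g q z = 0) (h4 : g q w = 0) : z = w := by
  by_contra h
  exact hpq (line_eq_of_g h1 h2 h3 h4 h)

theorem mem_VV {P : Finset Pt} (hP : Inj P) {z : Pt} :
    z ∈ VV P ↔ ∃ p ∈ P, ∃ q ∈ P, p ≠ q ∧ g p z = 0 ∧ g q z = 0 := by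
  unfold VV
  rw [Finset.mem_image]
  constructor
  · rintro ⟨⟨p, q⟩, h, rfl⟩
    rw [Finset.mem_offDiag] at h
    exact ⟨p, h.1, q, h.2.1, h.2.2, meet_left _ _, meet_right (hP.ne h.1 h.2.1 h.2.2)⟩
  · rintro ⟨p, hp, q, hq, hpq, h1, h2⟩
    exact ⟨(p, q), Finset.mem_offDiag.2 ⟨hp, hq, hpq⟩,
      pt_eq_of_lines hP hp hq hpq (meet_left _ _) h1 (meet_right (hP.ne hp hq hpq)) h2⟩

theorem two_le_deg {P : Finset Pt} (hP : Inj P) {z : Pt} (hz : z ∈ VV P) : 2 ≤ (LL P z).card := by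
  obtain ⟨p, hp, q, hq, hpq, h1, h2⟩ := (mem_VV hP).1 hz
  exact Finset.one_lt_card_iff.2 ⟨p, q, mem_LL.2 ⟨hp, h1⟩, mem_LL.2 ⟨hq, h2⟩, hpq⟩

theorem LL_meet {P : Finset Pt} (hP : Inj P) {p q : Pt} (hp : p ∈ P) (hq : q ∈ P) (hpq : p ≠ q) :
    LL P (meet p q) = lin P p q := by
  ext r
  rw [mem_LL, mem_lin]
  refine and_congr_right fun hr => ?_
  have h : p.1 - q.1 ≠ 0 := sub_ne_zero.2 (hP.ne hp hq hpq)
  simp only [g, meet, Col]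
  constructor
  · intro h0
    field_simp at h0
    linarith
  · intro h0
    field_simp
    linarith

theorem VV_LL_eq {P : Finset Pt} (hP : Inj P) {p q z : Pt} (hp : p ∈ P) (hq : q ∈ P) (hpq : p ≠ q)
    (h1 : g p z = 0) (h2 : g q z = 0) : LL P z = lin P p q := by
  rw [← LL_meet hP hp hq hpq]
  rw [pt_eq_of_lines hP hp hq hpq h1 (meet_left _ _) h2 (meet_right (hP.ne hp hq hpq))]

/-- double counting of bad pairs -/
theorem sum_deg_bad {P : Finset Pt} (hP : Inj P) :
    ∑ v ∈ (VV P).filter (fun v => (LL P v).card ≠ 3), (LL P v).card * ((LL P v).card - 1) = (bad P).card := by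
  rw [Finset.card_eq_sum_card_fiberwise (f := fun x : Pt × Pt => meet x.1 x.2)
    (t := (VV P).filter (fun v => (LL P v).card ≠ 3))]
  · apply Finset.sum_congr rfl
    intro v hv
    have : (bad P).filter (fun x => meet x.1 x.2 = v) = (LL P v).offDiag := by
      ext ⟨p, q⟩
      rw [Finset.mem_filter, mem_bad, Finset.mem_offDiag, mem_LL, mem_LL]
      constructor
      · rintro ⟨⟨hp, hq, hpq, h⟩, h2⟩
        simp only at h2
        subst h2
        exact ⟨⟨hp, meet_left _ _⟩, ⟨hq, meet_right (hP.ne hp hq hpq)⟩, hpq⟩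
      · rintro ⟨⟨hp, h1⟩, ⟨hq, h2⟩, hpq⟩
        simp only at *
        refine ⟨⟨hp, hq, hpq, ?_⟩, pt_eq_of_lines hP hp hq hpq (meet_left _ _) h1 (meet_right (hP.ne hp hq hpq)) h2⟩
        rw [← VV_LL_eq hP hp hq hpq h1 h2]
        exact (Finset.mem_filter.1 hv).2
    rw [this, Finset.offDiag_card, Nat.mul_sub, mul_one]
  · rintro ⟨p, q⟩ h
    obtain ⟨hp, hq, hpq, h⟩ := mem_bad.1 h
    rw [Finset.mem_coe, Finset.mem_filter]
    refine ⟨(mem_VV hP).2 ⟨p, hp, q, hq, hpq, meet_left _ _, meet_right (hP.ne hp hq hpq)⟩, ?_⟩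
    simp only
    rwa [LL_meet hP hp hq hpq]

/-- crossing lemma -/
theorem cross {P : Finset Pt} (hP : Inj P) {i t A B : Pt} (hi : i ∈ P) (ht : t ∈ P)
    (hA : g i A = 0) (hB : g i B = 0) (hAB : A.1 < B.1) (h : g t A * g t B < 0) :
    ∃ z ∈ VV P, g i z = 0 ∧ g t z = 0 ∧ A.1 < z.1 ∧ z.1 < B.1 := by
  have hti : i ≠ t := by
    rintro rfl
    rw [hA] at h; simp at h
  have hne := sub_ne_zero.2 (hP.ne hi ht hti)
  refine ⟨meet i t, (mem_VV hP).2 ⟨i, hi, t, ht, hti, meet_left _ _, meet_right (hP.ne hi ht hti)⟩,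
    meet_left _ _, meet_right (hP.ne hi ht hti), ?_⟩
  have h1 := g_key (meet_left i t) (meet_right (hP.ne hi ht hti)) hA
  have h2 := g_key (meet_left i t) (meet_right (hP.ne hi ht hti)) hB
  rw [h1, h2] at h
  have hsq : 0 < (i.1 - t.1)^2 := by positivity
  have h3 : (A.1 - (meet i t).1) * (B.1 - (meet i t).1) < 0 := by
    by_contra hc
    push Not at hc
    nlinarith [mul_nonneg hsq.le hc]
  constructor
  · by_contra hc; push Not at hc
    nlinarith
  · by_contra hc; push Not at hc
    nlinarith

/-- `u` is the right end (for `s = 1`) of an empty cell lying above (for `e = 1`) line `i`. -/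
def Strict (P : Finset Pt) (u : Pt) (s e : ℝ) : Prop :=
  ∃ v i j : Pt, i ∈ P ∧ j ∈ P ∧ g i v = 0 ∧ g j v = 0 ∧ g j u = 0 ∧ 0 < s * (u.1 - v.1) ∧ 0 < e * g i u ∧
    ∀ t ∈ P, t ≠ i → (0 ≤ g t v ∧ 0 ≤ g t u ∧ 0 < g t (u.1, i.1 * u.1 + i.2)) ∨
      (g t v ≤ 0 ∧ g t u ≤ 0 ∧ g t (u.1, i.1 * u.1 + i.2) < 0)

/-- next vertex on a line -/
def Next (P : Finset Pt) (j v w : Pt) : Prop :=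
  w ∈ VV P ∧ g j v = 0 ∧ g j w = 0 ∧ v.1 < w.1 ∧ ∀ z ∈ VV P, g j z = 0 → v.1 < z.1 → w.1 ≤ z.1

theorem exists_next {P : Finset Pt} {j v z : Pt} (hv : g j v = 0) (hz : z ∈ VV P) (hjz : g j z = 0) (h : v.1 < z.1) :
    ∃ w, Next P j v w ∧ w.1 ≤ z.1 := by
  obtain ⟨w, hw, hmin⟩ := Finset.exists_min_image ((VV P).filter (fun z => g j z = 0 ∧ v.1 < z.1)) (fun z => z.1)
    ⟨z, Finset.mem_filter.2 ⟨hz, hjz, h⟩⟩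
  rw [Finset.mem_filter] at hw
  exact ⟨w, ⟨hw.1, hv, hw.2.1, hw.2.2, fun z h1 h2 h3 => hmin z (Finset.mem_filter.2 ⟨h1, h2, h3⟩)⟩,
    hmin z (Finset.mem_filter.2 ⟨hz, hjz, h⟩)⟩

theorem next_left_unique {P : Finset Pt} {j v v' w : Pt} (hv : v ∈ VV P) (hv' : v' ∈ VV P)
    (h : Next P j v w) (h' : Next P j v' w) : v = v' := by
  apply pt_eq_of_g h.2.1 h'.2.1
  rcases lt_trichotomy v.1 v'.1 with hh | hh | hh
  · exact absurd (h.2.2.2.2 v' hv' h'.2.1 hh) (not_le.2 h'.2.2.2.1)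
  · exact hh
  · exact absurd (h'.2.2.2.2 v hv h.2.1 hh) (not_le.2 h.2.2.2.1)

/-- slope predecessor at a vertex -/
def Pred (P : Finset Pt) (v i j : Pt) : Prop :=
  i ∈ LL P v ∧ j ∈ LL P v ∧ i.1 < j.1 ∧ ∀ k ∈ LL P v, k.1 < j.1 → k.1 ≤ i.1

theorem exists_pred {P : Finset Pt} {v k j : Pt} (hj : j ∈ LL P v) (hk : k ∈ LL P v) (h : k.1 < j.1) :
    ∃ i, Pred P v i j := by
  obtain ⟨i, hi, hmax⟩ := Finset.exists_max_image ((LL P v).filter (fun z => z.1 < j.1)) (fun z => z.1)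
    ⟨k, Finset.mem_filter.2 ⟨hk, h⟩⟩
  rw [Finset.mem_filter] at hi
  exact ⟨i, hi.1, hj, hi.2, fun k h1 h2 => hmax k (Finset.mem_filter.2 ⟨h1, h2⟩)⟩

theorem caseBeta {P : Finset Pt} (hP : Inj P) {v i j u : Pt} (hpred : Pred P v i j) (hn : Next P j v u)
    (hno : ∀ z ∈ VV P, g i z = 0 → v.1 < z.1 → u.1 < z.1) :
    Strict P u 1 1 ∧ ∀ k ∈ LL P u, k.1 ≤ j.1 := by
  obtain ⟨hi, hj, hij, hp⟩ := hpred
  obtain ⟨huV, hjv, hju, hvu, hmin⟩ := hn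
  rw [mem_LL] at hi hj
  have hiu : 0 < g i u := by
    rw [g_key hjv hi.2 hju]
    exact mul_pos (by linarith) (by linarith)
  have hu' : g i (u.1, i.1 * u.1 + i.2) = 0 := by unfold g; ring
  have hdiff : ∀ t, g t u = g t (u.1, i.1 * u.1 + i.2) + g i u := by intro t; unfold g; ring
  have key : ∀ t ∈ P, t ≠ i → (0 ≤ g t v ∧ 0 ≤ g t u ∧ 0 < g t (u.1, i.1 * u.1 + i.2)) ∨
      (g t v ≤ 0 ∧ g t u ≤ 0 ∧ g t (u.1, i.1 * u.1 + i.2) < 0) := by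
    intro t ht hti
    rcases lt_trichotomy (g t v) 0 with h | h | h
    · right
      have h1 : g t u ≤ 0 := by
        by_contra hc
        push Not at hc
        obtain ⟨z, hz, hz1, _, hz2, hz3⟩ := cross hP hj.1 ht hjv hju hvu (mul_neg_of_neg_of_pos h hc)
        linarith [hmin z hz hz1 hz2]
      exact ⟨h.le, h1, by linarith [hdiff t]⟩
    · have h1 := g_key hi.2 h hu'
      have h2 := g_key hjv h hju
      simp only at h1
      rcases lt_trichotomy t.1 j.1 with h3 | h3 | h3
      · left
        have h4 := hp t (mem_LL.2 ⟨ht, h⟩) h3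
        have h5 : t.1 < i.1 := lt_of_le_of_ne h4 (hP.ne ht hi.1 hti)
        refine ⟨h.ge, ?_, ?_⟩
        · rw [h2]; exact mul_nonneg (by linarith) (by linarith)
        · rw [h1]; exact mul_pos (by linarith) (by linarith)
      · right
        refine ⟨h.le, ?_, ?_⟩
        · rw [h2, h3]; simp
        · rw [h1, h3]; exact mul_neg_of_neg_of_pos (by linarith) (by linarith)
      · right
        refine ⟨h.le, ?_, ?_⟩
        · rw [h2]; exact mul_nonpos_of_nonpos_of_nonneg (by linarith) (by linarith)
        · rw [h1]; exact mul_neg_of_neg_of_pos (by linarith) (by linarith)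
    · left
      have h1 : 0 < g t (u.1, i.1 * u.1 + i.2) := by
        by_contra hc
        push Not at hc
        rcases hc.lt_or_eq with hc | hc
        · obtain ⟨z, hz, hz1, _, hz2, hz3⟩ := cross hP hi.1 ht hi.2 hu' (B := (u.1, i.1 * u.1 + i.2)) hvu (mul_neg_of_pos_of_neg h hc)
          simp only at hz3
          linarith [hno z hz hz1 hz2]
        · have := hno (u.1, i.1 * u.1 + i.2) ((mem_VV hP).2 ⟨i, hi.1, t, ht, hti.symm, hu', hc⟩) hu' hvu
          simp at this
      exact ⟨h.le, by linarith [hdiff t], h1⟩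
  refine ⟨⟨v, i, j, hi.1, hj.1, hi.2, hjv, hju, by linarith, by linarith, key⟩, ?_⟩
  intro k hk
  by_contra hc
  push Not at hc
  rw [mem_LL] at hk
  have hkv : 0 < g k v := by
    rw [g_key hju hk.2 hjv]
    exact mul_pos_of_neg_of_neg (by linarith) (by linarith)
  have hki : k ≠ i := by rintro rfl; linarith
  rcases key k hk.1 hki with h | h
  · linarith [hdiff k, hk.2]
  · linarith

theorem caseGamma {P : Finset Pt} (hP : Inj P) {v i j u w : Pt} (hpred : Pred P v i j) (hn : Next P j v u)
    (hw : Next P i v w) (hwu : w.1 ≤ u.1) : ∀ k ∈ LL P w, i.1 ≤ k.1 := by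
  obtain ⟨hi, hj, hij, hp⟩ := hpred
  obtain ⟨huV, hjv, hju, hvu, hmin⟩ := hn
  obtain ⟨hwV, hiv, hiw, hvw, hminw⟩ := hw
  rw [mem_LL] at hi hj
  intro k hk
  by_contra hc
  push Not at hc
  rw [mem_LL] at hk
  have hkv : g k v < 0 := by
    rw [g_key hiw hk.2 hiv]
    exact mul_neg_of_pos_of_neg (by linarith) (by linarith)
  have hw' : g j (w.1, j.1 * w.1 + j.2) = 0 := by unfold g; ring
  have h1 : g i (w.1, j.1 * w.1 + j.2) = (j.1 - i.1) * (w.1 - v.1) := g_key hjv hiv hw'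
  have h2 : g k (w.1, j.1 * w.1 + j.2) = g k w + g i (w.1, j.1 * w.1 + j.2) - g i w := by unfold g; ring
  have h3 : 0 < g k (w.1, j.1 * w.1 + j.2) := by
    rw [h2, hk.2, hiw, h1]
    have := mul_pos (sub_pos.2 hij) (sub_pos.2 hvw)
    linarith
  obtain ⟨z, hz, hz1, _, hz2, hz3⟩ := cross hP hj.1 hk.1 hjv hw' hvw (mul_neg_of_neg_of_pos hkv h3)
  simp only at hz3
  linarith [hmin z hz hz1 hz2]

theorem lemmaA {P : Finset Pt} (hP : Inj P) :
    ((VV P).filter (fun u => ¬ Strict P u 1 1)).card + ∑ v ∈ VV P, (LL P v).card ≤ P.card + 3 * (VV P).card := by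
  set sec : Finset (Σ _ : Pt, Pt) := (VV P).sigma (fun v => (LL P v).filter (fun j => ∃ k ∈ LL P v, k.1 < j.1)) with hsec
  have hcard : ∑ v ∈ VV P, (LL P v).card ≤ sec.card + (VV P).card := by
    rw [hsec, Finset.card_sigma, Finset.card_eq_sum_ones, ← Finset.sum_add_distrib]
    apply Finset.sum_le_sum
    intro v hv
    obtain ⟨m, hm, hmin⟩ := Finset.exists_min_image (LL P v) (fun z => z.1) (by
      rw [← Finset.card_pos]; linarith [two_le_deg hP hv])
    have : LL P v ⊆ insert m ((LL P v).filter (fun j => ∃ k ∈ LL P v, k.1 < j.1)) := by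
      intro j hj
      by_cases hjm : j = m
      · simp [hjm]
      · refine Finset.mem_insert_of_mem (Finset.mem_filter.2 ⟨hj, m, hm, ?_⟩)
        exact lt_of_le_of_ne (hmin j hj) (hP.ne (mem_LL.1 hm).1 (mem_LL.1 hj).1 (Ne.symm hjm))
    exact (Finset.card_le_card this).trans (Finset.card_insert_le _ _)
  have hmem : ∀ x ∈ sec, x.1 ∈ VV P ∧ x.2 ∈ P ∧ g x.2 x.1 = 0 ∧ ∃ k ∈ LL P x.1, k.1 < x.2.1 := by
    rintro ⟨v, j⟩ hx
    rw [hsec, Finset.mem_sigma, Finset.mem_filter, mem_LL] at hx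
    exact ⟨hx.1, hx.2.1.1, hx.2.1.2, hx.2.2⟩
  let α : (Σ _ : Pt, Pt) → Prop := fun x => ∀ z ∈ VV P, g x.2 z = 0 → z.1 ≤ x.1.1
  let β : (Σ _ : Pt, Pt) → Prop := fun x => ∃ u ∈ (VV P).filter (fun u => Strict P u 1 1), Next P x.2 x.1 u ∧ ∀ k ∈ LL P u, k.1 ≤ x.2.1
  let γ : (Σ _ : Pt, Pt) → Prop := fun x => ∃ w ∈ VV P, ∃ i, Pred P x.1 i x.2 ∧ Next P i x.1 w ∧ ∀ k ∈ LL P w, i.1 ≤ k.1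
  have hcov : sec ⊆ sec.filter α ∪ sec.filter β ∪ sec.filter γ := by
    intro x hx
    rw [Finset.mem_union, Finset.mem_union, Finset.mem_filter, Finset.mem_filter, Finset.mem_filter]
    obtain ⟨hv, hj, hjv, k, hk, hkj⟩ := hmem x hx
    by_cases hα : α x
    · exact Or.inl (Or.inl ⟨hx, hα⟩)
    · simp only [α] at hα
      push Not at hα
      obtain ⟨z, hz, hjz, hvz⟩ := hα
      obtain ⟨u, hu, _⟩ := exists_next hjv hz hjz hvz
      obtain ⟨i, hi⟩ := exists_pred (mem_LL.2 ⟨hj, hjv⟩) hk hkj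
      by_cases hno : ∀ z ∈ VV P, g i z = 0 → x.1.1 < z.1 → u.1 < z.1
      · have := caseBeta hP hi hu hno
        exact Or.inl (Or.inr ⟨hx, u, Finset.mem_filter.2 ⟨hu.1, this.1⟩, hu, this.2⟩)
      · push Not at hno
        obtain ⟨z, hz, hiz, hvz, hzu⟩ := hno
        obtain ⟨w, hw, hwz⟩ := exists_next (mem_LL.1 hi.1).2 hz hiz hvz
        exact Or.inr ⟨hx, w, hw.1, i, hi, hw, caseGamma hP hi hu hw (hwz.trans hzu)⟩
  have hA : (sec.filter α).card ≤ P.card := by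
    apply Finset.card_le_card_of_forall_subsingleton (fun x j => x.2 = j)
    · intro x hx
      exact ⟨x.2, (hmem x (Finset.mem_filter.1 hx).1).2.1, rfl⟩
    · rintro j hj ⟨v, j1⟩ ⟨hx, h1⟩ ⟨v', j2⟩ ⟨hx', h2⟩
      simp only at h1 h2
      subst h1; subst h2
      rw [Finset.mem_filter] at hx hx'
      have a := hmem _ hx.1
      have b := hmem _ hx'.1
      have c := hx.2 _ b.1 b.2.2.1
      have d := hx'.2 _ a.1 a.2.2.1
      simp only at a b c d
      rw [pt_eq_of_g a.2.2.1 b.2.2.1 (le_antisymm d c)]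
  have hB : (sec.filter β).card ≤ ((VV P).filter (fun u => Strict P u 1 1)).card := by
    apply Finset.card_le_card_of_forall_subsingleton (fun x u => Next P x.2 x.1 u ∧ ∀ k ∈ LL P u, k.1 ≤ x.2.1)
    · intro x hx
      exact (Finset.mem_filter.1 hx).2
    · rintro u hu ⟨v, j⟩ ⟨hx, h1, h1'⟩ ⟨v', j'⟩ ⟨hx', h2, h2'⟩
      rw [Finset.mem_filter] at hx hx'
      have a := hmem _ hx.1
      have b := hmem _ hx'.1
      simp only at *
      have hjj : j = j' := hP a.2.1 b.2.1 (le_antisymm (h2' j (mem_LL.2 ⟨a.2.1, h1.2.2.1⟩)) (h1' j' (mem_LL.2 ⟨b.2.1, h2.2.2.1⟩)))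
      subst hjj
      rw [next_left_unique a.1 b.1 h1 h2]
  have hC : (sec.filter γ).card ≤ (VV P).card := by
    apply Finset.card_le_card_of_forall_subsingleton (fun x w => ∃ i, Pred P x.1 i x.2 ∧ Next P i x.1 w ∧ ∀ k ∈ LL P w, i.1 ≤ k.1)
    · intro x hx
      exact (Finset.mem_filter.1 hx).2
    · rintro w hw ⟨v, j⟩ ⟨hx, i, h1, h1', h1''⟩ ⟨v', j'⟩ ⟨hx', i', h2, h2', h2''⟩
      rw [Finset.mem_filter] at hx hx'
      have a := hmem _ hx.1
      have b := hmem _ hx'.1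
      simp only at *
      have hiP := (mem_LL.1 h1.1).1
      have hiP' := (mem_LL.1 h2.1).1
      have hii : i = i' := hP hiP hiP' (le_antisymm (h1'' i' (mem_LL.2 ⟨hiP', h2'.2.2.1⟩)) (h2'' i (mem_LL.2 ⟨hiP, h1'.2.2.1⟩)))
      subst hii
      have hvv := next_left_unique a.1 b.1 h1' h2'
      subst hvv
      have : j = j' := by
        apply hP a.2.1 b.2.1
        rcases lt_trichotomy j.1 j'.1 with h | h | h
        · linarith [h2.2.2.2 j h1.2.1 h, h1.2.2.1]
        · exact h
        · linarith [h1.2.2.2 j' h2.2.1 h, h2.2.2.1]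
      rw [this]
  have h1 := Finset.card_le_card hcov
  have h2 := Finset.card_union_le (sec.filter α ∪ sec.filter β) (sec.filter γ)
  have h3 := Finset.card_union_le (sec.filter α) (sec.filter β)
  have h4 : ((VV P).filter (fun u => Strict P u 1 1)).card + ((VV P).filter (fun u => ¬ Strict P u 1 1)).card = (VV P).card :=
    Finset.card_filter_add_card_filter_not _
  omega
end Orch

namespace Orch
open scoped Classical

/-- reflection of parameters -/
def rfP (s e : ℝ) (p : Pt) : Pt := (s * e * p.1, e * p.2)
/-- reflection of points -/
def rfZ (s e : ℝ) (z : Pt) : Pt := (s * z.1, e * z.2)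

theorem sq_one_of {s : ℝ} (h : s = 1 ∨ s = -1) : s * s = 1 := by rcases h with rfl | rfl <;> norm_num

theorem g_rf {s e : ℝ} (hs : s * s = 1) (p z : Pt) : g (rfP s e p) (rfZ s e z) = e * g p z := by
  simp only [g, rfP, rfZ]; linear_combination (-e * p.1 * z.1) * hs

theorem rfP_rfP {s e : ℝ} (hs : s * s = 1) (he : e * e = 1) (p : Pt) : rfP s e (rfP s e p) = p := by
  simp only [rfP]
  ext
  · simp only; linear_combination (s * s * p.1) * he + p.1 * hs
  · simp only; linear_combination p.2 * he
theorem rfZ_rfZ {s e : ℝ} (hs : s * s = 1) (he : e * e = 1) (p : Pt) : rfZ s e (rfZ s e p) = p := by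
  simp only [rfZ]
  ext
  · simp only; linear_combination p.1 * hs
  · simp only; linear_combination p.2 * he

theorem lemmaA' {P : Finset Pt} (hP : Inj P) {s e : ℝ} (hs : s = 1 ∨ s = -1) (he : e = 1 ∨ e = -1) :
    ((VV P).filter (fun u => ¬ Strict P u s e)).card + ∑ v ∈ VV P, (LL P v).card ≤ P.card + 3 * (VV P).card := by
  have hs2 := sq_one_of hs
  have he2 := sq_one_of he
  have hs0 : s ≠ 0 := by rintro rfl; simp at hs2
  have he0 : e ≠ 0 := by rintro rfl; simp at he2
  let f : Pt ↪ Pt := ⟨rfP s e, fun a b h => by rw [← rfP_rfP hs2 he2 a, h, rfP_rfP hs2 he2]⟩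
  let h : Pt ↪ Pt := ⟨rfZ s e, fun a b h => by rw [← rfZ_rfZ hs2 he2 a, h, rfZ_rfZ hs2 he2]⟩
  have hQ : Inj (P.map f) := by
    intro x hx y hy hxy
    rw [Finset.mem_coe, Finset.mem_map] at hx hy
    obtain ⟨p, hp, rfl⟩ := hx
    obtain ⟨q, hq, rfl⟩ := hy
    have : p.1 = q.1 := by
      have h1 : s * e * p.1 = s * e * q.1 := hxy
      exact mul_left_cancel₀ (mul_ne_zero hs0 he0) h1
    rw [hP hp hq this]
  have hg : ∀ p z, g (f p) (h z) = e * g p z := fun p z => g_rf hs2 p z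
  have hg0 : ∀ p z, g (f p) (h z) = 0 ↔ g p z = 0 := fun p z => by rw [hg]; simp [he0]
  have hhs : ∀ z, ∃ w, h w = z := fun z => ⟨rfZ s e z, rfZ_rfZ hs2 he2 z⟩
  have hV : VV (P.map f) = (VV P).map h := by
    ext z
    obtain ⟨w, rfl⟩ := hhs z
    rw [mem_VV hQ, Finset.mem_map' h, mem_VV hP]
    constructor
    · rintro ⟨p, hp, q, hq, hpq, h1, h2⟩
      rw [Finset.mem_map] at hp hq
      obtain ⟨p, hp, rfl⟩ := hp
      obtain ⟨q, hq, rfl⟩ := hq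
      exact ⟨p, hp, q, hq, fun e => hpq (e ▸ rfl), (hg0 _ _).1 h1, (hg0 _ _).1 h2⟩
    · rintro ⟨p, hp, q, hq, hpq, h1, h2⟩
      exact ⟨f p, (Finset.mem_map' f).2 hp, f q, (Finset.mem_map' f).2 hq, fun e => hpq (f.injective e), (hg0 _ _).2 h1, (hg0 _ _).2 h2⟩
  have hL : ∀ z, LL (P.map f) (h z) = (LL P z).map f := by
    intro z
    ext q
    rw [mem_LL, Finset.mem_map, Finset.mem_map]
    constructor
    · rintro ⟨⟨p, hp, rfl⟩, h1⟩
      exact ⟨p, mem_LL.2 ⟨hp, (hg0 _ _).1 h1⟩, rfl⟩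
    · rintro ⟨p, hp, rfl⟩
      rw [mem_LL] at hp
      exact ⟨⟨p, hp.1, rfl⟩, (hg0 _ _).2 hp.2⟩
  have hS : ∀ u, Strict (P.map f) (h u) 1 1 → Strict P u s e := by
    rintro u ⟨v, i, j, hi, hj, h1, h2, h3, h4, h5, h6⟩
    obtain ⟨v, rfl⟩ := hhs v
    rw [Finset.mem_map] at hi hj
    obtain ⟨i, hi, rfl⟩ := hi
    obtain ⟨j, hj, rfl⟩ := hj
    rw [hg0] at h1 h2 h3
    have h4' : 0 < s * (u.1 - v.1) := by
      have : (h u).1 - (h v).1 = s * (u.1 - v.1) := by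
        change s * u.1 - s * v.1 = _; ring
      linarith
    refine ⟨v, i, j, hi, hj, h1, h2, h3, h4', by rw [hg] at h5; linarith, ?_⟩
    intro t ht hti
    have h7 := h6 (f t) ((Finset.mem_map' f).2 ht) (fun e => hti (f.injective e))
    have hu' : ((h u).1, (f i).1 * (h u).1 + (f i).2) = h (u.1, i.1 * u.1 + i.2) := by
      change (s * u.1, s * e * i.1 * (s * u.1) + e * i.2) = (s * u.1, e * (i.1 * u.1 + i.2))
      ext
      · rfl
      · simp only; linear_combination (e * i.1 * u.1) * hs2
    rw [hu', hg, hg, hg] at h7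
    rcases he with rfl | rfl
    · simpa using h7
    · simp only [neg_mul, one_mul, Left.nonneg_neg_iff, Left.neg_nonpos_iff, Left.neg_pos_iff, Left.neg_neg_iff] at h7
      tauto
  have main := lemmaA hQ
  rw [hV, Finset.card_map, Finset.card_map, Finset.sum_map] at main
  simp only [hL, Finset.card_map] at main
  refine le_trans (Nat.add_le_add_right ?_ _) main
  rw [Finset.filter_map, Finset.card_map]
  apply Finset.card_le_card
  intro u hu
  rw [Finset.mem_filter] at hu ⊢
  exact ⟨hu.1, fun hc => hu.2 (hS u hc)⟩

/-- triangular face -/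
def Face (P : Finset Pt) (A B C : Pt) : Prop :=
  (∃ p ∈ P, g p A = 0 ∧ g p B = 0 ∧ g p C ≠ 0) ∧ (∃ p ∈ P, g p B = 0 ∧ g p C = 0 ∧ g p A ≠ 0) ∧
  (∃ p ∈ P, g p A = 0 ∧ g p C = 0 ∧ g p B ≠ 0) ∧
  ∀ t ∈ P, (0 ≤ g t A ∧ 0 ≤ g t B ∧ 0 ≤ g t C) ∨ (g t A ≤ 0 ∧ g t B ≤ 0 ∧ g t C ≤ 0)

theorem Face.swap12 {P : Finset Pt} {A B C : Pt} (h : Face P A B C) : Face P B A C := by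
  obtain ⟨⟨p, hp, p1, p2, p3⟩, ⟨q, hq, q1, q2, q3⟩, ⟨r, hr, r1, r2, r3⟩, h⟩ := h
  exact ⟨⟨p, hp, p2, p1, p3⟩, ⟨r, hr, r1, r2, r3⟩, ⟨q, hq, q1, q2, q3⟩, fun t ht => by have := h t ht; tauto⟩
theorem Face.swap23 {P : Finset Pt} {A B C : Pt} (h : Face P A B C) : Face P A C B := by
  obtain ⟨⟨p, hp, p1, p2, p3⟩, ⟨q, hq, q1, q2, q3⟩, ⟨r, hr, r1, r2, r3⟩, h⟩ := h
  exact ⟨⟨r, hr, r1, r2, r3⟩, ⟨q, hq, q2, q1, q3⟩, ⟨p, hp, p1, p2, p3⟩, fun t ht => by have := h t ht; tauto⟩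
theorem Face.rot {P : Finset Pt} {A B C : Pt} (h : Face P A B C) : Face P B C A := h.swap12.swap23

theorem Face.ne {P : Finset Pt} {A B C : Pt} (h : Face P A B C) : A ≠ B := by
  obtain ⟨_, ⟨q, hq, q1, q2, q3⟩, _⟩ := h
  rintro rfl
  exact q3 q1

theorem Face.ne_fst {P : Finset Pt} {A B C : Pt} (h : Face P A B C) : A.1 ≠ B.1 := by
  have h2 := h.ne
  obtain ⟨⟨p, hp, p1, p2, p3⟩, _⟩ := h
  intro e
  exact h2 (pt_eq_of_g p1 p2 e)

theorem Face.mem {P : Finset Pt} (hP : Inj P) {A B C : Pt} (h : Face P A B C) : A ∈ VV P := by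
  obtain ⟨⟨p, hp, p1, p2, p3⟩, _, ⟨r, hr, r1, r2, r3⟩, h⟩ := h
  exact (mem_VV hP).2 ⟨p, hp, r, hr, by rintro rfl; exact p3 r2, p1, r1⟩

/-- no dual line separates -/
def Unsep (P : Finset Pt) (A B : Pt) : Prop := ∀ t ∈ P, 0 ≤ g t A * g t B

theorem Face.unsep {P : Finset Pt} {A B C : Pt} (h : Face P A B C) : Unsep P A B := by
  intro t ht
  rcases h.2.2.2 t ht with h | h
  · exact mul_nonneg h.1 h.2.1
  · exact mul_nonneg_of_nonpos_of_nonpos h.1 h.2.1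

theorem Face.side {P : Finset Pt} {A B C p : Pt} (h : Face P A B C) (h1 : g p A = 0) (h2 : g p B = 0) :
    p ∈ P ∧ g p C ≠ 0 := by
  have hne := h.ne
  obtain ⟨⟨q, hq, q1, q2, q3⟩, _⟩ := h
  have := line_eq_of_g h1 h2 q1 q2 hne
  subst this
  exact ⟨hq, q3⟩

/-- neighbor uniqueness -/
theorem nb_unique {P : Finset Pt} (hP : Inj P) {p A B B' : Pt} (hp : p ∈ P) (hA : g p A = 0) (hB : g p B = 0)
    (hB' : g p B' = 0) (h : 0 < (B.1 - A.1) * (B'.1 - A.1)) (u : Unsep P A B) (u' : Unsep P A B')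
    (hBV : B ∈ VV P) (hBV' : B' ∈ VV P) : B = B' := by
  have aux : ∀ B ∈ VV P, g p B = 0 → ∃ q ∈ P, q ≠ p ∧ g q B = 0 := by
    intro B hBV hB
    obtain ⟨q, hq, r, hr, hqr, h1, h2⟩ := (mem_VV hP).1 hBV
    by_cases hqp : q = p
    · exact ⟨r, hr, by rw [← hqp]; exact hqr.symm, h2⟩
    · exact ⟨q, hq, hqp, h1⟩
  have main : ∀ B B', g p B = 0 → g p B' = 0 → B ∈ VV P → 0 < (B.1 - A.1) * (B'.1 - A.1) → Unsep P A B' →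
      0 ≤ (A.1 - B.1) * (B'.1 - B.1) := by
    intro B B' hB hB' hBV h u'
    obtain ⟨q, hq, hqp, hqB⟩ := aux B hBV hB
    have h1 := g_key hB hqB hA
    have h2 := g_key hB hqB hB'
    have h3 := u' q hq
    rw [h1, h2] at h3
    have hne := sub_ne_zero.2 (hP.ne hp hq hqp.symm)
    have hsq : 0 < (p.1 - q.1)^2 := by positivity
    by_contra hc
    push Not at hc
    nlinarith [mul_pos_of_neg_of_neg (neg_lt_zero.2 hsq) hc]
  apply pt_eq_of_g hB hB'
  have h1 := main B B' hB hB' hBV h u'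
  have h2 := main B' B hB' hB hBV' (by linarith) u
  by_contra hne
  have : 0 < (B.1 - B'.1)^2 := by
    have := sub_ne_zero.2 hne
    positivity
  nlinarith

theorem bary {p q A B C : Pt} (D : Pt) (hA : g p A = 0) (hB : g p B = 0) (hC : g p C ≠ 0) (hAB : A.1 ≠ B.1) :
    ∃ α β γ : ℝ, α + β + γ = 1 ∧ (∀ t, g t D = α * g t A + β * g t B + γ * g t C) ∧
      D = (α * A.1 + β * B.1 + γ * C.1, α * A.2 + β * B.2 + γ * C.2) := by
  have hAB' := sub_ne_zero.2 hAB.symm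
  have hB' := sub_ne_zero.2 hAB
  set γ := g p D / g p C with hγ
  have hγ' : γ * g p C = g p D := by rw [hγ]; field_simp
  set β := (D.1 - A.1 - γ * (C.1 - A.1)) / (B.1 - A.1) with hβ
  have hβ' : β * (B.1 - A.1) = D.1 - A.1 - γ * (C.1 - A.1) := by rw [hβ]; field_simp
  have e1 : D.1 = (1 - β - γ) * A.1 + β * B.1 + γ * C.1 := by linarith
  have e2 : D.2 = (1 - β - γ) * A.2 + β * B.2 + γ * C.2 := by
    unfold g at hγ' hA hB
    linear_combination (-(1 - β - γ)) * hA - β * hB - hγ' + p.1 * e1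
  refine ⟨1 - β - γ, β, γ, by ring, ?_, Prod.ext e1 e2⟩
  intro t
  unfold g
  rw [e1, e2]; ring

/-- uniqueness of a face given an edge and a side -/
theorem face_unique {P : Finset Pt} {p A B C C' : Pt} (h : Face P A B C) (h' : Face P A B C')
    (hA : g p A = 0) (hB : g p B = 0) (hs : 0 < g p C * g p C') : C = C' := by
  have hw := h
  have hw' := h'
  have hAB := h.ne_fst
  have hC := (h.side hA hB).2
  obtain ⟨α, β, γ, hsum, hbar, hD⟩ := bary (q := p) C' hA hB hC hAB
  obtain ⟨_, ⟨q, hq, q1, q2, q3⟩, ⟨r, hr, r1, r2, r3⟩, _⟩ := h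
  obtain ⟨_, ⟨q', hq', q1', q2', q3'⟩, ⟨r', hr', r1', r2', r3'⟩, _⟩ := h'
  have hγ : 0 < γ := by
    have := hbar p
    rw [hA, hB] at this
    rw [this] at hs
    have h2 : 0 < (g p C)^2 := by positivity
    by_contra hc
    push Not at hc
    nlinarith [mul_nonneg h2.le (neg_nonneg.2 hc)]
  have a1 : 0 ≤ α := by
    have h1 := hbar q
    rw [q1, q2] at h1
    have h2 := hw'.swap23.unsep q hq
    rw [h1] at h2
    have h3 : 0 < (g q A)^2 := by positivity
    by_contra hc
    push Not at hc
    nlinarith [mul_pos h3 (neg_pos.2 hc)]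
  have b1 : 0 ≤ β := by
    have h1 := hbar r
    rw [r1, r2] at h1
    have h2 := hw'.rot.unsep r hr
    rw [h1] at h2
    have h3 : 0 < (g r B)^2 := by positivity
    by_contra hc
    push Not at hc
    nlinarith [mul_pos h3 (neg_pos.2 hc)]
  have a2 : α ≤ 0 := by
    have h1 := hbar q'
    rw [q1', q2'] at h1
    have h2 := hw.swap23.unsep q' hq'
    have h3 : 0 < (g q' A)^2 := by positivity
    by_contra hc
    push Not at hc
    have h5 : (g q' A)^2 * α + γ * (g q' A * g q' C) = 0 := by linear_combination (-(g q' A)) * h1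
    linarith [mul_pos h3 hc, mul_nonneg hγ.le h2]
  have b2 : β ≤ 0 := by
    have h1 := hbar r'
    rw [r1', r2'] at h1
    have h2 := hw.rot.unsep r' hr'
    have h3 : 0 < (g r' B)^2 := by positivity
    by_contra hc
    push Not at hc
    have h5 : (g r' B)^2 * β + γ * (g r' B * g r' C) = 0 := by linear_combination (-(g r' B)) * h1
    linarith [mul_pos h3 hc, mul_nonneg hγ.le h2]
  have ha : α = 0 := le_antisymm a2 a1
  have hb : β = 0 := le_antisymm b2 b1
  have hg : γ = 1 := by linarith
  rw [hD, ha, hb, hg]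
  simp

theorem strict_face {P : Finset Pt} {u : Pt} {e : ℝ} (h1 : Strict P u 1 e) (h2 : Strict P u (-1) e) (he : e = 1 ∨ e = -1) :
    ∃ v w i, Face P v u w ∧ v.1 < u.1 ∧ u.1 < w.1 ∧ g i v = 0 ∧ g i w = 0 ∧ 0 < e * g i u := by
  obtain ⟨v, i, j, hi, hj, a1, a2, a3, a4, a5, a6⟩ := h1
  obtain ⟨w, k, l, hk, hl, b1, b2, b3, b4, b5, b6⟩ := h2
  have dif : ∀ i t, g t u = g t (u.1, i.1 * u.1 + i.2) + g i u := by intro i t; unfold g; ring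
  have dif2 : g i (u.1, k.1 * u.1 + k.2) = - g k (u.1, i.1 * u.1 + i.2) := by unfold g; ring
  have hik : k = i := by
    by_contra hne
    have c1 := a6 k hk hne
    have c2 := b6 i hi (Ne.symm hne)
    rcases he with rfl | rfl
    · rcases c1 with c1 | c1 <;> rcases c2 with c2 | c2 <;> linarith
    · rcases c1 with c1 | c1 <;> rcases c2 with c2 | c2 <;> linarith
  subst hik
  have hku : g k u ≠ 0 := fun h => by rw [h] at a5; simp at a5
  have hjk : j ≠ k := by rintro rfl; exact hku a3
  have hlk : l ≠ k := by rintro rfl; exact hku b3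
  have hvu : v.1 < u.1 := by linarith
  have huw : u.1 < w.1 := by linarith
  have hjw : g j w ≠ 0 := by
    intro h
    exact hjk (line_eq_of_g a2 h a1 b1 (fun e => by rw [e] at hvu; linarith))
  have hlv : g l v ≠ 0 := by
    intro h
    exact hlk (line_eq_of_g h b2 a1 b1 (fun e => by rw [e] at hvu; linarith))
  refine ⟨v, w, k, ⟨⟨j, hj, a2, a3, hjw⟩, ⟨l, hl, b3, b2, hlv⟩, ⟨k, hk, a1, b1, hku⟩, ?_⟩, hvu, huw, a1, b1, a5⟩
  intro t ht
  by_cases htk : t = k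
  · subst htk
    rcases le_total 0 (g t u) with h | h
    · exact Or.inl ⟨a1.ge, h, b1.ge⟩
    · exact Or.inr ⟨a1.le, h, b1.le⟩
  · have c1 := a6 t ht htk
    have c2 := b6 t ht htk
    rcases c1 with c1 | c1 <;> rcases c2 with c2 | c2
    · exact Or.inl ⟨c1.1, c1.2.1, c2.1⟩
    · linarith
    · linarith
    · exact Or.inr ⟨c1.1, c1.2.1, c2.1⟩
end Orch

namespace Orch
open scoped Classical

/-- ordered faces -/
noncomputable def FT (P : Finset Pt) : Finset (Pt × Pt × Pt) :=
  ((VV P) ×ˢ (VV P) ×ˢ (VV P)).filter (fun x => Face P x.1 x.2.1 x.2.2)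

theorem mem_FT {P : Finset Pt} (hP : Inj P) {A B C : Pt} : (A, B, C) ∈ FT P ↔ Face P A B C := by
  unfold FT
  rw [Finset.mem_filter, Finset.mem_product, Finset.mem_product]
  exact ⟨fun h => h.2, fun h => ⟨⟨h.mem hP, h.rot.mem hP, h.rot.rot.mem hP⟩, h⟩⟩

theorem sorted_le {P : Finset Pt} (hP : Inj P) :
    6 * ((FT P).filter (fun x => x.1.1 < x.2.1.1 ∧ x.2.1.1 < x.2.2.1)).card ≤ (FT P).card := by
  set m1 := (FT P).filter (fun x => x.1.1 < x.2.1.1 ∧ x.2.1.1 < x.2.2.1) with hm1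
  set m2 := (FT P).filter (fun x => x.2.2.1 < x.2.1.1 ∧ x.2.1.1 < x.1.1) with hm2
  set B := (FT P).filter (fun x => (x.1.1 - x.2.1.1) * (x.2.2.1 - x.2.1.1) < 0) with hB
  set A := (FT P).filter (fun x => (x.2.1.1 - x.1.1) * (x.2.2.1 - x.1.1) < 0) with hA
  set C := (FT P).filter (fun x => (x.1.1 - x.2.2.1) * (x.2.1.1 - x.2.2.1) < 0) with hC
  have h12 : m1.card ≤ m2.card := by
    apply Finset.card_le_card_of_injOn (fun x => (x.2.2, x.2.1, x.1))
    · rintro ⟨a, b, c⟩ h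
      rw [Finset.mem_coe, hm1, Finset.mem_filter, mem_FT hP] at h
      rw [Finset.mem_coe, hm2, Finset.mem_filter, mem_FT hP]
      exact ⟨h.1.rot.swap12, h.2⟩
    · rintro ⟨a, b, c⟩ _ ⟨a', b', c'⟩ _ h
      simp only [Prod.mk.injEq] at h ⊢
      tauto
  have hdB : m1.card + m2.card ≤ B.card := by
    rw [← Finset.card_union_of_disjoint]
    · apply Finset.card_le_card
      rintro ⟨a, b, c⟩ h
      rw [Finset.mem_union, hm1, hm2, Finset.mem_filter, Finset.mem_filter] at h
      rw [hB, Finset.mem_filter]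
      rcases h with h | h
      · exact ⟨h.1, mul_neg_of_neg_of_pos (by linarith) (by linarith)⟩
      · exact ⟨h.1, mul_neg_of_pos_of_neg (by linarith) (by linarith)⟩
    · rw [Finset.disjoint_left]
      intro x h h'
      rw [hm1, Finset.mem_filter] at h
      rw [hm2, Finset.mem_filter] at h'
      linarith
  have hBA : B.card ≤ A.card := by
    apply Finset.card_le_card_of_injOn (fun x => (x.2.1, x.1, x.2.2))
    · rintro ⟨a, b, c⟩ h
      rw [Finset.mem_coe, hB, Finset.mem_filter, mem_FT hP] at h
      rw [Finset.mem_coe, hA, Finset.mem_filter, mem_FT hP]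
      exact ⟨h.1.swap12, h.2⟩
    · rintro ⟨a, b, c⟩ _ ⟨a', b', c'⟩ _ h
      simp only [Prod.mk.injEq] at h ⊢
      tauto
  have hBC : B.card ≤ C.card := by
    apply Finset.card_le_card_of_injOn (fun x => (x.1, x.2.2, x.2.1))
    · rintro ⟨a, b, c⟩ h
      rw [Finset.mem_coe, hB, Finset.mem_filter, mem_FT hP] at h
      rw [Finset.mem_coe, hC, Finset.mem_filter, mem_FT hP]
      exact ⟨h.1.swap23, h.2⟩
    · rintro ⟨a, b, c⟩ _ ⟨a', b', c'⟩ _ h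
      simp only [Prod.mk.injEq] at h ⊢
      tauto
  have hABC : A.card + B.card + C.card ≤ (FT P).card := by
    have aux : ∀ x y z : ℝ, ¬ ((y - x) * (z - x) < 0 ∧ (x - y) * (z - y) < 0) := by
      rintro x y z ⟨h1, h2⟩
      nlinarith [sq_nonneg (x - y)]
    rw [← Finset.card_union_of_disjoint, ← Finset.card_union_of_disjoint]
    · apply Finset.card_le_card
      intro x h
      rw [Finset.mem_union, Finset.mem_union, hA, hB, hC, Finset.mem_filter, Finset.mem_filter, Finset.mem_filter] at h
      tauto
    · rw [Finset.disjoint_left]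
      intro x h h'
      rw [Finset.mem_union, hA, hB, Finset.mem_filter, Finset.mem_filter] at h
      rw [hC, Finset.mem_filter] at h'
      rcases h with h | h
      · exact aux x.1.1 x.2.2.1 x.2.1.1 ⟨by linarith [h.2], h'.2⟩
      · exact aux x.2.1.1 x.2.2.1 x.1.1 ⟨by linarith [h.2], by linarith [h'.2]⟩
    · rw [Finset.disjoint_left]
      intro x h h'
      rw [hA, Finset.mem_filter] at h
      rw [hB, Finset.mem_filter] at h'
      exact aux x.1.1 x.2.1.1 x.2.2.1 ⟨h.2, h'.2⟩
  omega

theorem faces_ge {P : Finset Pt} (hP : Inj P) :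
    12 * (VV P).card + 24 * (∑ v ∈ VV P, (LL P v).card) ≤ (FT P).card + 24 * (P.card + 3 * (VV P).card) := by
  have hb : ∀ e : ℝ, e = 1 ∨ e = -1 → (VV P).card + 2 * (∑ v ∈ VV P, (LL P v).card) ≤
      ((FT P).filter (fun x => (x.1.1 < x.2.1.1 ∧ x.2.1.1 < x.2.2.1) ∧ ∃ i, g i x.1 = 0 ∧ g i x.2.2 = 0 ∧ 0 < e * g i x.2.1)).card
       + 2 * (P.card + 3 * (VV P).card) := by
    intro e he
    have h1 := lemmaA' hP (s := 1) (Or.inl rfl) he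
    have h2 := lemmaA' hP (s := -1) (Or.inr rfl) he
    have h3 : (VV P).card ≤ ((VV P).filter (fun u => ¬ Strict P u 1 e)).card + ((VV P).filter (fun u => ¬ Strict P u (-1) e)).card
        + ((VV P).filter (fun u => Strict P u 1 e ∧ Strict P u (-1) e)).card := by
      refine le_trans (Finset.card_le_card ?_) ((Finset.card_union_le _ _).trans (Nat.add_le_add_right (Finset.card_union_le _ _) _))
      intro u hu
      simp only [Finset.mem_union, Finset.mem_filter]
      tauto
    have h4 : ((VV P).filter (fun u => Strict P u 1 e ∧ Strict P u (-1) e)).card ≤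
        ((FT P).filter (fun x => (x.1.1 < x.2.1.1 ∧ x.2.1.1 < x.2.2.1) ∧ ∃ i, g i x.1 = 0 ∧ g i x.2.2 = 0 ∧ 0 < e * g i x.2.1)).card := by
      apply Finset.card_le_card_of_forall_subsingleton (fun u x => x.2.1 = u)
      · intro u hu
        rw [Finset.mem_filter] at hu
        obtain ⟨v, w, i, h1, h2, h3, h4, h5, h6⟩ := strict_face hu.2.1 hu.2.2 he
        exact ⟨(v, u, w), Finset.mem_filter.2 ⟨(mem_FT hP).2 h1, ⟨h2, h3⟩, i, h4, h5, h6⟩, rfl⟩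
      · rintro x hx u ⟨_, h⟩ u' ⟨_, h'⟩
        rw [← h, ← h']
    omega
  have h1 := hb 1 (Or.inl rfl)
  have h2 := hb (-1) (Or.inr rfl)
  have h3 : ((FT P).filter (fun x => (x.1.1 < x.2.1.1 ∧ x.2.1.1 < x.2.2.1) ∧ ∃ i, g i x.1 = 0 ∧ g i x.2.2 = 0 ∧ 0 < (1:ℝ) * g i x.2.1)).card
     + ((FT P).filter (fun x => (x.1.1 < x.2.1.1 ∧ x.2.1.1 < x.2.2.1) ∧ ∃ i, g i x.1 = 0 ∧ g i x.2.2 = 0 ∧ 0 < (-1:ℝ) * g i x.2.1)).card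
     ≤ ((FT P).filter (fun x => x.1.1 < x.2.1.1 ∧ x.2.1.1 < x.2.2.1)).card := by
    rw [← Finset.card_union_of_disjoint]
    · apply Finset.card_le_card
      intro x h
      rw [Finset.mem_union, Finset.mem_filter, Finset.mem_filter] at h
      rw [Finset.mem_filter]
      tauto
    · rw [Finset.disjoint_left]
      intro x h h'
      rw [Finset.mem_filter] at h h'
      obtain ⟨_, ⟨h1, h2⟩, i, i1, i2, i3⟩ := h
      obtain ⟨_, _, j, j1, j2, j3⟩ := h'
      have : i = j := line_eq_of_g i1 i2 j1 j2 (fun e => by rw [e] at h1; linarith)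
      subst this
      linarith
  have h4 := sorted_le hP
  omega

/-- filled slot -/
def Filled (P : Finset Pt) (v p : Pt) (s e : ℝ) : Prop :=
  ∃ B C, Face P v B C ∧ g p B = 0 ∧ 0 < s * (B.1 - v.1) ∧ 0 < e * g p C

/-- sign -/
noncomputable def sg (b : Bool) : ℝ := if b then 1 else -1
theorem sg_pm (b : Bool) : sg b = 1 ∨ sg b = -1 := by cases b <;> simp [sg]
theorem exists_sg {x : ℝ} (h : x ≠ 0) : ∃ b, 0 < sg b * x := by
  rcases lt_or_gt_of_ne h with h | h
  · exact ⟨false, by simp [sg, h]⟩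
  · exact ⟨true, by simp [sg, h]⟩
theorem sg_mul {b : Bool} {x y : ℝ} (h1 : 0 < sg b * x) (h2 : 0 < sg b * y) : 0 < x * y := by
  have := mul_pos h1 h2
  have h3 := sq_one_of (sg_pm b)
  have : sg b * x * (sg b * y) = x * y := by linear_combination (x * y) * h3
  linarith

/-- good vertex -/
def Good (P : Finset Pt) (v : Pt) : Prop :=
  (LL P v).card = 3 ∧ ∀ p ∈ LL P v, ∀ b c, Filled P v p (sg b) (sg c)

/-- all slots -/
noncomputable def slots (P : Finset Pt) : Finset ((Σ _ : Pt, Pt) × (Bool × Bool)) :=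
  ((VV P).sigma (fun v => LL P v)) ×ˢ Finset.univ

theorem empty_le {P : Finset Pt} (hP : Inj P) (hN : (bad P).card ≤ 2 * P.card) :
    ((slots P).filter (fun x => ¬ Filled P x.1.1 x.1.2 (sg x.2.1) (sg x.2.2))).card ≤ 44 * P.card := by
  have h1 : ((slots P).filter (fun x => Filled P x.1.1 x.1.2 (sg x.2.1) (sg x.2.2))).card +
    ((slots P).filter (fun x => ¬ Filled P x.1.1 x.1.2 (sg x.2.1) (sg x.2.2))).card = (slots P).card :=
    Finset.card_filter_add_card_filter_not _
  have h2 : (slots P).card = 4 * ∑ v ∈ VV P, (LL P v).card := by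
    unfold slots
    rw [Finset.card_product, Finset.card_sigma, mul_comm]
    rfl
  have h3 : (FT P).card ≤ ((slots P).filter (fun x => Filled P x.1.1 x.1.2 (sg x.2.1) (sg x.2.2))).card := by
    apply Finset.card_le_card_of_forall_subsingleton (fun t x => x.1.1 = t.1 ∧ g x.1.2 t.1 = 0 ∧ g x.1.2 t.2.1 = 0 ∧
      0 < sg x.2.1 * (t.2.1.1 - t.1.1) ∧ 0 < sg x.2.2 * g x.1.2 t.2.2)
    · rintro ⟨A, B, C⟩ h
      rw [mem_FT hP] at h
      have hF := h
      obtain ⟨⟨p, hp, p1, p2, p3⟩, _⟩ := h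
      obtain ⟨b, hb⟩ := exists_sg (sub_ne_zero.2 hF.ne_fst.symm)
      obtain ⟨c, hc⟩ := exists_sg p3
      refine ⟨(⟨A, p⟩, (b, c)), ?_, rfl, p1, p2, hb, hc⟩
      rw [Finset.mem_filter]
      refine ⟨?_, B, C, hF, p2, hb, hc⟩
      unfold slots
      rw [Finset.mem_product, Finset.mem_sigma, mem_LL]
      exact ⟨⟨hF.mem hP, hp, p1⟩, Finset.mem_univ _⟩
    · rintro ⟨⟨v, p⟩, b, c⟩ hx ⟨A, B, C⟩ ⟨h, h1, h2, h3, h4, h5⟩ ⟨A', B', C'⟩ ⟨h', h1', h2', h3', h4', h5'⟩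
      simp only at *
      subst h1
      subst h1'
      rw [mem_FT hP] at h h'
      have hBB : B = B' := nb_unique hP (h.side h2 h3).1 h2 h3 h3' (sg_mul h4 h4') h.unsep h'.unsep (h.rot.mem hP) (h'.rot.mem hP)
      subst hBB
      have hCC : C = C' := face_unique h h' h2 h3 (sg_mul h5 h5')
      rw [hCC]
  have h4 := faces_ge hP
  have h5 : 3 * (VV P).card ≤ (∑ v ∈ VV P, (LL P v).card) + ((VV P).filter (fun v => (LL P v).card = 2)).card := by
    rw [Finset.card_filter, ← Finset.sum_add_distrib, mul_comm, ← smul_eq_mul, ← Finset.sum_const]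
    apply Finset.sum_le_sum
    intro v hv
    have := two_le_deg hP hv
    split_ifs <;> omega
  have h6 : 2 * ((VV P).filter (fun v => (LL P v).card = 2)).card ≤ (bad P).card := by
    rw [← sum_deg_bad hP]
    calc _ = ∑ v ∈ (VV P).filter (fun v => (LL P v).card = 2), (LL P v).card * ((LL P v).card - 1) := by
          rw [Finset.sum_congr rfl (g := fun _ => 2)]
          · simp [mul_comm]
          · intro v hv
            rw [(Finset.mem_filter.1 hv).2]
      _ ≤ _ := by
          apply Finset.sum_le_sum_of_subset
          intro v hv
          rw [Finset.mem_filter] at *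
          exact ⟨hv.1, by omega⟩
  omega

/-- weight -/
noncomputable def wt (P : Finset Pt) (v : Pt) : ℕ := (LL P v).card * ((LL P v).card - 1)

theorem notGood_le {P : Finset Pt} (hP : Inj P) (hN : (bad P).card ≤ 2 * P.card) :
    ∑ v ∈ (VV P).filter (fun v => ¬ Good P v), wt P v ≤ 266 * P.card := by
  have h1 := empty_le hP hN
  have h2 : ∑ v ∈ (VV P).filter (fun v => (LL P v).card ≠ 3), wt P v = (bad P).card := sum_deg_bad hP
  have h3 : ((VV P).filter (fun v => (LL P v).card = 3 ∧ ¬ Good P v)).card ≤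
     ((slots P).filter (fun x => ¬ Filled P x.1.1 x.1.2 (sg x.2.1) (sg x.2.2))).card := by
    apply Finset.card_le_card_of_forall_subsingleton (fun v x => x.1.1 = v)
    · intro v hv
      rw [Finset.mem_filter] at hv
      obtain ⟨hv, h3, hng⟩ := hv
      unfold Good at hng
      push Not at hng
      obtain ⟨p, hp, b, c, hf⟩ := hng h3
      refine ⟨(⟨v, p⟩, (b, c)), ?_, rfl⟩
      rw [Finset.mem_filter]
      refine ⟨?_, hf⟩
      unfold slots
      rw [Finset.mem_product, Finset.mem_sigma]
      exact ⟨⟨hv, hp⟩, Finset.mem_univ _⟩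
    · rintro x hx u ⟨_, h⟩ u' ⟨_, h'⟩
      rw [← h, ← h']
  have h4 : ∑ v ∈ (VV P).filter (fun v => (LL P v).card = 3 ∧ ¬ Good P v), wt P v =
      6 * ((VV P).filter (fun v => (LL P v).card = 3 ∧ ¬ Good P v)).card := by
    rw [Finset.sum_congr rfl (g := fun _ => 6)]
    · simp [mul_comm]
    · intro v hv
      unfold wt
      rw [(Finset.mem_filter.1 hv).2.1]
  have h5 : ∑ v ∈ (VV P).filter (fun v => ¬ Good P v), wt P v ≤
      ∑ v ∈ (VV P).filter (fun v => (LL P v).card ≠ 3) ∪ (VV P).filter (fun v => (LL P v).card = 3 ∧ ¬ Good P v), wt P v := by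
    apply Finset.sum_le_sum_of_subset
    intro v hv
    simp only [Finset.mem_union, Finset.mem_filter] at *
    tauto
  have h6 : ∑ v ∈ (VV P).filter (fun v => (LL P v).card ≠ 3) ∪ (VV P).filter (fun v => (LL P v).card = 3 ∧ ¬ Good P v), wt P v ≤
     ∑ v ∈ (VV P).filter (fun v => (LL P v).card ≠ 3), wt P v + ∑ v ∈ (VV P).filter (fun v => (LL P v).card = 3 ∧ ¬ Good P v), wt P v := by
    rw [← Finset.sum_union_inter]
    exact Nat.le_add_right _ _
  omega

/-- adjacency -/
def Adj (P : Finset Pt) (v u : Pt) : Prop := u ≠ v ∧ (∃ p ∈ P, g p v = 0 ∧ g p u = 0) ∧ Unsep P v u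

theorem Face.adj {P : Finset Pt} {A B C : Pt} (h : Face P A B C) : Adj P A B := by
  refine ⟨h.ne.symm, ?_, h.unsep⟩
  obtain ⟨⟨p, hp, p1, p2, p3⟩, _⟩ := h
  exact ⟨p, hp, p1, p2⟩

/-- neighbors -/
noncomputable def Nb (P : Finset Pt) (v : Pt) : Finset Pt := (VV P).filter (fun u => Adj P v u)

theorem Nb_le {P : Finset Pt} (hP : Inj P) (v : Pt) : (Nb P v).card ≤ 2 * (LL P v).card := by
  have : 2 * (LL P v).card = ((LL P v) ×ˢ (Finset.univ : Finset Bool)).card := by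
    rw [Finset.card_product, mul_comm]; rfl
  rw [this]
  apply Finset.card_le_card_of_forall_subsingleton (fun u x => g x.1 u = 0 ∧ 0 < sg x.2 * (u.1 - v.1))
  · intro u hu
    unfold Nb at hu
    rw [Finset.mem_filter] at hu
    obtain ⟨_, h1, ⟨p, hp, h2, h3⟩, h4⟩ := hu
    have : u.1 - v.1 ≠ 0 := fun e => h1 (pt_eq_of_g h3 h2 (sub_eq_zero.1 e))
    obtain ⟨b, hb⟩ := exists_sg this
    exact ⟨(p, b), Finset.mem_product.2 ⟨mem_LL.2 ⟨hp, h2⟩, Finset.mem_univ _⟩, h3, hb⟩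
  · rintro ⟨p, b⟩ hx u ⟨hu, h1, h2⟩ u' ⟨hu', h1', h2'⟩
    unfold Nb at hu hu'
    rw [Finset.mem_product, mem_LL] at hx
    rw [Finset.mem_filter] at hu hu'
    exact nb_unique hP hx.1.1 hx.1.2 h1 h1' (sg_mul h2 h2') hu.2.2.2 hu'.2.2.2 hu.1 hu'.1

/-- iterated neighborhoods of the set of vertices that are not good -/
noncomputable def Bd (P : Finset Pt) : ℕ → Finset Pt
  | 0 => (VV P).filter (fun v => ¬ Good P v)
  | k+1 => Bd P k ∪ (Bd P k).biUnion (Nb P)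

theorem Bd_mono {P : Finset Pt} {d : ℕ} : Bd P d ⊆ Bd P (d+1) := by
  rw [Bd]; exact Finset.subset_union_left

theorem Bd_zero {P : Finset Pt} {d : ℕ} : Bd P 0 ⊆ Bd P d := by
  induction d with
  | zero => exact le_rfl
  | succ d ih => exact ih.trans Bd_mono

theorem Bd_sub {P : Finset Pt} {d : ℕ} : Bd P d ⊆ VV P := by
  induction d with
  | zero => exact Finset.filter_subset _ _
  | succ d ih =>
    rw [Bd]
    refine Finset.union_subset ih (Finset.biUnion_subset.2 fun v hv => Finset.filter_subset _ _)

theorem good_of_not_Bd {P : Finset Pt} {d : ℕ} {v : Pt} (hv : v ∈ VV P) (h : v ∉ Bd P d) : Good P v := by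
  by_contra hc
  exact h (Bd_zero (Finset.mem_filter.2 ⟨hv, hc⟩))

theorem Adj.symm {P : Finset Pt} {u v : Pt} (h : Adj P u v) : Adj P v u := by
  obtain ⟨h1, ⟨p, hp, h2, h3⟩, h4⟩ := h
  exact ⟨h1.symm, ⟨p, hp, h3, h2⟩, fun t ht => by linarith [h4 t ht]⟩

theorem not_Bd_of_adj {P : Finset Pt} {d : ℕ} {u v : Pt} (hv : v ∈ VV P) (h : v ∉ Bd P (d+1)) (ha : Adj P v u) : u ∉ Bd P d := by
  intro hu
  apply h
  rw [Bd]
  exact Finset.mem_union_right _ (Finset.mem_biUnion.2 ⟨u, hu, Finset.mem_filter.2 ⟨hv, ha.symm⟩⟩)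

theorem Bd_sum {P : Finset Pt} (hP : Inj P) (d : ℕ) : ∑ v ∈ Bd P (d+1), wt P v ≤ 13 * ∑ v ∈ Bd P d, wt P v := by
  set X := (Bd P d).biUnion (Nb P) \ Bd P d with hX
  have h0 : Bd P (d+1) = Bd P d ∪ X := by rw [Bd, hX, Finset.union_sdiff_self_eq_union]
  have h1 : ∑ v ∈ X, wt P v ≤ 12 * ∑ v ∈ Bd P d, wt P v := by
    calc ∑ v ∈ X, wt P v = ∑ v ∈ X, 6 := by
          apply Finset.sum_congr rfl
          intro v hv
          rw [hX, Finset.mem_sdiff, Finset.mem_biUnion] at hv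
          obtain ⟨⟨u, hu, hvu⟩, hv⟩ := hv
          have := good_of_not_Bd (Finset.mem_filter.1 hvu).1 hv
          unfold wt
          rw [this.1]
      _ = 6 * X.card := by simp [mul_comm]
      _ ≤ 6 * ((Bd P d).biUnion (Nb P)).card := Nat.mul_le_mul_left _ (Finset.card_le_card Finset.sdiff_subset)
      _ ≤ 6 * ∑ v ∈ Bd P d, (Nb P v).card := Nat.mul_le_mul_left _ Finset.card_biUnion_le
      _ ≤ 6 * ∑ v ∈ Bd P d, 2 * wt P v := by
          apply Nat.mul_le_mul_left
          apply Finset.sum_le_sum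
          intro v hv
          refine (Nb_le hP v).trans (Nat.mul_le_mul_left _ ?_)
          unfold wt
          have := two_le_deg hP (Bd_sub hv)
          exact Nat.le_mul_of_pos_right _ (by omega)
      _ = _ := by rw [← Finset.mul_sum]; ring
  rw [h0, Finset.sum_union (by rw [hX]; exact Finset.disjoint_sdiff)]
  omega

/-- badness of a dual line -/
noncomputable def BB (P : Finset Pt) (p : Pt) : ℕ := ∑ v ∈ (Bd P 3).filter (fun v => g p v = 0), ((LL P v).card - 1)

/-- the constant -/
abbrev CC : ℕ := 13 ^ 3 * 266

theorem sum_BB {P : Finset Pt} (hP : Inj P) (hN : (bad P).card ≤ 2 * P.card) :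
    ∑ p ∈ P, BB P p ≤ CC * P.card := by
  have h1 := notGood_le hP hN
  have h2 := Bd_sum hP 0
  have h3 := Bd_sum hP 1
  have h4 := Bd_sum hP 2
  have h5 : ∑ p ∈ P, BB P p = ∑ v ∈ Bd P 3, wt P v := by
    unfold BB
    simp_rw [Finset.sum_filter]
    rw [Finset.sum_comm]
    apply Finset.sum_congr rfl
    intro v hv
    rw [← Finset.sum_filter]
    unfold wt
    rw [Finset.sum_const, smul_eq_mul]
    rfl
  have h6 : Bd P 0 = (VV P).filter (fun v => ¬ Good P v) := rfl
  rw [← h6] at h1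
  simp only [zero_add, Nat.reduceAdd] at h2 h3 h4
  rw [h5]
  have h7 : CC = 584402 := by norm_num [CC]
  rw [h7]
  omega
end Orch

namespace Orch
open scoped Classical

theorem npc {x y z : ℝ} (h1 : x * y < 0) (h2 : 0 < y * z) : x * z < 0 := by
  have h3 : 0 < y * y := by
    have : y ≠ 0 := by rintro rfl; simp at h2
    exact mul_self_pos.2 this
  by_contra hc
  push Not at hc
  have h4 := mul_neg_of_neg_of_pos h1 h2
  have h5 := mul_nonneg h3.le hc
  nlinarith

theorem ppc {x y z : ℝ} (h1 : 0 < x * y) (h2 : 0 < y * z) : 0 < x * z := by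
  have := npc (x := -x) (y := y) (z := z) (by linarith) h2
  linarith

theorem posmul {x y : ℝ} (h : 0 ≤ x * y) (hx : x ≠ 0) (hy : y ≠ 0) : 0 < x * y :=
  lt_of_le_of_ne h (mul_ne_zero hx hy).symm

theorem prod_key {p q O X Y : Pt} (hp : g p O = 0) (hq : g q O = 0) (hX : g p X = 0) (hY : g p Y = 0) :
    g q X * g q Y = (p.1 - q.1)^2 * ((X.1 - O.1) * (Y.1 - O.1)) := by
  rw [g_key hp hq hX, g_key hp hq hY]; ring

theorem key_pos {P : Finset Pt} (hP : Inj P) {p q O X Y : Pt} (h1 : p ∈ P) (h2 : q ∈ P) (hpq : p ≠ q)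
    (hp : g p O = 0) (hq : g q O = 0) (hX : g p X = 0) (hY : g p Y = 0) :
    0 < g q X * g q Y ↔ 0 < (X.1 - O.1) * (Y.1 - O.1) := by
  rw [prod_key hp hq hX hY]
  have := sub_ne_zero.2 (hP.ne h1 h2 hpq)
  have h3 : 0 < (p.1 - q.1)^2 := by positivity
  exact mul_pos_iff_of_pos_left h3

theorem key_neg {P : Finset Pt} (hP : Inj P) {p q O X Y : Pt} (h1 : p ∈ P) (h2 : q ∈ P) (hpq : p ≠ q)
    (hp : g p O = 0) (hq : g q O = 0) (hX : g p X = 0) (hY : g p Y = 0) :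
    g q X * g q Y < 0 ↔ (X.1 - O.1) * (Y.1 - O.1) < 0 := by
  rw [prod_key hp hq hX hY]
  have := sub_ne_zero.2 (hP.ne h1 h2 hpq)
  have h3 : 0 < (p.1 - q.1)^2 := by positivity
  constructor
  · intro h; by_contra hc; push Not at hc; linarith [mul_nonneg h3.le hc]
  · exact fun h => mul_neg_of_pos_of_neg h3 h

theorem no_straight {P : Finset Pt} (hP : Inj P) {p q e X O Y Z : Pt} (hp : p ∈ P) (hq : q ∈ P) (he : e ∈ P)
    (hpq : p ≠ q) (hep : e ≠ p) (heq : e ≠ q) (pX : g p X = 0) (pO : g p O = 0) (pY : g p Y = 0)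
    (qO : g q O = 0) (qZ : g q Z = 0) (hOZ : O ≠ Z) (eO : g e O = 0) (hs : g q X * g q Y < 0)
    (u1 : Unsep P X Z) (u2 : Unsep P Z Y) : False := by
  have h1 := (key_neg hP hp hq hpq pO qO pX pY).1 hs
  have h2 := (key_neg hP hp he hep.symm pO eO pX pY).2 h1
  have h3 := u1 e he
  have h4 := u2 e he
  have h5 : g e Z = 0 := by
    by_contra hc
    have hx : g e X ≠ 0 := by intro h; rw [h] at h2; simp at h2
    have hy : g e Y ≠ 0 := by intro h; rw [h] at h2; simp at h2
    have := ppc (posmul h3 hx hc) (posmul h4 hc hy)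
    linarith
  exact heq (line_eq_of_g eO h5 qO qZ hOZ)

theorem Unsep.symm {P : Finset Pt} {A B : Pt} (h : Unsep P A B) : Unsep P B A := fun t ht => by linarith [h t ht]

theorem good_face {P : Finset Pt} (hP : Inj P) {v p X : Pt} (hv : Good P v) (hp : p ∈ P) (pv : g p v = 0)
    (hX : X ∈ VV P) (pX : g p X = 0) (hne : X ≠ v) (hu : Unsep P v X) {y : ℝ} (hy : y ≠ 0) :
    ∃ C, Face P v X C ∧ 0 < g p C * y := by
  have h1 : X.1 - v.1 ≠ 0 := fun e => hne (pt_eq_of_g pX pv (sub_eq_zero.1 e))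
  obtain ⟨b, hb⟩ := exists_sg h1
  obtain ⟨c, hc⟩ := exists_sg hy
  obtain ⟨B, C, hF, h2, h3, h4⟩ := hv.2 p (mem_LL.2 ⟨hp, pv⟩) b c
  have : B = X := nb_unique hP hp pv h2 pX (sg_mul h3 hb) hF.unsep hu (hF.rot.mem hP) hX
  subst this
  exact ⟨C, hF, sg_mul h4 hc⟩

theorem third {P : Finset Pt} {v a b : Pt} (h : (LL P v).card = 3) (ha : a ∈ LL P v) (hb : b ∈ LL P v) (hab : a ≠ b) :
    ∃ e ∈ P, g e v = 0 ∧ e ≠ a ∧ e ≠ b ∧ LL P v = {a, b, e} := by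
  have : (((LL P v).erase a).erase b).card = 1 := by
    rw [Finset.card_erase_of_mem (Finset.mem_erase.2 ⟨hab.symm, hb⟩), Finset.card_erase_of_mem ha, h]
  obtain ⟨e, he⟩ := Finset.card_eq_one.1 this
  have he' : e ∈ ((LL P v).erase a).erase b := by rw [he]; simp
  rw [Finset.mem_erase, Finset.mem_erase, mem_LL] at he'
  refine ⟨e, he'.2.2.1, he'.2.2.2, he'.2.1, he'.1, ?_⟩
  ext x
  rw [Finset.mem_insert, Finset.mem_insert, Finset.mem_singleton]
  constructor
  · intro hx
    by_cases hxa : x = a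
    · exact Or.inl hxa
    by_cases hxb : x = b
    · exact Or.inr (Or.inl hxb)
    have : x ∈ ((LL P v).erase a).erase b := Finset.mem_erase.2 ⟨hxb, Finset.mem_erase.2 ⟨hxa, hx⟩⟩
    rw [he] at this
    exact Or.inr (Or.inr (Finset.mem_singleton.1 this))
  · rintro (rfl | rfl | rfl)
    · exact ha
    · exact hb
    · exact mem_LL.2 ⟨he'.2.2.1, he'.2.2.2⟩

theorem LL_eq3 {P : Finset Pt} {v a b c : Pt} (h : (LL P v).card = 3) (ha : a ∈ LL P v) (hb : b ∈ LL P v) (hc : c ∈ LL P v)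
    (hab : a ≠ b) (hac : a ≠ c) (hbc : b ≠ c) : LL P v = {a, b, c} := by
  obtain ⟨e, he, he1, hea, heb, hL⟩ := third h ha hb hab
  have : c = e := by
    have := hc
    rw [hL] at this
    simp only [Finset.mem_insert, Finset.mem_singleton] at this
    rcases this with h | h | h
    · exact absurd h.symm hac
    · exact absurd h.symm hbc
    · exact h
  rw [this]; exact hL

theorem or3 {P : Finset Pt} {v a b c x : Pt} (h : (LL P v).card = 3) (ha : a ∈ LL P v) (hb : b ∈ LL P v) (hc : c ∈ LL P v)
    (hab : a ≠ b) (hac : a ≠ c) (hbc : b ≠ c) (hx : x ∈ LL P v) : x = a ∨ x = b ∨ x = c := by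
  rw [LL_eq3 h ha hb hc hab hac hbc] at hx
  simpa using hx

/-- a row of triangles along the dual line `l` -/
structure Row (P : Finset Pt) (d M : ℕ) (l : Pt) (σ : ℝ) (v a b : ℕ → Pt) : Prop where
  hl : l ∈ P
  hv : ∀ i ≤ M, v i ∈ VV P
  hB : ∀ i ≤ M, v i ∉ Bd P d
  hlv : ∀ i ≤ M, g l (v i) = 0
  ha : ∀ i ≤ M, a i ∈ P
  hav : ∀ i ≤ M, g (a i) (v i) = 0
  hb : ∀ i ≤ M, b i ∈ P
  hbv : ∀ i ≤ M, g (b i) (v i) = 0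
  hla : ∀ i ≤ M, l ≠ a i
  hlb : ∀ i ≤ M, l ≠ b i
  hab : ∀ i ≤ M, a i ≠ b i
  up : ∀ i < M, ∃ u, Face P (v i) (v (i+1)) u ∧ g (a i) u = 0 ∧ g (b (i+1)) u = 0 ∧ 0 < σ * g l u
  dn : ∀ i < M, ∃ u, Face P (v i) (v (i+1)) u ∧ g (b i) u = 0 ∧ g (a (i+1)) u = 0 ∧ σ * g l u < 0
  opp : ∀ i, i + 2 ≤ M → ((v i).1 - (v (i+1)).1) * ((v (i+2)).1 - (v (i+1)).1) < 0

theorem Row.swap {P : Finset Pt} {d M : ℕ} {l : Pt} {σ : ℝ} {v a b : ℕ → Pt} (h : Row P d M l σ v a b) :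
    Row P d M l (-σ) v b a where
  hl := h.hl
  hv := h.hv
  hB := h.hB
  hlv := h.hlv
  ha := h.hb
  hav := h.hbv
  hb := h.ha
  hbv := h.hav
  hla := h.hlb
  hlb := h.hla
  hab := fun i hi => (h.hab i hi).symm
  up := fun i hi => by
    obtain ⟨u, h1, h2, h3, h4⟩ := h.dn i hi
    exact ⟨u, h1, h2, h3, by linarith⟩
  dn := fun i hi => by
    obtain ⟨u, h1, h2, h3, h4⟩ := h.up i hi
    exact ⟨u, h1, h2, h3, by linarith⟩
  opp := h.opp

theorem Row.good {P : Finset Pt} {d M : ℕ} {l : Pt} {σ : ℝ} {v a b : ℕ → Pt} (h : Row P d M l σ v a b) {i : ℕ} (hi : i ≤ M) :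
    Good P (v i) := good_of_not_Bd (h.hv i hi) (h.hB i hi)

theorem Row.step {P : Finset Pt} (hP : Inj P) {d M : ℕ} {l : Pt} {σ : ℝ} {v a b : ℕ → Pt}
    (R : Row P (d+1) (M+1) l σ v a b) :
    ∃ (l' : Pt) (σ' : ℝ) (u : ℕ → Pt), Row P d M l' σ' u a (fun i => b (i+1)) := by
  have hup : ∀ i, ∃ u, i ≤ M → Face P (v i) (v (i+1)) u ∧ g (a i) u = 0 ∧ g (b (i+1)) u = 0 ∧ 0 < σ * g l u := by
    intro i
    by_cases hi : i ≤ M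
    · obtain ⟨u, hu⟩ := R.up i (by omega)
      exact ⟨u, fun _ => hu⟩
    · exact ⟨0, fun h => absurd h hi⟩
  choose u hu using hup
  have F : ∀ i ≤ M, Face P (v i) (v (i+1)) (u i) := fun i hi => (hu i hi).1
  have au : ∀ i ≤ M, g (a i) (u i) = 0 := fun i hi => (hu i hi).2.1
  have bu : ∀ i ≤ M, g (b (i+1)) (u i) = 0 := fun i hi => (hu i hi).2.2.1
  have lu : ∀ i ≤ M, 0 < σ * g l (u i) := fun i hi => (hu i hi).2.2.2
  have uV : ∀ i ≤ M, u i ∈ VV P := fun i hi => (F i hi).rot.rot.mem hP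
  have uB : ∀ i ≤ M, u i ∉ Bd P d := fun i hi =>
    not_Bd_of_adj (R.hv i (by omega)) (R.hB i (by omega)) (F i hi).swap23.adj
  have uG : ∀ i ≤ M, Good P (u i) := fun i hi => good_of_not_Bd (uV i hi) (uB i hi)
  have hab1 : ∀ i ≤ M, a i ≠ b (i+1) := by
    intro i hi e
    have := ((F i hi).swap23.side (R.hav i (by omega)) (au i hi)).2
    rw [e] at this
    exact this (R.hbv (i+1) (by omega))
  -- the triangle between
  have T : ∀ i, i + 1 ≤ M → Face P (v (i+1)) (u i) (u (i+1)) := by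
    intro i hi
    have hav := R.hav (i+1) (by omega)
    have hbv := R.hbv (i+1) (by omega)
    have hlv := R.hlv (i+1) (by omega)
    have haP := R.ha (i+1) (by omega)
    have hbP := R.hb (i+1) (by omega)
    have F0 := F i (by omega)
    have F1 := F (i+1) hi
    have hav2 : g (a (i+1)) (v (i+2)) ≠ 0 := (F1.swap23.side hav (au (i+1) hi)).2
    obtain ⟨C, hC, hs⟩ := good_face hP (R.good (by omega : i+1 ≤ M+1)) haP hav (uV (i+1) hi) (au (i+1) hi)
      F1.rot.rot.ne F1.swap23.unsep (neg_ne_zero.2 hav2)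
    obtain ⟨_, _, ⟨r, hr, r1, r2, r3⟩, _⟩ := id hC
    have hra : r ≠ a (i+1) := by rintro rfl; exact r3 (au (i+1) hi)
    rcases or3 (R.good (by omega : i+1 ≤ M+1)).1 (mem_LL.2 ⟨R.hl, hlv⟩) (mem_LL.2 ⟨haP, hav⟩) (mem_LL.2 ⟨hbP, hbv⟩)
      (R.hla _ (by omega)) (R.hlb _ (by omega)) (R.hab _ (by omega)) (mem_LL.2 ⟨hr, r1⟩) with h | h | h
    · exfalso
      subst h
      have hsgn : g (a (i+1)) C * g (a (i+1)) (v (i+2)) < 0 := by linarith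
      have h1 := (key_neg hP R.hl haP (R.hla _ (by omega)) hlv hav r2 (R.hlv (i+2) (by omega))).1 hsgn
      have h2 := R.opp i (by omega)
      have h3 : 0 < (C.1 - (v (i+1)).1) * ((v i).1 - (v (i+1)).1) := by
        have := npc (x := -(C.1 - (v (i+1)).1)) (y := -((v (i+2)).1 - (v (i+1)).1)) (z := (v i).1 - (v (i+1)).1) (by linarith) (by linarith)
        linarith
      have hCv : C = v i := nb_unique hP R.hl hlv r2 (R.hlv i (by omega)) h3 hC.swap23.unsep F0.swap12.unsep
        (hC.rot.rot.mem hP) (R.hv i (by omega))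
      subst hCv
      have h4 : 0 < g r (u (i+1)) * g r (u i) := by
        have h5 := mul_pos (lu (i+1) hi) (lu i (by omega))
        have hσ : 0 < σ * σ := by
          have : σ ≠ 0 := by rintro rfl; simp at h5
          exact mul_self_pos.2 this
        by_contra hc
        push Not at hc
        nlinarith [mul_nonneg hσ.le (neg_nonneg.2 hc)]
      have h6 := face_unique hC.swap23 F0.swap12 hlv (R.hlv i (by omega)) h4
      have h7 := bu i (by omega)
      rw [← h6] at h7
      exact F1.rot.rot.ne (pt_eq_of_lines hP haP hbP (R.hab _ (by omega)) (au _ hi) hav h7 hbv)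
    · exact absurd h hra
    · subst h
      have hlC : g l C ≠ 0 := by
        intro h
        exact hC.swap23.ne (pt_eq_of_lines hP hr R.hl (R.hlb _ (by omega)).symm r1 r2 hlv h)
      have hlu : ∀ i ≤ M, g l (u i) ≠ 0 := fun i hi h => by have := lu i hi; rw [h] at this; simp at this
      have h1 := posmul (hC.rot.unsep l R.hl) (hlu _ hi) hlC
      have h4 : 0 < g l (u i) * g l (u (i+1)) := by
        have h5 := mul_pos (lu (i+1) hi) (lu i (by omega))
        have hσ : 0 < σ * σ := by
          have : σ ≠ 0 := by rintro rfl; simp at h5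
          exact mul_self_pos.2 this
        by_contra hc
        push Not at hc
        nlinarith [mul_nonneg hσ.le (neg_nonneg.2 hc)]
      have h6 := ppc h4 h1
      have h7 := (key_pos hP hr R.hl (R.hlb _ (by omega)).symm r1 hlv (bu i (by omega)) r2).1 h6
      have : u i = C := nb_unique hP hr r1 (bu i (by omega)) r2 h7 F0.rot.unsep hC.swap23.unsep (uV i (by omega)) (hC.rot.rot.mem hP)
      rw [this]
      exact hC.swap23
  -- third sides
  have D : ∀ i, i + 1 ≤ M → ∃ e ∈ P, g e (u i) = 0 ∧ g e (u (i+1)) = 0 ∧ g e (v (i+1)) ≠ 0 ∧ e ≠ a i ∧ e ≠ b (i+1) ∧ e ≠ a (i+1) ∧ e ≠ b (i+2) := by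
    intro i hi
    have T0 := T i hi
    have F0 := F i (by omega)
    have F1 := F (i+1) hi
    obtain ⟨_, ⟨e, he, e1, e2, e3⟩, _⟩ := id T0
    refine ⟨e, he, e1, e2, e3, ?_, ?_, ?_, ?_⟩
    · rintro rfl
      obtain ⟨t, ht, t1, t2, t3, _⟩ := third (uG i (by omega)).1 (mem_LL.2 ⟨he, e1⟩) (mem_LL.2 ⟨R.hb _ (by omega), bu i (by omega)⟩) (hab1 i (by omega))
      have hb1 : g (b (i+1)) (v i) * g (b (i+1)) (v (i+2)) < 0 :=
        (key_neg hP R.hl (R.hb _ (by omega)) (R.hlb _ (by omega)) (R.hlv (i+1) (by omega)) (R.hbv _ (by omega)) (R.hlv _ (by omega)) (R.hlv _ (by omega))).2 (R.opp i (by omega))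
      have hb2 : g (b (i+1)) (v (i+2)) ≠ 0 := by intro h; rw [h] at hb1; simp at hb1
      have hb3 : g (b (i+1)) (u (i+1)) ≠ 0 := (T0.side (R.hbv _ (by omega)) (bu i (by omega))).2
      have hb4 := npc hb1 (posmul (F1.rot.unsep _ (R.hb (i+1) (by omega))) hb2 hb3)
      exact no_straight hP he (R.hb (i+1) (by omega)) ht (hab1 i (by omega)) t2 t3 (R.hav i (by omega)) e1 e2 (bu i (by omega))
        (R.hbv (i+1) (by omega)) F0.rot.ne.symm t1 hb4 F0.unsep F1.swap23.unsep
    · rintro rfl; exact e3 (R.hbv _ (by omega))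
    · rintro rfl; exact e3 (R.hav _ (by omega))
    · rintro rfl
      obtain ⟨t, ht, t1, t2, t3, _⟩ := third (uG (i+1) hi).1 (mem_LL.2 ⟨he, e2⟩) (mem_LL.2 ⟨R.ha _ (by omega), au (i+1) hi⟩) (hab1 (i+1) hi).symm
      have hb1 : g (a (i+1)) (v i) * g (a (i+1)) (v (i+2)) < 0 :=
        (key_neg hP R.hl (R.ha _ (by omega)) (R.hla _ (by omega)) (R.hlv (i+1) (by omega)) (R.hav _ (by omega)) (R.hlv _ (by omega)) (R.hlv _ (by omega))).2 (R.opp i (by omega))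
      have hb2 : g (a (i+1)) (v i) ≠ 0 := by intro h; rw [h] at hb1; simp at hb1
      have hb3 : g (a (i+1)) (u i) ≠ 0 := (T0.swap23.side (R.hav _ (by omega)) (au (i+1) hi)).2
      have hb4 := npc (by linarith : g (a (i+1)) (v (i+2)) * g (a (i+1)) (v i) < 0) (posmul (F0.swap23.unsep _ (R.ha (i+1) (by omega))) hb2 hb3)
      exact no_straight hP he (R.ha (i+1) (by omega)) ht (hab1 (i+1) hi).symm t2 t3 (R.hbv (i+2) (by omega)) e2 e1 (au (i+1) hi)
        (R.hav (i+1) (by omega)) F1.rot.rot.ne t1 hb4 F1.swap12.unsep F0.rot.unsep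
  obtain ⟨l', hl', l1, l2, l3, _⟩ := third (uG 0 (by omega)).1 (mem_LL.2 ⟨R.ha 0 (by omega), au 0 (by omega)⟩)
    (mem_LL.2 ⟨R.hb 1 (by omega), bu 0 (by omega)⟩) (hab1 0 (by omega))
  have D2 : ∀ i, i + 1 ≤ M → ∀ l', l' ∈ P → g l' (u i) = 0 → l' ≠ a i → l' ≠ b (i+1) → g l' (u (i+1)) = 0 ∧ l' ≠ a (i+1) ∧ l' ≠ b (i+2) ∧ g l' (v (i+1)) ≠ 0 := by
    intro i hi l' hl' h1 h2 h3
    obtain ⟨e, he, e1, e2, e3, e4, e5, e6, e7⟩ := D i hi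
    have : e = l' := by
      rcases or3 (uG i (by omega)).1 (mem_LL.2 ⟨R.ha i (by omega), au i (by omega)⟩)
        (mem_LL.2 ⟨R.hb (i+1) (by omega), bu i (by omega)⟩) (mem_LL.2 ⟨hl', h1⟩) (hab1 i (by omega)) h2.symm h3.symm (mem_LL.2 ⟨he, e1⟩) with h | h | h
      · exact absurd h e4
      · exact absurd h e5
      · exact h
    subst this
    exact ⟨e2, e6, e7, e3⟩
  have L : ∀ i ≤ M, g l' (u i) = 0 ∧ l' ≠ a i ∧ l' ≠ b (i+1) := by
    intro i
    induction i with
    | zero => exact fun _ => ⟨l1, l2, l3⟩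
    | succ i ih =>
      intro hi
      obtain ⟨h1, h2, h3⟩ := ih (by omega)
      have := D2 i hi l' hl' h1 h2 h3
      exact ⟨this.1, this.2.1, this.2.2.1⟩
  have Lv : ∀ i, i + 1 ≤ M → g l' (v (i+1)) ≠ 0 := by
    intro i hi
    obtain ⟨h1, h2, h3⟩ := L i (by omega)
    exact (D2 i hi l' hl' h1 h2 h3).2.2.2
  have Ls : ∀ i, i + 1 ≤ M → 0 < g l' (v 1) * g l' (v (i+1)) := by
    intro i
    induction i with
    | zero => intro hi; exact posmul (mul_self_nonneg _) (Lv 0 hi) (Lv 0 hi)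
    | succ i ih =>
      intro hi
      exact ppc (ih (by omega)) (posmul ((F (i+1) (by omega)).unsep l' hl') (Lv i (by omega)) (Lv (i+1) hi))
  refine ⟨l', -(g l' (v 1)), u, ?_⟩
  refine { hl := hl', hv := uV, hB := uB, hlv := fun i hi => (L i hi).1, ha := fun i hi => R.ha i (by omega), hav := au, hb := fun i hi => R.hb (i+1) (by omega), hbv := bu, hla := fun i hi => (L i hi).2.1, hlb := fun i hi => (L i hi).2.2, hab := hab1, up := ?_, dn := ?_, opp := ?_ }
  · intro i hi
    have T0 := T i (by omega)
    obtain ⟨h1, h2, h3⟩ := L i (by omega)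
    obtain ⟨h1', h2', h3'⟩ := L (i+1) (by omega)
    obtain ⟨C, hC, hs⟩ := good_face hP (uG i (by omega)) hl' h1 (uV (i+1) (by omega)) h1' T0.rot.ne.symm T0.rot.unsep (neg_ne_zero.2 (Lv i (by omega)))
    have hs' : g l' (v (i+1)) * g l' C < 0 := by linarith
    have hsides := id hC
    obtain ⟨_, ⟨r', hr', r1', r2', r3'⟩, ⟨r, hr, r1, r2, r3⟩, _⟩ := hsides
    refine ⟨C, hC, ?_, ?_, ?_⟩
    · rcases or3 (uG i (by omega)).1 (mem_LL.2 ⟨R.ha i (by omega), au i (by omega)⟩)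
        (mem_LL.2 ⟨R.hb (i+1) (by omega), bu i (by omega)⟩) (mem_LL.2 ⟨hl', h1⟩) (hab1 i (by omega)) h2.symm h3.symm (mem_LL.2 ⟨hr, r1⟩) with h | h | h
      · rw [← h]; exact r2
      · exfalso
        subst h
        exact no_straight hP hr hl' (R.ha i (by omega)) h3.symm (hab1 i (by omega)) h2.symm (R.hbv (i+1) (by omega)) r1 r2 h1 h1' hC.ne (au i (by omega))
          hs' T0.swap23.unsep hC.rot.unsep
      · subst h; exact absurd h1' r3
    · rcases or3 (uG (i+1) (by omega)).1 (mem_LL.2 ⟨R.ha (i+1) (by omega), au (i+1) (by omega)⟩)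
        (mem_LL.2 ⟨R.hb (i+2) (by omega), bu (i+1) (by omega)⟩) (mem_LL.2 ⟨hl', h1'⟩) (hab1 (i+1) (by omega)) h2'.symm h3'.symm (mem_LL.2 ⟨hr', r1'⟩) with h | h | h
      · exfalso
        subst h
        exact no_straight hP hr' hl' (R.hb (i+2) (by omega)) h2'.symm (hab1 (i+1) (by omega)).symm h3'.symm (R.hav (i+1) (by omega)) r1' r2' h1' h1 hC.ne.symm (bu (i+1) (by omega))
          hs' T0.unsep hC.swap23.unsep
      · change g (b (i+2)) C = 0
        rw [← h]; exact r2'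
      · subst h; exact absurd h1 r3'
    · have := npc (by linarith : g l' C * g l' (v (i+1)) < 0) (by linarith [Ls i (by omega)] : 0 < g l' (v (i+1)) * g l' (v 1))
      linarith
  · intro i hi
    refine ⟨v (i+1), (T i (by omega)).rot, R.hbv _ (by omega), R.hav _ (by omega), ?_⟩
    have := Ls i (by omega)
    linarith
  · intro i hi
    have T0 := T i (by omega)
    have T1 := T (i+1) (by omega)
    have F1 := F (i+1) (by omega)
    have F2 := F (i+2) (by omega)
    have hbP := R.hb (i+2) (by omega)
    have hb1 : g (b (i+2)) (v (i+1)) * g (b (i+2)) (v (i+3)) < 0 :=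
        (key_neg hP R.hl hbP (R.hlb _ (by omega)) (R.hlv (i+2) (by omega)) (R.hbv _ (by omega)) (R.hlv _ (by omega)) (R.hlv _ (by omega))).2 (R.opp (i+1) (by omega))
    have hb2 : g (b (i+2)) (v (i+1)) ≠ 0 := by intro h; rw [h] at hb1; simp at hb1
    have hb3 : g (b (i+2)) (v (i+3)) ≠ 0 := by intro h; rw [h] at hb1; simp at hb1
    have hb4 : g (b (i+2)) (u (i+2)) ≠ 0 := (T1.side (R.hbv _ (by omega)) (bu (i+1) (by omega))).2
    have hb5 : g (b (i+2)) (u i) ≠ 0 := by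
      intro h
      exact (L (i+1) (by omega)).2.2 (line_eq_of_g (L i (by omega)).1 (L (i+1) (by omega)).1 h (bu (i+1) (by omega)) T0.rot.ne)
    have c1 := npc hb1 (posmul (F2.rot.unsep _ hbP) hb3 hb4)
    have c2 := npc (by linarith : g (b (i+2)) (u (i+2)) * g (b (i+2)) (v (i+1)) < 0) (posmul (T0.unsep _ hbP) hb2 hb5)
    have c3 := (key_neg hP hl' hbP (L (i+1) (by omega)).2.2 (L (i+1) (by omega)).1 (bu (i+1) (by omega)) (L (i+2) (by omega)).1 (L i (by omega)).1).1 c2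
    linarith
end Orch

namespace Orch
open scoped Classical

theorem init_row {P : Finset Pt} (hP : Inj P) {d M : ℕ} {l : Pt} (hl : l ∈ P) {v : ℕ → Pt}
    (hv : ∀ i ≤ M+2, v i ∈ VV P) (hB : ∀ i ≤ M+2, v i ∉ Bd P d) (hlv : ∀ i ≤ M+2, g l (v i) = 0)
    (hlt : ∀ i < M+2, (v i).1 < (v (i+1)).1) (hu : ∀ i < M+2, Unsep P (v i) (v (i+1))) :
    ∃ a b, Row P d M l 1 (fun i => v (i+1)) a b := by
  have hne : ∀ i < M+2, v (i+1) ≠ v i := fun i hi e => by have := hlt i hi; rw [e] at this; exact lt_irrefl _ this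
  have hG : ∀ i ≤ M+2, Good P (v i) := fun i hi => good_of_not_Bd (hv i hi) (hB i hi)
  have hU : ∀ i, ∃ U, i < M+2 → Face P (v i) (v (i+1)) U ∧ 0 < g l U := by
    intro i
    by_cases hi : i < M+2
    · obtain ⟨C, h1, h2⟩ := good_face hP (hG i hi.le) hl (hlv i hi.le) (hv _ hi) (hlv _ hi) (hne i hi) (hu i hi) one_ne_zero
      exact ⟨C, fun _ => ⟨h1, by linarith⟩⟩
    · exact ⟨0, fun h => absurd h hi⟩
  have hW : ∀ i, ∃ U, i < M+2 → Face P (v i) (v (i+1)) U ∧ g l U < 0 := by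
    intro i
    by_cases hi : i < M+2
    · obtain ⟨C, h1, h2⟩ := good_face hP (hG i hi.le) hl (hlv i hi.le) (hv _ hi) (hlv _ hi) (hne i hi) (hu i hi)
        (neg_ne_zero.2 one_ne_zero)
      exact ⟨C, fun _ => ⟨h1, by linarith⟩⟩
    · exact ⟨0, fun h => absurd h hi⟩
  choose U hU using hU
  choose W hW using hW
  have hA : ∀ i, ∃ a, i < M+2 → a ∈ P ∧ g a (v i) = 0 ∧ g a (U i) = 0 := by
    intro i
    by_cases hi : i < M+2
    · obtain ⟨_, _, ⟨p, hp, p1, p2, p3⟩, _⟩ := (hU i hi).1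
      exact ⟨p, fun _ => ⟨hp, p1, p2⟩⟩
    · exact ⟨0, fun h => absurd h hi⟩
  have hBb : ∀ i, ∃ a, i < M+2 → a ∈ P ∧ g a (v (i+1)) = 0 ∧ g a (U i) = 0 := by
    intro i
    by_cases hi : i < M+2
    · obtain ⟨_, ⟨p, hp, p1, p2, p3⟩, _, _⟩ := (hU i hi).1
      exact ⟨p, fun _ => ⟨hp, p1, p2⟩⟩
    · exact ⟨0, fun h => absurd h hi⟩
  choose a ha using hA
  choose b hb using hBb
  have hla : ∀ i < M+2, l ≠ a i := fun i hi e => by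
    have h1 := (hU i hi).2
    rw [e, (ha i hi).2.2] at h1; exact lt_irrefl _ h1
  have hlb : ∀ i < M+2, l ≠ b i := fun i hi e => by
    have h1 := (hU i hi).2
    rw [e, (hb i hi).2.2] at h1; exact lt_irrefl _ h1
  have hab : ∀ i, i + 1 < M+2 → a (i+1) ≠ b i := by
    intro i hi e
    obtain ⟨a1, a2, a3⟩ := ha (i+1) hi
    obtain ⟨b1, b2, b3⟩ := hb i (by omega)
    have F1 := hU (i+1) hi
    have F0 := hU i (by omega)
    rw [← e] at b3
    have h1 := (key_pos hP a1 hl (hla _ hi).symm a2 (hlv _ (by omega)) a3 b3).1 (mul_pos F1.2 F0.2)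
    have h2 := nb_unique hP a1 a2 a3 b3 h1 F1.1.swap23.unsep F0.1.rot.unsep (F1.1.rot.rot.mem hP) (F0.1.rot.rot.mem hP)
    obtain ⟨e', he', h3, h4, h5, _⟩ := third (hG (i+1) hi.le).1 (mem_LL.2 ⟨hl, hlv _ hi.le⟩) (mem_LL.2 ⟨a1, a2⟩) (hla _ hi)
    have x1 := hlt i (by omega)
    have x2 := hlt (i+1) hi
    exact no_straight hP hl a1 he' (hla _ hi) h4 h5 (hlv i (by omega)) (hlv (i+1) (by omega)) (hlv (i+1+1) (by omega))
      a2 b3 F0.1.rot.ne h3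
      ((key_neg hP hl a1 (hla _ hi) (hlv _ (by omega)) a2 (hlv i (by omega)) (hlv (i+1+1) (by omega))).2
        (by nlinarith)) F0.1.swap23.unsep (h2 ▸ F1.1.swap12.swap23.unsep.symm)
  refine ⟨fun i => a (i+1), b, ⟨hl, fun i hi => hv _ (by omega), fun i hi => hB _ (by omega), fun i hi => hlv _ (by omega),
    fun i hi => (ha _ (by omega)).1, fun i hi => (ha _ (by omega)).2.1, fun i hi => (hb _ (by omega)).1,
    fun i hi => (hb _ (by omega)).2.1, fun i hi => hla _ (by omega), fun i hi => hlb _ (by omega), fun i hi => hab _ (by omega),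
    ?_, ?_, ?_⟩⟩
  · intro i hi
    exact ⟨U (i+1), (hU _ (by omega)).1, (ha _ (by omega)).2.2, (hb _ (by omega)).2.2, by
      have := (hU (i+1) (by omega)).2; linarith⟩
  · intro i hi
    have F := hU (i+1) (by omega)
    have G := hW (i+1) (by omega)
    have hs : g l (U (i+1)) * g l (W (i+1)) < 0 := mul_neg_of_pos_of_neg F.2 G.2
    obtain ⟨a1, a2, a3⟩ := ha (i+1) (by omega)
    obtain ⟨c1, c2, c3⟩ := ha (i+2) (by omega)
    obtain ⟨b1, b2, b3⟩ := hb i (by omega)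
    obtain ⟨d1, d2, d3⟩ := hb (i+1) (by omega)
    refine ⟨W (i+1), G.1, ?_, ?_, by linarith [G.2]⟩
    · obtain ⟨_, _, ⟨p, hp, p1, p2, p3⟩, _⟩ := G.1
      have hpl : p ≠ l := by rintro rfl; exact absurd p2 G.2.ne
      rcases or3 (hG (i+1) (by omega)).1 (mem_LL.2 ⟨hl, hlv _ (by omega)⟩) (mem_LL.2 ⟨a1, a2⟩) (mem_LL.2 ⟨b1, b2⟩)
        (hla _ (by omega)) (hlb _ (by omega)) (hab i (by omega)) (mem_LL.2 ⟨hp, p1⟩) with h | h | h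
      · exact absurd h hpl
      · subst h
        exact (no_straight hP hp hl b1 hpl (hab i (by omega)).symm (hlb _ (by omega)).symm a3 a2 p2 (hlv _ (by omega))
          (hlv (i+1+1) (by omega)) G.1.ne b2 hs F.1.rot.unsep.symm G.1.rot.unsep).elim
      · exact h ▸ p2
    · obtain ⟨_, ⟨p, hp, p1, p2, p3⟩, _, _⟩ := G.1
      have hpl : p ≠ l := by rintro rfl; exact absurd p2 G.2.ne
      rcases or3 (hG (i+2) (by omega)).1 (mem_LL.2 ⟨hl, hlv _ (by omega)⟩) (mem_LL.2 ⟨c1, c2⟩) (mem_LL.2 ⟨d1, d2⟩)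
        (hla _ (by omega)) (hlb _ (by omega)) (hab (i+1) (by omega)) (mem_LL.2 ⟨hp, p1⟩) with h | h | h
      · exact absurd h hpl
      · exact h ▸ p2
      · subst h
        exact (no_straight hP hp hl c1 hpl (hab (i+1) (by omega)) (hla _ (by omega)).symm d3 d2 p2 (hlv _ (by omega))
          (hlv (i+1) (by omega)) G.1.ne.symm c2 hs F.1.swap23.unsep.symm G.1.swap23.unsep).elim
  · intro i hi
    have x1 := hlt (i+1) (by omega)
    have x2 := hlt (i+2) (by omega)
    show ((v (i+1)).1 - (v (i+1+1)).1) * ((v (i+2+1)).1 - (v (i+1+1)).1) < 0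
    nlinarith [mul_pos (sub_pos.2 x1) (sub_pos.2 x2)]

end Orch

namespace Orch
open scoped Classical

/-- `x,y,z` form an exactly 3-rich line of `P` -/
structure Tri (P : Finset Pt) (x y z : Pt) : Prop where
  hx : x ∈ P
  hy : y ∈ P
  hz : z ∈ P
  hxy : x ≠ y
  hxz : x ≠ z
  hyz : y ≠ z
  col : Col x y z
  all : ∀ r ∈ P, Col x y r → r = x ∨ r = y ∨ r = z

theorem Tri.swap {P : Finset Pt} {x y z : Pt} (h : Tri P x y z) : Tri P y x z :=
  ⟨h.hy, h.hx, h.hz, h.hxy.symm, h.hyz, h.hxz, h.col.swap12, fun r hr hc => by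
    have := h.all r hr hc.swap12; tauto⟩
theorem Tri.swap23 {P : Finset Pt} {x y z : Pt} (h : Tri P x y z) : Tri P x z y :=
  ⟨h.hx, h.hz, h.hy, h.hxz, h.hxy, h.hyz.symm, h.col.swap23, fun r hr hc => by
    have := h.all r hr (Col.trans h.hxz h.col.swap23 hc); tauto⟩
theorem Tri.rot {P : Finset Pt} {x y z : Pt} (h : Tri P x y z) : Tri P y z x := h.swap.swap23

theorem Tri.of_LL {P : Finset Pt} (hP : Inj P) {v a b l : Pt} (ha : a ∈ P) (hb : b ∈ P) (hl : l ∈ P) (hab : a ≠ b) (hla : l ≠ a)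
    (hlb : l ≠ b) (av : g a v = 0) (bv : g b v = 0) (lv : g l v = 0) (h : (LL P v).card = 3) : Tri P a b l := by
  have h1 := VV_LL_eq hP ha hb hab av bv
  refine ⟨ha, hb, hl, hab, hla.symm, hlb.symm, ?_, fun r hr hc => ?_⟩
  · have : l ∈ lin P a b := h1 ▸ mem_LL.2 ⟨hl, lv⟩
    exact (mem_lin.1 this).2
  · have : r ∈ LL P v := h1 ▸ mem_lin.2 ⟨hr, hc⟩
    exact or3 h (mem_LL.2 ⟨ha, av⟩) (mem_LL.2 ⟨hb, bv⟩) (mem_LL.2 ⟨hl, lv⟩) hab hla.symm hlb.symm this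

theorem Row.tri {P : Finset Pt} (hP : Inj P) {d M : ℕ} {l : Pt} {σ : ℝ} {v a b : ℕ → Pt} (R : Row P d M l σ v a b) :
    ∀ i ≤ M, Tri P (a i) (b i) l := fun i hi =>
  Tri.of_LL hP (R.ha i hi) (R.hb i hi) R.hl (R.hab i hi) (R.hla i hi) (R.hlb i hi) (R.hav i hi) (R.hbv i hi) (R.hlv i hi)
    (R.good hi).1

/-- a strip of triple lines around the pencil of `p` -/
structure Strip (P : Finset Pt) (p : Pt) (M : ℕ) (a b : ℕ → Pt) (c : ℤ → Pt) : Prop where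
  hp : c 0 = p
  tri : ∀ i ≤ M, ∀ j ≤ M, ∀ k : ℤ, -3 ≤ k → k ≤ 3 → (j : ℤ) = i + k → Tri P (a i) (b j) (c k)
  ainj : ∀ i ≤ M, ∀ j ≤ M, a i = a j → i = j
  binj : ∀ i ≤ M, ∀ j ≤ M, b i = b j → i = j
  ab : ∀ i ≤ M, ∀ j ≤ M, a i ≠ b j
  ca : ∀ k : ℤ, -3 ≤ k → k ≤ 3 → ∀ i ≤ M, c k ≠ a i
  cb : ∀ k : ℤ, -3 ≤ k → k ≤ 3 → ∀ i ≤ M, c k ≠ b i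
  cinj : ∀ k : ℤ, -3 ≤ k → k ≤ 3 → ∀ l : ℤ, -3 ≤ l → l ≤ 3 → c k = c l → k = l

theorem Row.strip {P : Finset Pt} (hP : Inj P) {M : ℕ} {p : Pt} {σ : ℝ} {v a b : ℕ → Pt} (R : Row P 3 (M+6) p σ v a b)
    (hinj : ∀ i ≤ M+6, ∀ j ≤ M+6, v i = v j → i = j) :
    ∃ c, Strip P p M (fun i => a (i+3)) (fun i => b (i+3)) c := by
  obtain ⟨l1, σ1, u1, R1⟩ := R.step hP
  obtain ⟨l2, σ2, u2, R2⟩ := R1.step hP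
  obtain ⟨l3, σ3, u3, R3⟩ := R2.step hP
  obtain ⟨m1, τ1, w1, S1⟩ := R.swap.step hP
  obtain ⟨m2, τ2, w2, S2⟩ := S1.step hP
  obtain ⟨m3, τ3, w3, S3⟩ := S2.step hP
  set c : ℤ → Pt := fun k => if k = 0 then p else if k = 1 then l1 else if k = 2 then l2 else if k = 3 then l3 else
    if k = -1 then m1 else if k = -2 then m2 else m3 with hc
  have T : ∀ i ≤ M+6, ∀ j ≤ M+6, ∀ k : ℤ, -3 ≤ k → k ≤ 3 → (j : ℤ) = i + k → Tri P (a i) (b j) (c k) := by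
    intro i hi j hj k h1 h2 h3
    interval_cases k
    · obtain rfl : i = j + 3 := by omega
      simpa [hc] using (S3.tri hP j (by omega)).swap
    · obtain rfl : i = j + 2 := by omega
      simpa [hc] using (S2.tri hP j (by omega)).swap
    · obtain rfl : i = j + 1 := by omega
      simpa [hc] using (S1.tri hP j (by omega)).swap
    · obtain rfl : i = j := by omega
      simpa [hc] using (R.tri hP i (by omega))
    · obtain rfl : j = i + 1 := by omega
      simpa [hc] using (R1.tri hP i (by omega))
    · obtain rfl : j = i + 2 := by omega
      simpa [hc] using (R2.tri hP i (by omega))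
    · obtain rfl : j = i + 3 := by omega
      simpa [hc] using (R3.tri hP i (by omega))
  have key : ∀ x ∈ P, x ≠ p → ∀ i ≤ M+6, ∀ j ≤ M+6, g x (v i) = 0 → g x (v j) = 0 → i = j := by
    intro x hx hxp i hi j hj h1 h2
    exact hinj i hi j hj (pt_eq_of_lines hP hx R.hl hxp h1 h2 (R.hlv i hi) (R.hlv j hj))
  refine ⟨c, by simp [hc], ?_, ?_, ?_, ?_, ?_, ?_, ?_⟩
  · intro i hi j hj k h1 h2 h3
    exact T (i+3) (by omega) (j+3) (by omega) k h1 h2 (by push_cast; omega)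
  · intro i hi j hj h
    have := key (a (i+3)) (R.ha _ (by omega)) (R.hla _ (by omega)).symm (i+3) (by omega) (j+3) (by omega) (R.hav _ (by omega))
      (by have := R.hav (j+3) (by omega); rwa [← h] at this)
    omega
  · intro i hi j hj h
    have := key (b (i+3)) (R.hb _ (by omega)) (R.hlb _ (by omega)).symm (i+3) (by omega) (j+3) (by omega) (R.hbv _ (by omega))
      (by have := R.hbv (j+3) (by omega); rwa [← h] at this)
    omega
  · intro i hi j hj h
    have := key (a (i+3)) (R.ha _ (by omega)) (R.hla _ (by omega)).symm (i+3) (by omega) (j+3) (by omega) (R.hav _ (by omega))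
      (by have := R.hbv (j+3) (by omega); rwa [← h] at this)
    obtain rfl : i = j := by omega
    exact R.hab (i+3) (by omega) h
  · intro k h1 h2 i hi
    exact (T (i+3) (by omega) (((i:ℤ)+3+k).toNat) (by omega) k h1 h2 (by omega)).hxz.symm
  · intro k h1 h2 i hi
    exact (T (((i:ℤ)+3-k).toNat) (by omega) (i+3) (by omega) k h1 h2 (by omega)).hyz.symm
  · intro k h1 h2 l h3 h4 h
    have A := T 3 (by omega) ((3+k).toNat) (by omega) k h1 h2 (by omega)
    have B := T 3 (by omega) ((3+l).toNat) (by omega) l h3 h4 (by omega)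
    have h5 := B.col
    rw [← h] at h5
    have h6 := A.all _ B.hy (A.col.swap23.trans A.hxz h5.swap23).swap23.swap23
    have h7 : Col (a 3) (b ((3+k).toNat)) (b ((3+l).toNat)) := A.col.swap23.trans A.hxz h5.swap23
    rcases A.all _ B.hy h7 with h8 | h8 | h8
    · exact absurd h8.symm B.hxy
    · have h9 := key (b ((3+k).toNat)) A.hy (R.hlb _ (by omega)).symm ((3+k).toNat) (by omega) ((3+l).toNat) (by omega)
        (R.hbv _ (by omega)) (by have := R.hbv ((3+l).toNat) (by omega); rwa [h8] at this)
      omega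
    · rw [h] at h8; exact absurd h8 B.hyz

end Orch

namespace Orch
open scoped Classical

/-- points of a strip -/
noncomputable def st (M : ℕ) (a b : ℕ → Pt) : Finset Pt := (Finset.range (M+1)).image a ∪ (Finset.range (M+1)).image b

/-- bad vertices on `p` -/
noncomputable def Zp (P : Finset Pt) (p : Pt) : Finset Pt := (Bd P 3).filter (fun v => g p v = 0)
/-- class -/
noncomputable def cls (P : Finset Pt) (p v : Pt) : ℕ := ((Zp P p).filter (fun z => z.1 < v.1)).card

theorem cls_mono {P : Finset Pt} {p v w : Pt} (h : v.1 ≤ w.1) : cls P p v ≤ cls P p w := by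
  apply Finset.card_le_card
  intro z hz
  rw [Finset.mem_filter] at *
  exact ⟨hz.1, hz.2.trans_le h⟩

theorem cls_lt {P : Finset Pt} {p v w z : Pt} (hz : z ∈ Zp P p) (h1 : v.1 < z.1) (h2 : z.1 < w.1) : cls P p v < cls P p w := by
  apply Finset.card_lt_card
  rw [Finset.ssubset_iff_of_subset]
  · exact ⟨z, Finset.mem_filter.2 ⟨hz, h2⟩, fun h => by rw [Finset.mem_filter] at h; linarith [h.2]⟩
  · intro z hz
    rw [Finset.mem_filter] at *
    exact ⟨hz.1, by linarith⟩

theorem Zp_card {P : Finset Pt} (hP : Inj P) (p : Pt) : (Zp P p).card ≤ BB P p := by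
  unfold BB Zp
  rw [Finset.card_eq_sum_ones]
  apply Finset.sum_le_sum
  intro v hv
  have := two_le_deg hP (Bd_sub (Finset.mem_filter.1 hv).1)
  omega

theorem run_lemma {P : Finset Pt} (hP : Inj P) {p : Pt} (hp : p ∈ P) {S : Finset Pt} (hS : S ⊆ P) (hpS : p ∉ S) {K : ℕ}
    (hK : BB P p + (BB P p + 1) * (K + 40) ≤ S.card) :
    ∃ M a b c, 6 ≤ M ∧ Strip P p M a b c ∧ K ≤ (S ∩ st M a b).card := by
  have mV : ∀ s ∈ S, meet p s ∈ VV P ∧ g p (meet p s) = 0 ∧ g s (meet p s) = 0 ∧ p ≠ s := by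
    intro s hs
    have hps : p ≠ s := fun e => hpS (e ▸ hs)
    refine ⟨(mem_VV hP).2 ⟨p, hp, s, hS hs, hps, meet_left _ _, meet_right (hP.ne hp (hS hs) hps)⟩, meet_left _ _,
      meet_right (hP.ne hp (hS hs) hps), hps⟩
  set S0 := S.filter (fun s => meet p s ∉ Bd P 3) with hS0
  have hc0 : S.card ≤ BB P p + S0.card := by
    rw [hS0, ← Finset.card_filter_add_card_filter_not (s := S) (fun s => meet p s ∈ Bd P 3)]
    apply Nat.add_le_add_right
    have : (S.filter (fun s => meet p s ∈ Bd P 3)) ⊆ ((Bd P 3).filter (fun v => g p v = 0)).biUnion (fun v => (LL P v).erase p) := by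
      intro s hs
      rw [Finset.mem_filter] at hs
      obtain ⟨h1, h2, h3, h4⟩ := mV s hs.1
      exact Finset.mem_biUnion.2 ⟨meet p s, Finset.mem_filter.2 ⟨hs.2, h2⟩, Finset.mem_erase.2 ⟨h4.symm, mem_LL.2 ⟨hS hs.1, h3⟩⟩⟩
    refine (Finset.card_le_card this).trans (Finset.card_biUnion_le.trans (Finset.sum_le_sum fun v hv => ?_))
    rw [Finset.card_erase_of_mem (mem_LL.2 ⟨hp, (Finset.mem_filter.1 hv).2⟩)]
  obtain ⟨k, hk, hk2⟩ := Finset.exists_le_card_fiber_of_mul_le_card_of_maps_to (s := S0) (t := Finset.range (BB P p + 1))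
    (f := fun s => cls P p (meet p s)) (n := K + 40)
    (fun s hs => by
      rw [Finset.mem_range]
      exact Nat.lt_succ_of_le ((Finset.card_filter_le _ _).trans (Zp_card hP p))) (by simp)
    (by rw [Finset.card_range]; omega)
  set Sk := S0.filter (fun s => cls P p (meet p s) = k) with hSk
  set X := (VV P).filter (fun v => g p v = 0 ∧ v ∉ Bd P 3 ∧ cls P p v = k) with hX
  have hSX : ∀ s ∈ Sk, s ∈ S ∧ meet p s ∈ X := by
    intro s hs
    rw [hSk, Finset.mem_filter, hS0, Finset.mem_filter] at hs
    obtain ⟨h1, h2, h3, h4⟩ := mV s hs.1.1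
    exact ⟨hs.1.1, Finset.mem_filter.2 ⟨h1, h2, hs.1.2, hs.2⟩⟩
  have hdeg : ∀ v ∈ X, ((LL P v).erase p).card = 2 := by
    intro v hv
    rw [hX, Finset.mem_filter] at hv
    rw [Finset.card_erase_of_mem (mem_LL.2 ⟨hp, hv.2.1⟩), (good_of_not_Bd hv.1 hv.2.2.1).1]
  have hsm : ∀ s ∈ Sk, s ∈ (LL P (meet p s)).erase p := by
    intro s hs
    obtain ⟨h1, h2, h3, h4⟩ := mV s (hSX s hs).1
    exact Finset.mem_erase.2 ⟨h4.symm, mem_LL.2 ⟨hS (hSX s hs).1, h3⟩⟩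
  have hcard : Sk.card ≤ 2 * X.card := by
    have : Sk ⊆ X.biUnion (fun v => (LL P v).erase p) := fun s hs =>
      Finset.mem_biUnion.2 ⟨meet p s, (hSX s hs).2, hsm s hs⟩
    refine (Finset.card_le_card this).trans (Finset.card_biUnion_le.trans ?_)
    rw [Finset.sum_congr rfl hdeg]; simp [mul_comm]
  set Xs := X.image Prod.fst with hXs
  obtain ⟨N, hN⟩ : ∃ N, Xs.card = N := ⟨_, rfl⟩
  have hXN : X.card = N := by
    rw [← hN, hXs, Finset.card_image_of_injOn]
    intro v hv w hw h
    exact pt_eq_of_g (Finset.mem_filter.1 hv).2.1 (Finset.mem_filter.1 hw).2.1 h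
  set x := Xs.orderEmbOfFin hN with hx
  set v : ℕ → Pt := fun i => if h : i < N then (x ⟨i, h⟩, p.1 * x ⟨i, h⟩ + p.2) else 0 with hv
  have vx : ∀ i (h : i < N), (v i).1 = x ⟨i, h⟩ := fun i h => by simp [hv, h]
  have gp : ∀ i < N, g p (v i) = 0 := fun i h => by simp only [hv, h, g, dif_pos]; ring
  have vX : ∀ i < N, v i ∈ X := by
    intro i h
    have h1 : x ⟨i, h⟩ ∈ Xs := Finset.orderEmbOfFin_mem _ _ _
    rw [hXs, Finset.mem_image] at h1
    obtain ⟨w, hw, h2⟩ := h1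
    have := pt_eq_of_g (Finset.mem_filter.1 hw).2.1 (gp i h) (h2.trans (vx i h).symm)
    exact this ▸ hw
  have vlt : ∀ i j, i < j → j < N → (v i).1 < (v j).1 := by
    intro i j hij hj
    rw [vx i (hij.trans hj), vx j hj]
    exact x.strictMono (by simpa using hij)
  have vsurj : ∀ w ∈ X, ∃ i, i < N ∧ v i = w := by
    intro w hw
    have h1 : w.1 ∈ Set.range x := by
      rw [hx, Finset.range_orderEmbOfFin]; exact Finset.mem_coe.2 (Finset.mem_image_of_mem _ hw)
    obtain ⟨⟨i, hi⟩, h2⟩ := h1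
    exact ⟨i, hi, pt_eq_of_g (gp i hi) (Finset.mem_filter.1 hw).2.1 ((vx i hi).trans h2)⟩
  have vun : ∀ i, i + 1 < N → Unsep P (v i) (v (i+1)) := by
    intro i hi t ht
    by_contra hc
    push Not at hc
    obtain ⟨z, hz, z1, z2, z3, z4⟩ := cross hP hp ht (gp i (by omega)) (gp _ hi) (vlt i (i+1) (by omega) hi) hc
    have e1 := (Finset.mem_filter.1 (vX i (by omega))).2.2.2
    have e2 := (Finset.mem_filter.1 (vX (i+1) hi)).2.2.2
    have hzB : z ∉ Bd P 3 := by
      intro h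
      have := cls_lt (P := P) (p := p) (Finset.mem_filter.2 ⟨h, z1⟩) z3 z4
      omega
    have hzX : z ∈ X := by
      refine Finset.mem_filter.2 ⟨hz, z1, hzB, ?_⟩
      have h1 := cls_mono (P := P) (p := p) z3.le
      have h2 := cls_mono (P := P) (p := p) z4.le
      omega
    obtain ⟨j, hj, rfl⟩ := vsurj z hzX
    rcases lt_trichotomy j i with h | h | h
    · linarith [vlt j i h (by omega)]
    · subst h; linarith
    · rcases Nat.lt_or_ge (i+1) j with h' | h'
      · linarith [vlt (i+1) j h' hj]
      · obtain rfl : j = i+1 := by omega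
        linarith
  obtain ⟨M, rfl⟩ : ∃ M, N = M + 9 := ⟨N - 9, by omega⟩
  obtain ⟨a, b, R⟩ := init_row (d := 3) (M := M+6) hP hp (v := v) (fun i hi => (Finset.mem_filter.1 (vX i (by omega))).1)
    (fun i hi => (Finset.mem_filter.1 (vX i (by omega))).2.2.1) (fun i hi => gp i (by omega))
    (fun i hi => vlt i (i+1) (by omega) (by omega)) (fun i hi => vun i (by omega))
  obtain ⟨c, hc⟩ := R.strip hP (by
    intro i hi j hj h
    rcases lt_trichotomy i j with h' | h' | h'
    · have := vlt (i+1) (j+1) (by omega) (by omega); rw [h] at this; exact absurd this (lt_irrefl _)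
    · exact h'
    · have := vlt (j+1) (i+1) (by omega) (by omega); rw [h] at this; exact absurd this (lt_irrefl _))
  refine ⟨M, _, _, c, by omega, hc, ?_⟩
  set J : Finset ℕ := {0, 1, 2, 3, M+5, M+6, M+7, M+8} with hJ
  have hJc : J.card ≤ 8 := by rw [hJ]; exact (Finset.card_insert_le _ _).trans (Nat.succ_le_succ ((Finset.card_insert_le _ _).trans (Nat.succ_le_succ Finset.card_le_six)))
  have hsub : Sk ⊆ (S ∩ st M (fun i => a (i+3)) (fun i => b (i+3))) ∪ J.biUnion (fun j => if j < M + 9 then (LL P (v j)).erase p else ∅) := by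
    intro s hs
    obtain ⟨j, hj, hjv⟩ := vsurj _ (hSX s hs).2
    by_cases hjJ : j ∈ J
    · apply Finset.mem_union_right
      refine Finset.mem_biUnion.2 ⟨j, hjJ, ?_⟩
      rw [if_pos hj, hjv]; exact hsm s hs
    · apply Finset.mem_union_left
      refine Finset.mem_inter.2 ⟨(hSX s hs).1, ?_⟩
      have h1 : 4 ≤ j ∧ j ≤ M + 4 := by simp [hJ] at hjJ; omega
      obtain ⟨i, rfl⟩ : ∃ i, j = i + 4 := ⟨j - 4, by omega⟩
      have h2 := hsm s hs
      rw [← hjv, Finset.mem_erase] at h2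
      have hi : i + 3 ≤ M + 6 := by omega
      unfold st
      rw [Finset.mem_union, Finset.mem_image, Finset.mem_image]
      rcases or3 (R.good hi).1 (mem_LL.2 ⟨R.hl, R.hlv _ hi⟩) (mem_LL.2 ⟨R.ha _ hi, R.hav _ hi⟩) (mem_LL.2 ⟨R.hb _ hi, R.hbv _ hi⟩)
        (R.hla _ hi) (R.hlb _ hi) (R.hab _ hi) h2.2 with h | h | h
      · exact absurd h h2.1
      · left; exact ⟨i, by rw [Finset.mem_range]; omega, h.symm⟩
      · right; exact ⟨i, by rw [Finset.mem_range]; omega, h.symm⟩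
  have h1 := (Finset.card_le_card hsub).trans (Finset.card_union_le _ _)
  have h2 : (J.biUnion (fun j => if j < M + 9 then (LL P (v j)).erase p else ∅)).card ≤ J.card * 2 := by
    apply Finset.card_biUnion_le_card_mul
    intro j hj
    split_ifs with h
    · exact (hdeg _ (vX j h)).le
    · simp
  omega

end Orch

namespace Orch
open scoped Classical
open MvPolynomial

abbrev Pol := MvPolynomial (Fin 2) ℝ
/-- evaluation -/
noncomputable abbrev ev (F : Pol) (p : Pt) : ℝ := eval ![p.1, p.2] F
/-- degree at most d -/
noncomputable abbrev Vd (d : ℕ) : Submodule ℝ Pol := restrictTotalDegree (Fin 2) ℝ d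

theorem mem_Vd {d : ℕ} {F : Pol} : F ∈ Vd d ↔ F.totalDegree ≤ d := mem_restrictTotalDegree _ _ _

theorem sum2 (n : Fin 2 →₀ ℕ) : (n.sum fun _ e => e) = n 0 + n 1 := by
  rw [Finsupp.sum_fintype _ _ (fun _ => rfl), Fin.sum_univ_two]

theorem finrank_Vd (d : ℕ) : 2 * Module.finrank ℝ (Vd d) = (d+1)*(d+2) := by
  have h1 : Module.finrank ℝ (Vd d) = Nat.card {n : Fin 2 →₀ ℕ | (n.sum fun _ e => e) ≤ d} :=
    Module.finrank_eq_nat_card_basis (basisRestrictSupport ℝ _)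
  have h2 : Nat.card {n : Fin 2 →₀ ℕ | (n.sum fun _ e => e) ≤ d} =
      Nat.card (Σ i : Fin (d+1), Fin ((i:ℕ)+1)) := by
    apply Nat.card_congr
    refine ⟨fun n => ⟨⟨n.1 0 + n.1 1, by have := n.2; simp only [Set.mem_setOf_eq, sum2] at this; omega⟩, ⟨n.1 0, by simp⟩⟩,
      fun x => ⟨Finsupp.equivFunOnFinite.symm ![x.2, x.1 - x.2], by
        simp only [Set.mem_setOf_eq, sum2]; simp; omega⟩, ?_, ?_⟩
    · intro n
      ext i
      fin_cases i <;> simp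
    · rintro ⟨⟨i, hi⟩, ⟨j, hj⟩⟩
      simp only [Finsupp.equivFunOnFinite_symm_apply_apply, Matrix.cons_val_zero, Matrix.cons_val_one] at *
      have : j + (i - j) = i := by have : j < i + 1 := hj; omega
      congr 1
      · simp [this]
      · exact (Fin.heq_ext_iff (by simp [this])).2 rfl
  rw [h1, h2]
  rw [Nat.card_eq_fintype_card, Fintype.card_sigma]
  simp only [Fintype.card_fin]
  rw [Fin.sum_univ_eq_sum_range (fun i => i+1)]
  clear h1 h2
  induction d with
  | zero => simp
  | succ d ih => rw [Finset.sum_range_succ, mul_add, ih]; ring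

theorem exists_sep (S : Finset Pt) (p : Pt) (hp : p ∉ S) : ∃ F : Pol, F.totalDegree ≤ S.card ∧ ev F p ≠ 0 ∧ ∀ q ∈ S, ev F q = 0 := by
  have : ∀ q : Pt, ∃ L : Pol, L.totalDegree ≤ 1 ∧ ev L q = 0 ∧ (q ≠ p → ev L p ≠ 0) := by
    intro q
    by_cases h : p.1 = q.1
    · refine ⟨X 1 - C q.2, (totalDegree_sub_C_le _ _).trans (by simp), by simp, fun hq => ?_⟩
      simp only [map_sub, eval_X, eval_C, Matrix.cons_val_one]
      intro e
      exact hq (Prod.ext h.symm (sub_eq_zero.1 e).symm)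
    · refine ⟨X 0 - C q.1, (totalDegree_sub_C_le _ _).trans (by simp), by simp, fun hq => ?_⟩
      simp only [map_sub, eval_X, eval_C, Matrix.cons_val_zero]
      exact sub_ne_zero.2 h
  choose L h1 h2 h3 using this
  refine ⟨∏ q ∈ S, L q, ?_, ?_, ?_⟩
  · refine (totalDegree_finsetProd _ _).trans ((Finset.sum_le_sum fun q _ => h1 q).trans (by simp))
  · rw [ev, map_prod]
    exact Finset.prod_ne_zero_iff.2 fun q hq => h3 q (fun e => hp (e ▸ hq))
  · intro q hq
    rw [ev, map_prod]
    exact Finset.prod_eq_zero hq (h2 q)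

/-- evaluation at the points of S -/
noncomputable def evS (d : ℕ) (S : Finset Pt) : Vd d →ₗ[ℝ] (S → ℝ) :=
  LinearMap.pi (fun p => ((MvPolynomial.aeval ![p.1.1, p.1.2] : Pol →ₐ[ℝ] ℝ).toLinearMap).comp (Vd d).subtype)

theorem evS_apply (d : ℕ) (S : Finset Pt) (F : Vd d) (p : S) : evS d S F p = ev F.1 p.1 := by
  simp [evS, ev, aeval_eq_eval]

theorem evS_surj {d : ℕ} {S : Finset Pt} (h : S.card ≤ d) : Function.Surjective (evS d S) := by
  have : ∀ p : S, ∃ F : Vd d, ev F.1 p.1 ≠ 0 ∧ ∀ q : S, q ≠ p → ev F.1 q.1 = 0 := by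
    intro p
    obtain ⟨F, h1, h2, h3⟩ := exists_sep (S.erase p.1) p.1 (by simp)
    refine ⟨⟨F, mem_Vd.2 (h1.trans ((Finset.card_erase_le).trans h))⟩, h2, fun q hq => h3 _ ?_⟩
    exact Finset.mem_erase.2 ⟨fun e => hq (Subtype.ext e), q.2⟩
  choose F h1 h2 using this
  intro f
  refine ⟨∑ p : S, (f p / ev (F p).1 p.1) • F p, ?_⟩
  ext q
  rw [map_sum, Finset.sum_apply, Finset.sum_eq_single q]
  · rw [map_smul, Pi.smul_apply, evS_apply, smul_eq_mul, div_mul_cancel₀ _ (h1 q)]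
  · intro p _ hp
    rw [map_smul, Pi.smul_apply, evS_apply, h2 p q hp.symm, smul_zero]
  · simp

theorem bezout {F G : Pol} (hF : Irreducible F) (hFG : ¬ F ∣ G) {b : ℕ} (hG : G.totalDegree ≤ b) (S : Finset Pt)
    (hS : ∀ p ∈ S, ev F p = 0 ∧ ev G p = 0) : S.card ≤ F.totalDegree * b := by
  obtain ⟨a, ha⟩ : ∃ a, F.totalDegree = a := ⟨_, rfl⟩
  rw [ha]
  obtain ⟨s, hs⟩ : ∃ s, S.card = s := ⟨_, rfl⟩
  have hF0 := hF.ne_zero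
  have hG0 : G ≠ 0 := by rintro rfl; exact hFG (dvd_zero _)
  set Φ : (Vd (s+b)) × (Vd (s+a)) →ₗ[ℝ] Pol :=
    LinearMap.coprod ((LinearMap.mulLeft ℝ F).comp (Vd (s+b)).subtype) ((LinearMap.mulLeft ℝ G).comp (Vd (s+a)).subtype) with hΦ
  have Φa : ∀ x, Φ x = F * x.1.1 + G * x.2.1 := fun x => by simp [hΦ]
  set Ψ : Vd s →ₗ[ℝ] Pol × Pol := LinearMap.prod ((LinearMap.mulLeft ℝ (-G)).comp (Vd s).subtype) ((LinearMap.mulLeft ℝ F).comp (Vd s).subtype)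
    with hΨ
  have Ψa : ∀ x, Ψ x = (-G * x.1, F * x.1) := fun x => by simp [hΨ]
  -- range
  have r1 : Module.finrank ℝ (LinearMap.range Φ) ≤ Module.finrank ℝ (LinearMap.ker (evS (s+a+b) S)) := by
    have : LinearMap.range Φ ≤ (LinearMap.ker (evS (s+a+b) S)).map (Vd (s+a+b)).subtype := by
      rintro _ ⟨x, rfl⟩
      have x1 := mem_Vd.1 x.1.2
      have x2 := mem_Vd.1 x.2.2
      have hm : Φ x ∈ Vd (s+a+b) := by
        rw [mem_Vd, Φa]
        refine (totalDegree_add _ _).trans (max_le ((totalDegree_mul _ _).trans ?_) ((totalDegree_mul _ _).trans ?_)) <;> omega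
      refine ⟨⟨Φ x, hm⟩, ?_, rfl⟩
      rw [SetLike.mem_coe, LinearMap.mem_ker]
      ext p
      rw [evS_apply]
      simp only [Φa, ev, map_add, map_mul]
      have e1 : eval ![p.1.1, p.1.2] F = 0 := (hS p.1 p.2).1
      have e2 : eval ![p.1.1, p.1.2] G = 0 := (hS p.1 p.2).2
      rw [e1, e2]; simp
    refine (Submodule.finrank_mono this).trans ?_
    exact Submodule.finrank_map_le _ _
  have r2 := LinearMap.finrank_range_add_finrank_ker (evS (s+a+b) S)
  rw [LinearMap.range_eq_top.2 (evS_surj (by omega)), finrank_top, Module.finrank_fintype_fun_eq_card, Fintype.card_coe, hs] at r2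
  have r3 := LinearMap.finrank_range_add_finrank_ker Φ
  rw [Module.finrank_prod] at r3
  have r4 : Module.finrank ℝ (LinearMap.ker Φ) ≤ Module.finrank ℝ (Vd s) := by
    have : (LinearMap.ker Φ).map (LinearMap.prodMap (Vd (s+b)).subtype (Vd (s+a)).subtype) ≤ LinearMap.range Ψ := by
      rintro _ ⟨x, hx, rfl⟩
      rw [SetLike.mem_coe, LinearMap.mem_ker, Φa] at hx
      have h1 : F ∣ G * x.2.1 := ⟨-x.1.1, by linear_combination hx⟩
      obtain ⟨H, hH⟩ := ((hF.prime.dvd_or_dvd h1).resolve_left hFG)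
      have h2 : x.1.1 = -G * H := by
        apply mul_left_cancel₀ hF0
        rw [hH] at hx
        linear_combination hx
      have h3 : H ∈ Vd s := by
        rw [mem_Vd]
        by_cases hH0 : H = 0
        · rw [hH0]; simp
        · have x2 := mem_Vd.1 x.2.2
          rw [hH, totalDegree_mul_of_isDomain hF0 hH0] at x2
          omega
      refine ⟨⟨H, h3⟩, ?_⟩
      rw [Ψa]
      simp only [LinearMap.prodMap_apply, Submodule.subtype_apply]
      rw [h2, hH]
    have h4 : Module.finrank ℝ (LinearMap.ker Φ) = Module.finrank ℝ ((LinearMap.ker Φ).map (LinearMap.prodMap (Vd (s+b)).subtype (Vd (s+a)).subtype)) := by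
      refine (LinearEquiv.finrank_eq (Submodule.equivMapOfInjective _ ?_ _))
      intro x y h
      simp only [LinearMap.prodMap_apply, Submodule.subtype_apply, Prod.mk.injEq] at h
      exact Prod.ext (Subtype.ext h.1) (Subtype.ext h.2)
    rw [h4]
    exact (Submodule.finrank_mono this).trans (LinearMap.finrank_range_le Ψ)
  have e1 := finrank_Vd (s+a+b)
  have e2 := finrank_Vd (s+a)
  have e3 := finrank_Vd (s+b)
  have e4 := finrank_Vd s
  rw [hs]
  nlinarith

theorem irr_deg_one {F : Pol} (h : F.totalDegree = 1) : Irreducible F := by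
  apply irreducible_of_totalDegree_eq_one h
  intro x hx
  apply IsUnit.mk0
  rintro rfl
  have : F = 0 := by
    ext i
    simpa using zero_dvd_iff.1 (hx i)
  rw [this] at h
  simp at h

/-- the line through p, q -/
noncomputable def lineP (p q : Pt) : Pol := C (q.1-p.1) * (X 1 - C p.2) - C (q.2-p.2) * (X 0 - C p.1)

theorem ev_lineP (p q r : Pt) : ev (lineP p q) r = (q.1-p.1)*(r.2-p.2) - (q.2-p.2)*(r.1-p.1) := by
  simp [lineP, ev]

theorem ev_lineP_iff {p q r : Pt} : ev (lineP p q) r = 0 ↔ Col p q r := by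
  rw [ev_lineP, sub_eq_zero]; rfl

theorem lineP_deg_le (p q : Pt) : (lineP p q).totalDegree ≤ 1 := by
  unfold lineP
  have h : ∀ (c d : ℝ) (i : Fin 2), (C c * (X i - C d) : Pol).totalDegree ≤ 1 := by
    intro c d i
    refine (totalDegree_mul _ _).trans ?_
    have := totalDegree_sub_C_le (X i : Pol) d
    rw [totalDegree_X] at this
    rw [totalDegree_C]; omega
  exact (totalDegree_sub _ _).trans (max_le (h _ _ _) (h _ _ _))

theorem lineP_ne {p q : Pt} (h : p ≠ q) : ∃ r, ev (lineP p q) r ≠ 0 := by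
  refine ⟨(p.1 - (q.2-p.2), p.2 + (q.1 - p.1)), ?_⟩
  rw [ev_lineP]
  rcases Pt.ne_iff.1 h with h | h
  · have : 0 < (q.1-p.1)^2 := by positivity
    simp only; nlinarith [sq_nonneg (q.2-p.2)]
  · have : 0 < (q.2-p.2)^2 := by positivity
    simp only; nlinarith [sq_nonneg (q.1-p.1)]

theorem lineP_deg {p q : Pt} (h : p ≠ q) : (lineP p q).totalDegree = 1 := by
  refine le_antisymm (lineP_deg_le p q) ?_
  by_contra hc
  have h0 : (lineP p q).totalDegree = 0 := by omega
  rw [totalDegree_eq_zero_iff_eq_C] at h0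
  obtain ⟨r, hr⟩ := lineP_ne h
  apply hr
  have h1 : ev (lineP p q) p = 0 := ev_lineP_iff.2 (col_left p q)
  rw [h0, ev, eval_C] at h1 ⊢
  exact h1

theorem lineP_irr {p q : Pt} (h : p ≠ q) : Irreducible (lineP p q) := irr_deg_one (lineP_deg h)

theorem line_dvd {p q : Pt} (h : p ≠ q) {G : Pol} {b : ℕ} (hG : G.totalDegree ≤ b) (S : Finset Pt) (hS : b < S.card)
    (hc : ∀ r ∈ S, Col p q r ∧ ev G r = 0) : lineP p q ∣ G := by
  by_contra hd
  have := bezout (lineP_irr h) hd hG S (fun r hr => ⟨ev_lineP_iff.2 (hc r hr).1, (hc r hr).2⟩)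
  rw [lineP_deg h] at this
  omega

theorem deg_quot {F G : Pol} {a b : ℕ} (hF : F.totalDegree = a) (hF0 : F ≠ 0) (h : (F * G).totalDegree ≤ a + b) : G.totalDegree ≤ b := by
  by_cases hG : G = 0
  · rw [hG]; simp
  · rw [totalDegree_mul_of_isDomain hF0 hG] at h; omega

end Orch

namespace Orch
open scoped Classical
open MvPolynomial

theorem exists_vanish (d : ℕ) (S : Finset Pt) (h : 2 * S.card < (d+1)*(d+2)) :
    ∃ F : Pol, F ≠ 0 ∧ F.totalDegree ≤ d ∧ ∀ p ∈ S, ev F p = 0 := by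
  have h1 := LinearMap.finrank_range_add_finrank_ker (evS d S)
  have h2 := finrank_Vd d
  have h3 : Module.finrank ℝ (LinearMap.range (evS d S)) ≤ S.card := by
    refine (Submodule.finrank_le _).trans ?_
    rw [Module.finrank_fintype_fun_eq_card, Fintype.card_coe]
  have h4 : 0 < Module.finrank ℝ (LinearMap.ker (evS d S)) := by omega
  haveI : Nontrivial ↥(LinearMap.ker (evS d S)) := Module.nontrivial_of_finrank_pos (R := ℝ) h4
  obtain ⟨x, hx⟩ := exists_ne (0 : ↥(LinearMap.ker (evS d S)))
  refine ⟨x.1.1, fun e => hx (Subtype.ext (Subtype.ext e)), mem_Vd.1 x.1.2, fun p hp => ?_⟩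
  have := congrFun (LinearMap.mem_ker.1 x.2) ⟨p, hp⟩
  rwa [evS_apply] at this

theorem exists_on_line {p q : Pt} (h : p ≠ q) (S : Finset Pt) : ∃ y, Col p q y ∧ y ∉ S := by
  have hinj : Function.Injective (fun t : ℝ => ((p.1 + t * (q.1 - p.1), p.2 + t * (q.2 - p.2)) : Pt)) := by
    intro s t e
    simp only [Prod.mk.injEq, add_right_inj] at e
    rcases Pt.ne_iff.1 h with h | h
    · exact mul_right_cancel₀ h e.1
    · exact mul_right_cancel₀ h e.2
  obtain ⟨y, ⟨t, rfl⟩, hy⟩ := (Set.infinite_range_of_injective hinj).exists_notMem_finset S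
  refine ⟨_, ?_, hy⟩
  unfold Col; simp only; ring

theorem const_of_dvd {F G : Pol} (hF : F.totalDegree = 1) (hG : G.totalDegree ≤ 1) (h : F ∣ G) : ∃ c : ℝ, G = F * C c := by
  obtain ⟨H, rfl⟩ := h
  have hF0 : F ≠ 0 := by rintro rfl; simp at hF
  have := deg_quot (b := 0) hF hF0 hG
  have h2 := totalDegree_eq_zero_iff_eq_C.1 (Nat.le_zero.1 this)
  exact ⟨_, by rw [← h2]⟩

theorem chasles {x11 x12 x13 x21 x22 x23 x31 x32 : Pt} {F : Pol} (hF : F.totalDegree ≤ 3)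
    (d1 : x11 ≠ x12) (d2 : x11 ≠ x13) (d3 : x12 ≠ x13) (c1 : Col x11 x12 x13)
    (e1 : x21 ≠ x22) (e2 : x21 ≠ x23) (e3 : x22 ≠ x23) (c2 : Col x21 x22 x23) (f1 : x31 ≠ x32)
    (m1 : Col x11 x21 x31) (m2 : Col x12 x22 x32)
    (n1 : ¬ Col x11 x12 x21) (n2 : ¬ Col x11 x12 x22) (n3 : ¬ Col x11 x12 x23)
    (n4 : ¬ Col x11 x12 x31) (n5 : ¬ Col x11 x12 x32) (n6 : ¬ Col x21 x22 x31) (n7 : ¬ Col x21 x22 x32)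
    (v11 : ev F x11 = 0) (v12 : ev F x12 = 0) (v13 : ev F x13 = 0)
    (v21 : ev F x21 = 0) (v22 : ev F x22 = 0) (v23 : ev F x23 = 0) (v31 : ev F x31 = 0) (v32 : ev F x32 = 0) :
    ∃ l m : ℝ, F = C l * (lineP x11 x21 * lineP x12 x22 * lineP x13 x23) + C m * (lineP x11 x12 * lineP x21 x22 * lineP x31 x32) := by
  obtain ⟨y, hy, hyS⟩ := exists_on_line d1 {x11, x12, x13}
  simp only [Finset.mem_insert, Finset.mem_singleton, not_or] at hyS
  obtain ⟨y1, y2, y3⟩ := hyS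
  set M := lineP x11 x21 * lineP x12 x22 * lineP x13 x23 with hM
  have key : ∀ u w : Pt, Col x11 x12 u → y ≠ u → ¬ Col x11 x12 w → ev (lineP u w) y ≠ 0 := by
    intro u w h1 h2 h3 h4
    rw [ev_lineP_iff] at h4
    apply h3
    exact Col.trans4 h2.symm (Col.trans4 d1 h1 hy (col_left _ _)) (Col.trans4 d1 h1 hy (col_right _ _)) h4.swap23
  have hMy : ev M y ≠ 0 := by
    simp only [hM, ev, map_mul]
    exact mul_ne_zero (mul_ne_zero (key _ _ (col_left _ _) y1 n1) (key _ _ (col_right _ _) y2 n2)) (key _ _ c1 y3 n3)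
  have evM : ∀ z, ev M z = ev (lineP x11 x21) z * ev (lineP x12 x22) z * ev (lineP x13 x23) z := fun z => by simp [hM]
  have l0 : ∀ u w : Pt, ev (lineP u w) u = 0 := fun u w => ev_lineP_iff.2 (col_left _ _)
  have l1 : ∀ u w : Pt, ev (lineP u w) w = 0 := fun u w => ev_lineP_iff.2 (col_right _ _)
  set l : ℝ := ev F y / ev M y with hl
  set G := F - C l * M with hG
  have evG : ∀ z, ev G z = ev F z - l * ev M z := fun z => by simp [hG]
  have hGd : G.totalDegree ≤ 3 := by
    refine (totalDegree_sub _ _).trans (max_le hF ?_)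
    refine (totalDegree_mul _ _).trans ?_
    rw [totalDegree_C, zero_add, hM]
    have a1 := lineP_deg_le x11 x21
    have a2 := lineP_deg_le x12 x22
    have a3 := lineP_deg_le x13 x23
    have a4 := totalDegree_mul (lineP x11 x21 * lineP x12 x22) (lineP x13 x23)
    have a5 := totalDegree_mul (lineP x11 x21) (lineP x12 x22)
    omega
  have g1 : ev G x11 = 0 := by rw [evG, evM, l0, v11]; ring
  have g2 : ev G x12 = 0 := by rw [evG, evM, l0, v12]; ring
  have g3 : ev G x13 = 0 := by rw [evG, evM, l0, v13]; ring
  have g4 : ev G y = 0 := by rw [evG, hl]; field_simp; ring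
  have g21 : ev G x21 = 0 := by rw [evG, evM, l1, v21]; ring
  have g22 : ev G x22 = 0 := by rw [evG, evM, l1, v22]; ring
  have g23 : ev G x23 = 0 := by rw [evG, evM, l1, v23]; ring
  have g31 : ev G x31 = 0 := by rw [evG, evM, ev_lineP_iff.2 m1, v31]; ring
  have g32 : ev G x32 = 0 := by rw [evG, evM, ev_lineP_iff.2 m2, v32]; ring
  obtain ⟨Q, hQ⟩ := line_dvd d1 hGd {x11, x12, x13, y} (by
    rw [Finset.card_insert_of_notMem, Finset.card_insert_of_notMem, Finset.card_insert_of_notMem, Finset.card_singleton]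
    · norm_num
    · simpa using Ne.symm y3
    · simpa using ⟨d3, Ne.symm y2⟩
    · simpa using ⟨d1, d2, Ne.symm y1⟩) (by
      intro r hr
      simp only [Finset.mem_insert, Finset.mem_singleton] at hr
      rcases hr with rfl | rfl | rfl | rfl
      · exact ⟨col_left _ _, g1⟩
      · exact ⟨col_right _ _, g2⟩
      · exact ⟨c1, g3⟩
      · exact ⟨hy, g4⟩)
  have hQd : Q.totalDegree ≤ 2 := deg_quot (lineP_deg d1) (lineP_irr d1).ne_zero (hQ ▸ hGd)
  have van : ∀ {u w z : Pt} {A B : Pol}, A = lineP u w * B → ev A z = 0 → ¬ Col u w z → ev B z = 0 := by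
    intro u w z A B h1 h2 h3
    rw [h1, ev, map_mul] at h2
    exact (mul_eq_zero.1 h2).resolve_left (fun h => h3 (ev_lineP_iff.1 h))
  obtain ⟨L, hL⟩ := line_dvd e1 hQd {x21, x22, x23} (by
    rw [Finset.card_insert_of_notMem, Finset.card_insert_of_notMem, Finset.card_singleton]
    · norm_num
    · simpa using e3
    · simpa using ⟨e1, e2⟩) (by
      intro r hr
      simp only [Finset.mem_insert, Finset.mem_singleton] at hr
      rcases hr with rfl | rfl | rfl
      · exact ⟨col_left _ _, van hQ g21 n1⟩
      · exact ⟨col_right _ _, van hQ g22 n2⟩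
      · exact ⟨c2, van hQ g23 n3⟩)
  have hLd : L.totalDegree ≤ 1 := deg_quot (lineP_deg e1) (lineP_irr e1).ne_zero (hL ▸ hQd)
  have h3 := line_dvd f1 hLd {x31, x32} (by
    rw [Finset.card_insert_of_notMem, Finset.card_singleton]
    · norm_num
    · simp [f1]) (by
      intro r hr
      simp only [Finset.mem_insert, Finset.mem_singleton] at hr
      rcases hr with rfl | rfl
      · exact ⟨col_left _ _, van hL (van hQ g31 n4) n6⟩
      · exact ⟨col_right _ _, van hL (van hQ g32 n5) n7⟩)
  obtain ⟨m, hm⟩ := const_of_dvd (lineP_deg f1) hLd h3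
  refine ⟨l, m, ?_⟩
  have : F = C l * M + G := by rw [hG]; ring
  rw [this, hQ, hL, hm]; ring

/-- a 3 by 3 array of triple lines -/
structure Arr (P : Finset Pt) (x : Fin 3 → Fin 3 → Pt) : Prop where
  inj : ∀ i j k l, x i j = x k l → i = k ∧ j = l
  row : ∀ i j k l, j ≠ k → j ≠ l → k ≠ l → Tri P (x i j) (x i k) (x i l)
  clm : ∀ i j k l, j ≠ k → j ≠ l → k ≠ l → Tri P (x j i) (x k i) (x l i)

theorem Arr.perm {P : Finset Pt} {x : Fin 3 → Fin 3 → Pt} (h : Arr P x) (σ τ : Equiv.Perm (Fin 3)) :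
    Arr P (fun i j => x (σ i) (τ j)) :=
  ⟨fun i j k l e => by
    have := h.inj _ _ _ _ e
    exact ⟨σ.injective this.1, τ.injective this.2⟩,
   fun i j k l h1 h2 h3 => h.row _ _ _ _ (τ.injective.ne h1) (τ.injective.ne h2) (τ.injective.ne h3),
   fun i j k l h1 h2 h3 => h.clm _ _ _ _ (σ.injective.ne h1) (σ.injective.ne h2) (σ.injective.ne h3)⟩

theorem Arr.ch22 {P : Finset Pt} {x : Fin 3 → Fin 3 → Pt} (h : Arr P x) {F : Pol} (hF : F.totalDegree ≤ 3)
    (hv : ∀ i j, ¬ (i = 2 ∧ j = 2) → ev F (x i j) = 0) : ev F (x 2 2) = 0 := by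
  have hP : ∀ i j, x i j ∈ P := fun i j => (h.row i j (j+1) (j+2) (by fin_cases j <;> simp) (by fin_cases j <;> simp) (by fin_cases j <;> simp)).hx
  have r0 := h.row 0 0 1 2 (by decide) (by decide) (by decide)
  have r1 := h.row 1 0 1 2 (by decide) (by decide) (by decide)
  have r2 := h.row 2 0 1 2 (by decide) (by decide) (by decide)
  have k0 := h.clm 0 0 1 2 (by decide) (by decide) (by decide)
  have k1 := h.clm 1 0 1 2 (by decide) (by decide) (by decide)
  have k2 := h.clm 2 0 1 2 (by decide) (by decide) (by decide)
  have nc : ∀ i k l, i ≠ k → ¬ Col (x i 0) (x i 1) (x k l) := by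
    intro i k l hik hc
    rcases (h.row i 0 1 2 (by decide) (by decide) (by decide)).all _ (hP k l) hc with e | e | e <;>
    exact hik (h.inj _ _ _ _ e).1.symm
  obtain ⟨l, m, hlm⟩ := chasles hF r0.hxy r0.hxz r0.hyz r0.col r1.hxy r1.hxz r1.hyz r1.col r2.hxy k0.col k1.col
    (nc 0 1 0 (by decide)) (nc 0 1 1 (by decide)) (nc 0 1 2 (by decide)) (nc 0 2 0 (by decide)) (nc 0 2 1 (by decide))
    (nc 1 2 0 (by decide)) (nc 1 2 1 (by decide)) (hv _ _ (by decide)) (hv _ _ (by decide)) (hv _ _ (by decide)) (hv _ _ (by decide))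
    (hv _ _ (by decide)) (hv _ _ (by decide)) (hv _ _ (by decide)) (hv _ _ (by decide))
  have e1 : eval ![(x 2 2).1, (x 2 2).2] (lineP (x 0 2) (x 1 2)) = 0 := ev_lineP_iff.2 k2.col
  have e2 : eval ![(x 2 2).1, (x 2 2).2] (lineP (x 2 0) (x 2 1)) = 0 := ev_lineP_iff.2 r2.col
  rw [hlm, ev]
  simp only [map_add, map_mul, e1, e2]
  ring

theorem Arr.ch {P : Finset Pt} {x : Fin 3 → Fin 3 → Pt} (h : Arr P x) {F : Pol} (hF : F.totalDegree ≤ 3) (i0 j0 : Fin 3)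
    (hv : ∀ i j, ¬ (i = i0 ∧ j = j0) → ev F (x i j) = 0) : ev F (x i0 j0) = 0 := by
  have := (h.perm (Equiv.swap 2 i0) (Equiv.swap 2 j0)).ch22 hF (by
    intro i j hij
    apply hv
    rintro ⟨h1, h2⟩
    apply hij
    constructor
    · have := congrArg (Equiv.swap 2 i0) h1; simpa using this
    · have := congrArg (Equiv.swap 2 j0) h2; simpa using this)
  simpa using this

end Orch

namespace Orch
open scoped Classical
open MvPolynomial

theorem Tri.fin {P : Finset Pt} {f : Fin 3 → Pt} (h : Tri P (f 0) (f 1) (f 2)) (j k l : Fin 3)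
    (h1 : j ≠ k) (h2 : j ≠ l) (h3 : k ≠ l) : Tri P (f j) (f k) (f l) := by
  fin_cases j <;> fin_cases k <;> fin_cases l <;> first | exact absurd rfl h1 | exact absurd rfl h2 | exact absurd rfl h3 | exact h | exact h.swap | exact h.swap23 | exact h.rot | exact h.rot.rot | exact h.rot.swap | exact h.rot.swap23

theorem Arr.mk3 {P : Finset Pt} {x : Fin 3 → Fin 3 → Pt} (inj : ∀ i j k l, x i j = x k l → i = k ∧ j = l)
    (row : ∀ i, Tri P (x i 0) (x i 1) (x i 2)) (clm : ∀ i, Tri P (x 0 i) (x 1 i) (x 2 i)) : Arr P x :=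
  ⟨inj, fun i => (row i).fin (f := x i), fun i => (clm i).fin (f := fun r => x r i)⟩

def lab : Fin 3 → Fin 3 → Fin 3 × Fin 3 :=
  ![![(0,0),(1,1),(2,2)], ![(1,0),(2,0),(0,1)], ![(2,1),(0,2),(1,2)]]

theorem lab_inj : ∀ i j k l, lab i j = lab k l → i = k ∧ j = l := by decide
theorem lab_surj : ∀ t, ∃ i j, lab i j = t := by decide

theorem Strip.ch {P : Finset Pt} {p : Pt} {M : ℕ} {a b : ℕ → Pt} {c : ℤ → Pt} (hS : Strip P p M a b c)
    {F : Pol} (hF : F.totalDegree ≤ 3) (i j : ℕ) (k : ℤ) (hk : -2 ≤ k) (hk' : k ≤ 2) (hij : (j:ℤ) = i + k)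
    (hi : i + 2 ≤ M) (hj : j + 2 ≤ M) (pt : Fin 3 × Fin 3 → Pt)
    (hpt : pt = fun q => ![a (i + q.2.val), b (j + q.2.val), c (k - 1 + q.2.val)] q.1) (t : Fin 3 × Fin 3)
    (hv : ∀ s, s ≠ t → ev F (pt s) = 0) : ev F (pt t) = 0 := by
  have T : ∀ t0 t1 t2 : Fin 3, t1.val + 1 = t0.val + t2.val → Tri P (pt (0,t0)) (pt (1,t1)) (pt (2,t2)) := by
    intro t0 t1 t2 h
    rw [hpt]
    exact hS.tri _ (by omega) _ (by omega) _ (by omega) (by omega) (by push_cast; omega)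
  have inj : ∀ s s', pt s = pt s' → s = s' := by
    rintro ⟨s, t⟩ ⟨s', t'⟩ h
    rw [hpt] at h
    have e : ∀ t t' : Fin 3, t.val = t'.val → t = t' := fun t t' h => Fin.ext h
    fin_cases s <;> fin_cases s' <;> simp at h ⊢
    · exact e _ _ (by have := hS.ainj _ (by omega) _ (by omega) h; omega)
    · exact hS.ab _ (by omega) _ (by omega) h
    · exact hS.ca _ (by omega) (by omega) _ (by omega) h.symm
    · exact hS.ab _ (by omega) _ (by omega) h.symm
    · exact e _ _ (by have := hS.binj _ (by omega) _ (by omega) h; omega)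
    · exact hS.cb _ (by omega) (by omega) _ (by omega) h.symm
    · exact hS.ca _ (by omega) (by omega) _ (by omega) h
    · exact hS.cb _ (by omega) (by omega) _ (by omega) h
    · exact e _ _ (by have := hS.cinj _ (by omega) (by omega) _ (by omega) (by omega) h; omega)
  have A : Arr P (fun r s => pt (lab r s)) := by
    apply Arr.mk3
    · intro i j k l h
      exact lab_inj _ _ _ _ (inj _ _ h)
    · intro i
      fin_cases i
      · exact T 0 1 2 rfl
      · exact (T 1 0 0 rfl).rot
      · exact (T 2 2 1 rfl).rot.rot
    · intro i
      fin_cases i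
      · exact T 0 0 1 rfl
      · exact (T 2 1 0 rfl).rot
      · exact (T 1 2 2 rfl).rot.rot
  obtain ⟨r, s, rfl⟩ := lab_surj t
  exact A.ch hF r s (fun i j hne => hv _ (fun e => hne (lab_inj _ _ _ _ e)))

theorem fin33 {q : Fin 3 × Fin 3 → Prop} (h1 : ∀ t, q (0,t)) (h2 : ∀ t, q (1,t)) (h3 : ∀ t, q (2,t)) : ∀ s, q s := by
  rintro ⟨s, t⟩
  fin_cases s
  · exact h1 t
  · exact h2 t
  · exact h3 t

theorem fin3 {q : Fin 3 → Prop} (h0 : q 0) (h1 : q 1) (h2 : q 2) : ∀ t, q t := by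
  intro t; fin_cases t <;> assumption

section
variable {P : Finset Pt} {p : Pt} {M : ℕ} {a b : ℕ → Pt} {c : ℤ → Pt}

theorem Strip.ch_b2 (hS : Strip P p M a b c) {F : Pol} (hF : F.totalDegree ≤ 3) (i j : ℕ) (k : ℤ) (hk : -2 ≤ k) (hk' : k ≤ 2)
    (hij : (j:ℤ) = i + k) (hi : i + 2 ≤ M) (hj : j + 2 ≤ M)
    (a0 : ev F (a i) = 0) (a1 : ev F (a (i+1)) = 0) (a2 : ev F (a (i+2)) = 0) (b0 : ev F (b j) = 0) (b1 : ev F (b (j+1)) = 0)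
    (c0 : ev F (c (k-1)) = 0) (c1 : ev F (c k) = 0) (c2 : ev F (c (k+1)) = 0) : ev F (b (j+2)) = 0 := by
  refine hS.ch hF i j k hk hk' hij hi hj _ rfl (1,2) (fin33 (fin3 ?_ ?_ ?_) (fin3 ?_ ?_ ?_) (fin3 ?_ ?_ ?_))
  · intro _; exact a0
  · intro _; exact a1
  · intro _; exact a2
  · intro _; exact b0
  · intro _; exact b1
  · intro h; exact absurd rfl h
  · intro _; simpa using c0
  · intro _; simpa using c1
  · intro _; convert c2 using 3; simp; ring_nf

theorem Strip.ch_a2 (hS : Strip P p M a b c) {F : Pol} (hF : F.totalDegree ≤ 3) (i j : ℕ) (k : ℤ) (hk : -2 ≤ k) (hk' : k ≤ 2)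
    (hij : (j:ℤ) = i + k) (hi : i + 2 ≤ M) (hj : j + 2 ≤ M)
    (a0 : ev F (a i) = 0) (a1 : ev F (a (i+1)) = 0) (b0 : ev F (b j) = 0) (b1 : ev F (b (j+1)) = 0) (b2 : ev F (b (j+2)) = 0)
    (c0 : ev F (c (k-1)) = 0) (c1 : ev F (c k) = 0) (c2 : ev F (c (k+1)) = 0) : ev F (a (i+2)) = 0 := by
  refine hS.ch hF i j k hk hk' hij hi hj _ rfl (0,2) (fin33 (fin3 ?_ ?_ ?_) (fin3 ?_ ?_ ?_) (fin3 ?_ ?_ ?_))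
  · intro _; exact a0
  · intro _; exact a1
  · intro h; exact absurd rfl h
  · intro _; exact b0
  · intro _; exact b1
  · intro _; exact b2
  · intro _; simpa using c0
  · intro _; simpa using c1
  · intro _; convert c2 using 3; simp; ring_nf

theorem Strip.ch_c2 (hS : Strip P p M a b c) {F : Pol} (hF : F.totalDegree ≤ 3) (i j : ℕ) (k : ℤ) (hk : -2 ≤ k) (hk' : k ≤ 2)
    (hij : (j:ℤ) = i + k) (hi : i + 2 ≤ M) (hj : j + 2 ≤ M)
    (a0 : ev F (a i) = 0) (a1 : ev F (a (i+1)) = 0) (a2 : ev F (a (i+2)) = 0) (b0 : ev F (b j) = 0) (b1 : ev F (b (j+1)) = 0)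
    (b2 : ev F (b (j+2)) = 0)
    (c0 : ev F (c (k-1)) = 0) (c1 : ev F (c k) = 0) : ev F (c (k+1)) = 0 := by
  have := hS.ch hF i j k hk hk' hij hi hj _ rfl (2,2) (fin33 (fin3 ?_ ?_ ?_) (fin3 ?_ ?_ ?_) (fin3 ?_ ?_ ?_))
  · convert this using 3; simp; ring_nf
  · intro _; exact a0
  · intro _; exact a1
  · intro _; exact a2
  · intro _; exact b0
  · intro _; exact b1
  · intro _; exact b2
  · intro _; simpa using c0
  · intro _; simpa using c1
  · intro h; exact absurd rfl h

theorem Strip.ch_c0 (hS : Strip P p M a b c) {F : Pol} (hF : F.totalDegree ≤ 3) (i j : ℕ) (k : ℤ) (hk : -2 ≤ k) (hk' : k ≤ 2)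
    (hij : (j:ℤ) = i + k) (hi : i + 2 ≤ M) (hj : j + 2 ≤ M)
    (a0 : ev F (a i) = 0) (a1 : ev F (a (i+1)) = 0) (a2 : ev F (a (i+2)) = 0) (b0 : ev F (b j) = 0) (b1 : ev F (b (j+1)) = 0)
    (b2 : ev F (b (j+2)) = 0)
    (c1 : ev F (c k) = 0) (c2 : ev F (c (k+1)) = 0) : ev F (c (k-1)) = 0 := by
  have := hS.ch hF i j k hk hk' hij hi hj _ rfl (2,0) (fin33 (fin3 ?_ ?_ ?_) (fin3 ?_ ?_ ?_) (fin3 ?_ ?_ ?_))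
  · simpa using this
  · intro _; exact a0
  · intro _; exact a1
  · intro _; exact a2
  · intro _; exact b0
  · intro _; exact b1
  · intro _; exact b2
  · intro h; exact absurd rfl h
  · intro _; simpa using c1
  · intro _; convert c2 using 3; simp; ring_nf

set_option maxHeartbeats 400000 in
theorem Strip.cubic (hS : Strip P p M a b c) (hM : 6 ≤ M) :
    ∃ F : Pol, F ≠ 0 ∧ F.totalDegree ≤ 3 ∧ (∀ i ≤ M, ev F (a i) = 0) ∧ (∀ i ≤ M, ev F (b i) = 0) ∧
      (∀ k : ℤ, -3 ≤ k → k ≤ 3 → ev F (c k) = 0) := by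
  obtain ⟨F, hF0, hF, hv⟩ := exists_vanish 3 {c (-1), c 0, c 1, a 0, a 1, a 2, a 3, b 0, b 1} (by
    have : ({c (-1), c 0, c 1, a 0, a 1, a 2, a 3, b 0, b 1} : Finset Pt).card ≤ 9 := by
      have h1 := Finset.card_insert_le (c (-1)) {c 0, c 1, a 0, a 1, a 2, a 3, b 0, b 1}
      have h2 := Finset.card_insert_le (c 0) {c 1, a 0, a 1, a 2, a 3, b 0, b 1}
      have h3 := Finset.card_insert_le (c 1) {a 0, a 1, a 2, a 3, b 0, b 1}
      have h4 : ({a 0, a 1, a 2, a 3, b 0, b 1} : Finset Pt).card ≤ 6 := Finset.card_le_six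
      omega
    omega)
  have cm1 : ev F (c (-1)) = 0 := hv _ (by simp)
  have c0 : ev F (c 0) = 0 := hv _ (by simp)
  have c1 : ev F (c 1) = 0 := hv _ (by simp)
  have a0 : ev F (a 0) = 0 := hv _ (by simp)
  have a1 : ev F (a 1) = 0 := hv _ (by simp)
  have a2 : ev F (a 2) = 0 := hv _ (by simp)
  have a3 : ev F (a 3) = 0 := hv _ (by simp)
  have b0 : ev F (b 0) = 0 := hv _ (by simp)
  have b1 : ev F (b 1) = 0 := hv _ (by simp)
  have B2 := fun i j k hk hk' hij hi hj => @Strip.ch_b2 P p M a b c hS F hF i j k hk hk' hij hi hj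
  have A2 := fun i j k hk hk' hij hi hj => @Strip.ch_a2 P p M a b c hS F hF i j k hk hk' hij hi hj
  have C2 := fun i j k hk hk' hij hi hj => @Strip.ch_c2 P p M a b c hS F hF i j k hk hk' hij hi hj
  have C0 := fun i j k hk hk' hij hi hj => @Strip.ch_c0 P p M a b c hS F hF i j k hk hk' hij hi hj
  refine ⟨F, hF0, hF, ?_⟩
  clear hv hF hF0
  have gen : ∃ V : Pt → Prop, ∀ x, V x ↔ ev F x = 0 := ⟨_, fun x => Iff.rfl⟩
  obtain ⟨V, hV⟩ := gen
  simp only [← hV] at *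
  clear hV F
  have b2 : V (b 2) := B2 0 0 0 (by norm_num) (by norm_num) (by norm_num) (by omega) (by omega) a0 a1 a2 b0 b1 cm1 c0 c1
  have b3 : V (b 3) := B2 1 1 0 (by norm_num) (by norm_num) (by norm_num) (by omega) (by omega) a1 a2 a3 b1 b2 cm1 c0 c1
  have c2 : V (c 2) := C2 0 1 1 (by norm_num) (by norm_num) (by norm_num) (by omega) (by omega) a0 a1 a2 b1 b2 b3 c0 c1
  have cm2 : V (c (-2)) := C0 1 0 (-1) (by norm_num) (by norm_num) (by norm_num) (by omega) (by omega) a1 a2 a3 b0 b1 b2 cm1 c0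
  have ab : ∀ m, m + 3 ≤ M → (V (a m) ∧ V (a (m+1)) ∧ V (a (m+2)) ∧ V (a (m+3))) ∧
      (V (b m) ∧ V (b (m+1)) ∧ V (b (m+2)) ∧ V (b (m+3))) := by
    intro m
    induction m with
    | zero => intro _; exact ⟨⟨a0, a1, a2, a3⟩, b0, b1, b2, b3⟩
    | succ m ih =>
      intro hm
      obtain ⟨⟨h0, h1, h2, h3⟩, k0, k1, k2, k3⟩ := ih (by omega)
      have := A2 (m+2) (m+1) (-1) (by norm_num) (by norm_num) (by push_cast; ring) (by omega) (by omega) h2 h3 k1 k2 k3 (by norm_num; exact cm2) cm1 (by norm_num; exact c0)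
      have := B2 (m+1) (m+2) 1 (by norm_num) (by norm_num) (by push_cast; ring) (by omega) (by omega) h1 h2 h3 k2 k3 c0 c1 c2
      exact ⟨⟨h1, h2, h3, by assumption⟩, k1, k2, k3, by assumption⟩
  have ha : ∀ i ≤ M, V (a i) := by
    intro i hi
    by_cases h : i + 3 ≤ M
    · exact (ab i h).1.1
    · have h1 := ab (M-3) (by omega)
      have h2 : i = M - 3 + 1 ∨ i = M - 3 + 2 ∨ i = M - 3 + 3 := by omega
      rcases h2 with rfl | rfl | rfl
      · exact h1.1.2.1
      · exact h1.1.2.2.1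
      · exact h1.1.2.2.2
  have hb : ∀ i ≤ M, V (b i) := by
    intro i hi
    by_cases h : i + 3 ≤ M
    · exact (ab i h).2.1
    · have h1 := ab (M-3) (by omega)
      have h2 : i = M - 3 + 1 ∨ i = M - 3 + 2 ∨ i = M - 3 + 3 := by omega
      rcases h2 with rfl | rfl | rfl
      · exact h1.2.2.1
      · exact h1.2.2.2.1
      · exact h1.2.2.2.2
  have c3 : V (c 3) := C2 0 2 2 (by norm_num) (by norm_num) (by norm_num) (by omega) (by omega) a0 a1 a2 b2 b3 (hb 4 (by omega)) c1 c2
  have cm3 : V (c (-3)) := C0 2 0 (-2) (by norm_num) (by norm_num) (by norm_num) (by omega) (by omega) a2 a3 (ha 4 (by omega)) b0 b1 b2 cm2 cm1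
  refine ⟨ha, hb, ?_⟩
  intro k h1 h2
  interval_cases k <;> assumption
end
end Orch

namespace Orch
open scoped Classical
open MvPolynomial

/-- points of `P` on a curve -/
noncomputable def zr (P : Finset Pt) (F : Pol) : Finset Pt := P.filter (fun p => ev F p = 0)

theorem mem_zr {P : Finset Pt} {F : Pol} {p : Pt} : p ∈ zr P F ↔ p ∈ P ∧ ev F p = 0 := by simp [zr]

theorem zr_sub {P : Finset Pt} {F : Pol} : zr P F ⊆ P := Finset.filter_subset _ _

theorem tri_of {P : Finset Pt} {p q : Pt} (hp : p ∈ P) (hq : q ∈ P) (hpq : p ≠ q) (hb : (p, q) ∉ bad P) :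
    ∃ r, Tri P p q r := by
  have h3 : (lin P p q).card = 3 := by
    by_contra h; exact hb (mem_bad.2 ⟨hp, hq, hpq, h⟩)
  have hp' : p ∈ lin P p q := mem_lin.2 ⟨hp, col_left _ _⟩
  have hq' : q ∈ (lin P p q).erase p := Finset.mem_erase.2 ⟨hpq.symm, mem_lin.2 ⟨hq, col_right _ _⟩⟩
  have h1 : (((lin P p q).erase p).erase q).card = 1 := by
    rw [Finset.card_erase_of_mem hq', Finset.card_erase_of_mem hp', h3]
  obtain ⟨r, hr⟩ := Finset.card_eq_one.1 h1
  have hr' : r ∈ ((lin P p q).erase p).erase q := by rw [hr]; simp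
  simp only [Finset.mem_erase, mem_lin] at hr'
  refine ⟨r, hp, hq, hr'.2.2.1, hpq, Ne.symm hr'.2.1, Ne.symm hr'.1, hr'.2.2.2, fun s hs hc => ?_⟩
  by_cases e1 : s = p
  · exact Or.inl e1
  by_cases e2 : s = q
  · exact Or.inr (Or.inl e2)
  right; right
  have : s ∈ ((lin P p q).erase p).erase q := Finset.mem_erase.2 ⟨e2, Finset.mem_erase.2 ⟨e1, mem_lin.2 ⟨hs, hc⟩⟩⟩
  rw [hr] at this; simpa using this

theorem Tri.not_bad {P : Finset Pt} {p q r : Pt} (h : Tri P p q r) : (p, q) ∉ bad P := by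
  intro hb
  apply (mem_bad.1 hb).2.2.2
  have : lin P p q = {p, q, r} := by
    ext s
    simp only [mem_lin, Finset.mem_insert, Finset.mem_singleton]
    constructor
    · rintro ⟨h1, h2⟩; exact h.all s h1 h2
    · rintro (rfl | rfl | rfl)
      · exact ⟨h.hx, col_left _ _⟩
      · exact ⟨h.hy, col_right _ _⟩
      · exact ⟨h.hz, h.col⟩
  rw [this, Finset.card_eq_three]
  exact ⟨p, q, r, h.hxy, h.hxz, h.hyz, rfl⟩

theorem irr_line {F : Pol} (hF : Irreducible F) (hd : 2 ≤ F.totalDegree) {p q : Pt} (hpq : p ≠ q) (S : Finset Pt)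
    (hS : ∀ r ∈ S, Col p q r ∧ ev F r = 0) : S.card ≤ F.totalDegree := by
  have h := bezout hF (G := lineP p q) (b := 1) (fun hdvd => by
    have h1 := lineP_deg hpq
    obtain ⟨H, hH⟩ := hdvd
    have h0 : H ≠ 0 := by rintro rfl; exact (lineP_irr hpq).ne_zero (by rw [hH]; simp)
    rw [hH, totalDegree_mul_of_isDomain hF.ne_zero h0] at h1
    omega) (lineP_deg_le p q) S (fun r hr => ⟨(hS r hr).2, ev_lineP_iff.2 (hS r hr).1⟩)
  omega

theorem line_pts {P : Finset Pt} {B : ℕ} (hB : 3 ≤ B) (hB2 : (bad P).card < (B + 1) * B) {p q : Pt} (hp : p ∈ P) (hq : q ∈ P)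
    (hpq : p ≠ q) : (lin P p q).card ≤ B := by
  by_contra hc
  push Not at hc
  have h1 : (lin P p q).offDiag ⊆ bad P := by
    rintro ⟨r, s⟩ h
    simp only [Finset.mem_offDiag, mem_lin] at h
    rw [mem_bad]
    refine ⟨h.1.1, h.2.1.1, h.2.2, ?_⟩
    rw [← lin_eq hpq h.1.2 h.2.1.2 h.2.2]; omega
  have h2 := Finset.card_le_card h1
  rw [Finset.offDiag_card] at h2
  have h3 : (B+1) * B ≤ (lin P p q).card * (lin P p q).card - (lin P p q).card := by
    obtain ⟨k, hk⟩ : ∃ k, (lin P p q).card = B + 1 + k := ⟨_, (Nat.add_sub_cancel' hc).symm⟩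
    rw [hk]
    have : (B + 1 + k) * (B + 1 + k) = (B+1) * B + (B + 1 + k) + (B * k + B * k + k + k * k) := by ring
    omega
  omega

theorem zr_one {P : Finset Pt} {B : ℕ} (hB : 3 ≤ B) (hB2 : (bad P).card < (B + 1) * B) {L : Pol} (hL : L ≠ 0)
    (hd : L.totalDegree ≤ 1) : (zr P L).card ≤ B := by
  by_cases h : (zr P L).card ≤ 1
  · omega
  push Not at h
  obtain ⟨p, hp, q, hq, hpq⟩ := Finset.one_lt_card.1 h
  have hp' := mem_zr.1 hp
  have hq' := mem_zr.1 hq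
  refine le_trans (Finset.card_le_card ?_) (line_pts hB hB2 hp'.1 hq'.1 hpq)
  have hdv := line_dvd hpq hd {p, q} (by rw [Finset.card_pair hpq]; norm_num) (by
    intro r hr
    simp only [Finset.mem_insert, Finset.mem_singleton] at hr
    rcases hr with rfl | rfl
    · exact ⟨col_left _ _, hp'.2⟩
    · exact ⟨col_right _ _, hq'.2⟩)
  obtain ⟨c, hc⟩ := const_of_dvd (lineP_deg hpq) hd hdv
  intro r hr
  have hr' := mem_zr.1 hr
  refine mem_lin.2 ⟨hr'.1, ?_⟩
  have h3 := hr'.2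
  rw [hc, ev, map_mul, eval_C] at h3
  rcases mul_eq_zero.1 h3 with h | h
  · exact ev_lineP_iff.1 h
  · exfalso; apply hL; rw [hc, h]; simp

theorem zr_mul {P : Finset Pt} {A B : Pol} : zr P (A * B) = zr P A ∪ zr P B := by
  ext p
  simp only [mem_zr, Finset.mem_union, ev, map_mul, mul_eq_zero]
  tauto

theorem unit_of_deg {A : Pol} (h0 : A ≠ 0) (h : A.totalDegree = 0) : IsUnit A := by
  rw [totalDegree_eq_zero_iff_eq_C.1 h] at h0 ⊢
  apply IsUnit.map
  apply IsUnit.mk0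
  intro e
  rw [e] at h0; simp at h0

theorem zr_unit {P : Finset Pt} {A : Pol} (h : IsUnit A) : zr P A = ∅ := by
  ext p
  simp only [mem_zr, Finset.notMem_empty, iff_false, not_and]
  intro _ h2
  have := (h.map (eval ![p.1, p.2])).ne_zero
  exact this h2

/-- reducible splits -/
theorem split_deg {F : Pol} (h0 : F ≠ 0) (hu : ¬ IsUnit F) (hF : ¬ Irreducible F) :
    ∃ A B, F = A * B ∧ A ≠ 0 ∧ B ≠ 0 ∧ 1 ≤ A.totalDegree ∧ 1 ≤ B.totalDegree ∧ F.totalDegree = A.totalDegree + B.totalDegree := by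
  rw [irreducible_iff] at hF
  push Not at hF
  obtain ⟨A, B, h, hA, hB⟩ := hF hu
  have hA0 : A ≠ 0 := by rintro rfl; simp at h; exact h0 h
  have hB0 : B ≠ 0 := by rintro rfl; simp at h; exact h0 h
  refine ⟨A, B, h, hA0, hB0, ?_, ?_, by rw [h, totalDegree_mul_of_isDomain hA0 hB0]⟩
  · by_contra hc; exact hA (unit_of_deg hA0 (by omega))
  · by_contra hc; exact hB (unit_of_deg hB0 (by omega))

theorem zr_two {P : Finset Pt} {B : ℕ} (hB : 3 ≤ B) (hB2 : (bad P).card < (B + 1) * B) {Q : Pol} (hQ : Q ≠ 0)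
    (hd : Q.totalDegree ≤ 2) (hc : 2 * B < (zr P Q).card) : Irreducible Q ∧ Q.totalDegree = 2 := by
  have h2 : Q.totalDegree = 2 := by
    by_contra h
    have := zr_one hB hB2 hQ (by omega); omega
  refine ⟨?_, h2⟩
  by_contra hi
  obtain ⟨X, Y, h, hX, hY, dX, dY, hs⟩ := split_deg hQ (fun hu => by rw [zr_unit hu] at hc; simp at hc) hi
  have h4 := zr_one hB hB2 hX (by omega)
  have h5 := zr_one hB hB2 hY (by omega)
  have h6 := Finset.card_union_le (zr P X) (zr P Y)
  rw [← zr_mul, ← h] at h6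
  omega

theorem zr_three {P : Finset Pt} {B K : ℕ} (hB : 3 ≤ B) (hB2 : (bad P).card < (B + 1) * B)
    (hK : ∀ Q : Pol, Q ≠ 0 → Q.totalDegree ≤ 2 → (zr P Q).card ≤ K) {F : Pol} (hF : F ≠ 0)
    (hd : F.totalDegree ≤ 3) (hc : K + B < (zr P F).card) : Irreducible F ∧ F.totalDegree = 3 := by
  have h2 : F.totalDegree = 3 := by
    by_contra h
    have := hK F hF (by omega); omega
  refine ⟨?_, h2⟩
  by_contra hi
  obtain ⟨X, Y, h, hX, hY, dX, dY, hs⟩ := split_deg hF (fun hu => by rw [zr_unit hu] at hc; simp at hc) hi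
  have h6 := Finset.card_union_le (zr P X) (zr P Y)
  rw [← zr_mul, ← h] at h6
  by_cases h1 : X.totalDegree ≤ 1
  · have h4 := zr_one hB hB2 hX h1
    have h5 := hK Y hY (by omega)
    omega
  · have h4 := zr_one hB hB2 hY (by omega)
    have h5 := hK X hX (by omega)
    omega

/-- conic count -/
theorem conic_count {P : Finset Pt} {Q : Pol} (hQ : Irreducible Q) (hd : Q.totalDegree = 2) :
    (zr P Q).card * (zr P Q).card ≤ (zr P Q).card * (P \ zr P Q).card + (zr P Q).card + (bad P).card := by
  set T := zr P Q with hT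
  have h1 : ∀ x ∈ T.offDiag \ bad P, ∃ r, Tri P x.1 x.2 r := by
    rintro ⟨p, q⟩ h
    simp only [Finset.mem_sdiff, Finset.mem_offDiag] at h
    exact tri_of (zr_sub h.1.1) (zr_sub h.1.2.1) h.1.2.2 h.2
  choose! f hf using h1
  have h2 : (T.offDiag \ bad P).card ≤ (T ×ˢ (P \ T)).card := by
    apply Finset.card_le_card_of_injOn (fun x => (x.1, f x))
    · intro x hx
      have hx' : x ∈ T.offDiag \ bad P := hx
      have ht := hf x hx'
      simp only [Finset.mem_sdiff, Finset.mem_offDiag] at hx'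
      simp only [Finset.coe_product, Set.mem_prod, Finset.mem_coe, Finset.mem_sdiff]
      refine ⟨hx'.1.1, ht.hz, fun hz => ?_⟩
      have h3 := irr_line hQ (by omega) ht.hxy {x.1, x.2, f x} (by
        intro r hr
        simp only [Finset.mem_insert, Finset.mem_singleton] at hr
        rcases hr with rfl | rfl | rfl
        · exact ⟨col_left _ _, (mem_zr.1 hx'.1.1).2⟩
        · exact ⟨col_right _ _, (mem_zr.1 hx'.1.2.1).2⟩
        · exact ⟨ht.col, (mem_zr.1 hz).2⟩)
      rw [hd, Finset.card_eq_three.2 ⟨_, _, _, ht.hxy, ht.hxz, ht.hyz, rfl⟩] at h3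
      omega
    · rintro ⟨x1, x2⟩ hx ⟨y1, y2⟩ hy he
      have tx := hf _ hx
      have ty := hf _ hy
      simp only [Prod.mk.injEq] at he
      obtain ⟨rfl, he⟩ := he
      rw [← he] at ty
      simp only at tx ty
      rcases tx.swap23.all y2 ty.hy ty.col.swap23 with e | e | e
      · exact absurd e.symm ty.hxy
      · exact absurd e ty.hyz
      · rw [e]
  rw [Finset.card_product] at h2
  have h3 := Finset.le_card_sdiff (bad P) T.offDiag
  rw [Finset.offDiag_card] at h3
  have : T.card ≤ T.card * T.card := by nlinarith [Nat.zero_le T.card, Nat.le_mul_self T.card]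
  omega

/-- the conic strip -/
theorem conic_rich {P : Finset Pt} (hP : Inj P) {Q : Pol} (hQ : Irreducible Q) (hd : Q.totalDegree = 2) {r : Pt} (hr : r ∈ P)
    (hrQ : r ∉ zr P Q) (hB : BB P r + (BB P r + 1) * 47 ≤ (zr P Q).card) :
    6 ≤ ((bad P).filter (fun x => x.1 = r)).card := by
  obtain ⟨M, a, b, c, hM, hS, hc⟩ := run_lemma hP hr zr_sub hrQ (K := 7) hB
  obtain ⟨G, hG0, hGd, hGa, hGb, hGc⟩ := hS.cubic hM
  have hst : ∀ s ∈ st M a b, ev G s = 0 := by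
    intro s hs
    simp only [st, Finset.mem_union, Finset.mem_image, Finset.mem_range] at hs
    rcases hs with ⟨i, hi, rfl⟩ | ⟨i, hi, rfl⟩
    · exact hGa i (by omega)
    · exact hGb i (by omega)
  have hdv : Q ∣ G := by
    by_contra hn
    have := bezout hQ hn hGd (zr P Q ∩ st M a b) (fun p hp => by
      rw [Finset.mem_inter] at hp
      exact ⟨(mem_zr.1 hp.1).2, hst p hp.2⟩)
    rw [hd] at this; omega
  obtain ⟨L, hL⟩ := hdv
  have hL0 : L ≠ 0 := by rintro rfl; rw [mul_zero] at hL; exact hG0 hL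
  have hLd : L.totalDegree ≤ 1 := deg_quot hd hQ.ne_zero (hL ▸ hGd)
  have hor : ∀ s, ev G s = 0 → ev Q s = 0 ∨ ev L s = 0 := by
    intro s hs
    rw [hL, ev, map_mul] at hs
    exact mul_eq_zero.1 hs
  have hLcol : ∀ s, ev L s = 0 → s ≠ r → ∀ t, ev L t = 0 → Col r s t := by
    intro s hs hsr t ht
    have hLr : ev L r = 0 := by
      rcases hor r (by rw [← hS.hp]; exact hGc 0 (by norm_num) (by norm_num)) with h | h
      · exact absurd (mem_zr.2 ⟨hr, h⟩) hrQ
      · exact h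
    have hdv := line_dvd hsr.symm hLd {r, s} (by rw [Finset.card_pair hsr.symm]; norm_num) (by
      intro r hr
      simp only [Finset.mem_insert, Finset.mem_singleton] at hr
      rcases hr with rfl | rfl
      · exact ⟨col_left _ _, hLr⟩
      · exact ⟨col_right _ _, hs⟩)
    obtain ⟨c, hc⟩ := const_of_dvd (lineP_deg hsr.symm) hLd hdv
    rw [hc, ev, map_mul, eval_C] at ht
    rcases mul_eq_zero.1 ht with h | h
    · exact ev_lineP_iff.1 h
    · exfalso; apply hL0; rw [hc, h]; simp
  have tri0 : ∀ i ≤ M, Tri P (a i) (b i) r := by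
    intro i hi
    have := hS.tri i hi i hi 0 (by norm_num) (by norm_num) (by simp)
    rwa [hS.hp] at this
  -- exceptional index
  obtain ⟨i0, hi0⟩ : ∃ i0, ∀ i ≤ M, i ≠ i0 → ev Q (a i) = 0 ∧ ev Q (b i) = 0 := by
    by_cases h : ∀ i ≤ M, ev Q (a i) = 0 ∧ ev Q (b i) = 0
    · exact ⟨0, fun i hi _ => h i hi⟩
    push Not at h
    obtain ⟨i0, hi0, h⟩ := h
    have hex : ∃ s, ev L s = 0 ∧ s ≠ r ∧ ∀ t ∈ P, Col r s t → t = a i0 ∨ t = b i0 ∨ t = r := by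
      have t0 := tri0 i0 hi0
      by_cases hq : ev Q (a i0) = 0
      · refine ⟨b i0, (hor _ (hGb i0 hi0)).resolve_left (h hq), t0.hyz, fun t ht hc => ?_⟩
        have := t0.rot.swap.all t ht hc; tauto
      · refine ⟨a i0, (hor _ (hGa i0 hi0)).resolve_left hq, t0.hxz, fun t ht hc => ?_⟩
        have := t0.rot.rot.all t ht hc; tauto
    obtain ⟨s, hs, hsr, hall⟩ := hex
    refine ⟨i0, fun i hi hne => ⟨?_, ?_⟩⟩
    · refine (hor _ (hGa i hi)).resolve_right (fun hl => ?_)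
      rcases hall _ (tri0 i hi).hx (hLcol s hs hsr _ hl) with e | e | e
      · exact hne (hS.ainj _ hi _ hi0 e)
      · exact hS.ab _ hi _ hi0 e
      · exact (tri0 i hi).hxz e
    · refine (hor _ (hGb i hi)).resolve_right (fun hl => ?_)
      rcases hall _ (tri0 i hi).hy (hLcol s hs hsr _ hl) with e | e | e
      · exact hS.ab _ hi0 _ hi e.symm
      · exact hne (hS.binj _ hi _ hi0 e)
      · exact (tri0 i hi).hyz e
  have hLc : ∀ k : ℤ, -3 ≤ k → k ≤ 3 → ev L (c k) = 0 := by
    intro k hk hk'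
    obtain ⟨i, j, hi, hj, hij, hi1, hj1⟩ : ∃ i j : ℕ, i ≤ M ∧ j ≤ M ∧ (j : ℤ) = i + k ∧ i ≠ i0 ∧ j ≠ i0 := by
      have hcase : ∀ i : ℕ, 0 ≤ (i:ℤ) + k → (i:ℤ) + k ≤ M → i ≤ M → i ≠ i0 → (i:ℤ) + k ≠ i0 →
          ∃ i j : ℕ, i ≤ M ∧ j ≤ M ∧ (j : ℤ) = i + k ∧ i ≠ i0 ∧ j ≠ i0 := by
        intro i h1 h2 h3 h4 h5
        exact ⟨i, ((i:ℤ)+k).toNat, h3, by omega, by omega, h4, by omega⟩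
      by_cases hk0 : 0 ≤ k
      · by_cases e0 : (0 ≠ i0 ∧ k ≠ i0)
        · exact hcase 0 (by omega) (by omega) (by omega) e0.1 (by omega)
        by_cases e1 : (1 ≠ i0 ∧ 1 + k ≠ i0)
        · exact hcase 1 (by omega) (by omega) (by omega) e1.1 (by omega)
        exact hcase 2 (by omega) (by omega) (by omega) (by omega) (by omega)
      · by_cases e0 : (3 ≠ i0 ∧ 3 + k ≠ i0)
        · exact hcase 3 (by omega) (by omega) (by omega) e0.1 (by omega)
        by_cases e1 : (4 ≠ i0 ∧ 4 + k ≠ i0)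
        · exact hcase 4 (by omega) (by omega) (by omega) e1.1 (by omega)
        exact hcase 5 (by omega) (by omega) (by omega) (by omega) (by omega)
    have ht := hS.tri i hi j hj k hk hk' hij
    refine (hor _ (hGc k hk hk')).resolve_left (fun hq => ?_)
    have h3 := irr_line hQ (by omega) ht.hxy {a i, b j, c k} (by
      intro r hr
      simp only [Finset.mem_insert, Finset.mem_singleton] at hr
      rcases hr with rfl | rfl | rfl
      · exact ⟨col_left _ _, (hi0 i hi hi1).1⟩
      · exact ⟨col_right _ _, (hi0 j hj hj1).2⟩
      · exact ⟨ht.col, hq⟩)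
    rw [hd, Finset.card_eq_three.2 ⟨_, _, _, ht.hxy, ht.hxz, ht.hyz, rfl⟩] at h3
    omega
  have hcP : ∀ k : ℤ, -3 ≤ k → k ≤ 3 → c k ∈ P := by
    intro k hk hk'
    by_cases h0 : 0 ≤ k
    · exact (hS.tri 0 (by omega) k.toNat (by omega) k hk hk' (by omega)).hz
    · exact (hS.tri (-k).toNat (by omega) 0 (by omega) k hk hk' (by omega)).hz
  set I : Finset ℤ := Finset.Icc (-3) 3 with hI
  have hcard : ∀ J ⊆ I, (J.image c).card = J.card := by
    intro J hJ
    apply Finset.card_image_of_injOn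
    intro x hx y hy he
    have hx' := Finset.mem_Icc.1 (hJ hx)
    have hy' := Finset.mem_Icc.1 (hJ hy)
    exact hS.cinj x hx'.1 hx'.2 y hy'.1 hy'.2 he
  have h6 : (I.erase 0).card = 6 := by rw [hI]; rfl
  have h7 : I.card = 7 := by rw [hI]; rfl
  rw [← h6, ← hcard _ (Finset.erase_subset _ _), ← Finset.card_image_of_injective _ (Prod.mk_right_injective r)]
  apply Finset.card_le_card
  intro x hx
  simp only [Finset.mem_image, Finset.mem_erase] at hx
  obtain ⟨y, ⟨k, ⟨hk0, hkI⟩, rfl⟩, rfl⟩ := hx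
  have hkI' := Finset.mem_Icc.1 hkI
  have hne : c k ≠ r := by
    rw [← hS.hp]
    intro e
    exact hk0 (hS.cinj k hkI'.1 hkI'.2 0 (by norm_num) (by norm_num) e)
  rw [Finset.mem_filter, mem_bad]
  refine ⟨⟨hr, hcP k hkI'.1 hkI'.2, hne.symm, ?_⟩, rfl⟩
  have : I.image c ⊆ lin P r (c k) := by
    intro y hy
    simp only [Finset.mem_image] at hy
    obtain ⟨j, hj, rfl⟩ := hy
    have hj' := Finset.mem_Icc.1 hj
    exact mem_lin.2 ⟨hcP j hj'.1 hj'.2, hLcol _ (hLc k hkI'.1 hkI'.2) hne _ (hLc j hj'.1 hj'.2)⟩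
  have := Finset.card_le_card this
  rw [hcard _ subset_rfl] at this
  omega

end Orch

namespace Orch
open scoped Classical
open MvPolynomial

theorem avg {α : Type*} {P S : Finset α} (hS : S ⊆ P) {f : α → ℕ} {k X : ℕ} (hX : ∑ p ∈ P, f p ≤ X) (hk : ∀ s ∈ S, k ≤ f s) :
    k * S.card ≤ X := by
  have h1 := Finset.card_nsmul_le_sum S f k hk
  have h2 := Finset.sum_le_sum_of_subset (f := f) hS
  rw [smul_eq_mul, mul_comm] at h1
  exact h1.trans (h2.trans hX)

theorem bad_rows (P : Finset Pt) : ∑ r ∈ P, ((bad P).filter (fun x => x.1 = r)).card = (bad P).card :=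
  (Finset.card_eq_sum_card_fiberwise (fun x hx => by
    have hx' : (x.1, x.2) ∈ bad P := hx
    exact (mem_bad.1 hx').1)).symm

theorem no_conic {P : Finset Pt} (hP : Inj P) (hN : (bad P).card ≤ 2 * P.card) {Q : Pol} (hQ : Irreducible Q)
    (hd : Q.totalDegree = 2) {E : ℕ} (hE : P.card ≤ E * (zr P Q).card) (hn : E * (4800 * CC + 48) + 10 * (1 + 2 * E) < P.card) : False := by
  set T := zr P Q with hT
  set n := P.card with hn'
  obtain ⟨c, hc⟩ : ∃ c, c = CC := ⟨_, rfl⟩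
  have hc0 : 0 < c := by rw [hc]; norm_num
  have hsum := sum_BB hP hN
  rw [← hc] at hsum hn
  have hm : 100 * c + (100 * c + 1) * 47 ≤ T.card := by
    have h2 : E * (4800 * c + 48) < E * T.card := by omega
    have := lt_of_mul_lt_mul_left h2 (Nat.zero_le _)
    omega
  set R1 := (P \ T).filter (fun r => 100 * c < BB P r) with hR1
  set R2 := (P \ T).filter (fun r => ¬ 100 * c < BB P r) with hR2
  have hR12 : R1.card + R2.card = (P \ T).card := Finset.card_filter_add_card_filter_not _
  have h1 : (100 * c + 1) * R1.card ≤ c * n := avg ((Finset.filter_subset _ _).trans Finset.sdiff_subset) hsum (fun s hs => (Finset.mem_filter.1 hs).2)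
  have h1' : 100 * R1.card ≤ n := by
    have : c * (100 * R1.card) ≤ c * n := by nlinarith
    exact le_of_mul_le_mul_left this hc0
  have h2 : 6 * R2.card ≤ (bad P).card := avg ((Finset.filter_subset _ _).trans Finset.sdiff_subset) (bad_rows P).le (fun s hs => by
    obtain ⟨h3, h4⟩ := Finset.mem_filter.1 hs
    rw [Finset.mem_sdiff] at h3
    refine conic_rich hP hQ hd h3.1 h3.2 ?_
    have : (BB P s + 1) * 47 ≤ (100 * c + 1) * 47 := Nat.mul_le_mul_right _ (by omega)
    have : BB P s ≤ 100 * c := by omega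
    rw [← hT]
    omega)
  have h3 := conic_count (P := P) hQ hd
  rw [← hT] at h3
  have h4 : T.card ≤ (P \ T).card + 1 + 2 * E := by
    have h5 : T.card * T.card ≤ T.card * ((P \ T).card + 1 + 2 * E) := by nlinarith
    exact le_of_mul_le_mul_left h5 (by omega)
  have h5 : (P \ T).card + T.card = n := Finset.card_sdiff_add_card_eq_card zr_sub
  omega

theorem cubic_out {P : Finset Pt} (hP : Inj P) {F : Pol} (hF : Irreducible F) (hd : F.totalDegree = 3) {r : Pt} (hr : r ∈ P)
    (hrF : r ∉ zr P F) : (zr P F).card ≤ 51 * BB P r + 50 := by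
  by_contra hc
  obtain ⟨M, a, b, c, hM, hS, hc⟩ := run_lemma hP hr zr_sub hrF (K := 10) (by omega)
  obtain ⟨G, hG0, hGd, hGa, hGb, hGc⟩ := hS.cubic hM
  have hst : ∀ s ∈ st M a b, ev G s = 0 := by
    intro s hs
    simp only [st, Finset.mem_union, Finset.mem_image, Finset.mem_range] at hs
    rcases hs with ⟨i, hi, rfl⟩ | ⟨i, hi, rfl⟩
    · exact hGa i (by omega)
    · exact hGb i (by omega)
  have hdv : F ∣ G := by
    by_contra hn
    have := bezout hF hn hGd (zr P F ∩ st M a b) (fun p hp => by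
      rw [Finset.mem_inter] at hp
      exact ⟨(mem_zr.1 hp.1).2, hst p hp.2⟩)
    rw [hd] at this; omega
  obtain ⟨L, hL⟩ := hdv
  have hL0 : L ≠ 0 := by rintro rfl; rw [mul_zero] at hL; exact hG0 hL
  have hLd : L.totalDegree ≤ 0 := deg_quot hd hF.ne_zero (hL ▸ hGd)
  have hu := unit_of_deg hL0 (by omega)
  have h1 : ev G r = 0 := by rw [← hS.hp]; exact hGc 0 (by norm_num) (by norm_num)
  rw [hL, ev, map_mul] at h1
  rcases mul_eq_zero.1 h1 with h | h
  · exact hrF (mem_zr.2 ⟨hr, h⟩)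
  · exact (hu.map (eval ![r.1, r.2])).ne_zero h

set_option maxHeartbeats 1000000 in
theorem partD : ∃ ρ c₁ n₁ : ℕ, ∀ P : Finset Pt, Inj P → n₁ ≤ P.card → (bad P).card ≤ 2 * P.card →
    ∃ F : Pol, Irreducible F ∧ F.totalDegree = 3 ∧ (P \ zr P F).card ≤ ρ ∧
      ∃ p M a b c, 6 ≤ M ∧ Strip P p M a b c ∧ P.card ≤ c₁ * M ∧ (∀ i ≤ M, ev F (a i) = 0) ∧ (∀ i ≤ M, ev F (b i) = 0) ∧
      (∀ k : ℤ, -3 ≤ k → k ≤ 3 → ev F (c k) = 0) := by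
  obtain ⟨C0, hC0⟩ : ∃ c, c = CC := ⟨_, rfl⟩
  have hCp : 0 < C0 := by rw [hC0]; norm_num
  obtain ⟨E, hE⟩ : ∃ E, E = 16 * (C0 + 1) := ⟨_, rfl⟩
  refine ⟨51 * C0 * E + 50, E, E * (4800 * C0 + 48) + 10 * (1 + 2 * E) + 1000 * E * E, fun P hP hn hN => ?_⟩
  have hsum := sum_BB hP hN
  rw [← hC0] at hsum
  have hcn := @no_conic P hP hN
  rw [← hC0] at hcn
  clear hC0
  obtain ⟨n, hn'⟩ : ∃ n, n = P.card := ⟨_, rfl⟩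
  rw [← hn'] at hn hN hsum hcn ⊢
  have hEE : 16 ≤ E := by omega
  have hn0 : 1000 * E * E ≤ n := by omega
  have hn1 : 16000 * E ≤ n := by nlinarith
  obtain ⟨K, hK⟩ : ∃ K, K = n / (2 * (C0 + 1)) := ⟨_, rfl⟩
  have hK1 : 2 * (C0 + 1) * K ≤ n := by rw [hK]; exact Nat.mul_div_le _ _
  have hK2 : n < 2 * (C0 + 1) * (K + 1) := by
    have := Nat.lt_mul_div_succ n (b := 2 * (C0+1)) (by omega)
    rw [hK]; exact this
  have hEK : E * (K + 1) > 8 * n := by nlinarith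
  have hKbig : 100 * E ≤ K := by
    have : E * (1000 * E) ≤ E * (K + 1) := by nlinarith
    have := le_of_mul_le_mul_left this (by omega)
    omega
  obtain ⟨B, hB⟩ : ∃ B, B = K / 8 := ⟨_, rfl⟩
  have hB8 : K < 8 * B + 8 := by omega
  have hBE : 12 * E ≤ B := by omega
  have hB3 : 3 ≤ B := by omega
  have hB2 : (bad P).card < (B + 1) * B := by
    have h1 : 8 * n < 8 * (E * (B + 2)) := by nlinarith
    have h2 : n < E * (B + 2) := by omega
    have h3 : 12 * E * (B + 1) ≤ B * (B + 1) := Nat.mul_le_mul_right _ hBE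
    nlinarith
  -- no conic
  have hcon : ∀ Q : Pol, Q ≠ 0 → Q.totalDegree ≤ 2 → (zr P Q).card ≤ K / 2 := by
    intro Q hQ hQd
    by_contra hc
    push Not at hc
    obtain ⟨hi, h2⟩ := zr_two hB3 hB2 hQ hQd (by omega)
    refine hcn hi h2 (E := E) ?_ ?_
    · have : E * (K + 1) ≤ E * (2 * (zr P Q).card) := Nat.mul_le_mul_left _ (by omega)
      nlinarith
    · nlinarith
  obtain ⟨p0, hp0, hB0⟩ : ∃ p ∈ P, BB P p ≤ C0 := by
    by_contra hcon
    push Not at hcon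
    have h1 : (C0 + 1) * P.card ≤ C0 * n := avg subset_rfl hsum (fun s hs => hcon s hs)
    rw [← hn'] at h1
    nlinarith
  obtain ⟨M, a, b, c, hM, hS, hc⟩ := run_lemma hP hp0 (S := P.erase p0) (Finset.erase_subset _ _) (by simp) (K := K) (by
    rw [Finset.card_erase_of_mem hp0, ← hn']
    have h1 : (BB P p0 + 1) * (K + 40) ≤ (C0 + 1) * (K + 40) := Nat.mul_le_mul_right _ (by omega)
    have h2 : 2 * ((C0 + 1) * (K + 40)) ≤ n + 80 * (C0 + 1) := by nlinarith
    have h3 : 16 * C0 ≤ E := by omega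
    omega)
  obtain ⟨F, hF0, hFd, hFa, hFb, hFc⟩ := hS.cubic hM
  have hst : (P.erase p0) ∩ st M a b ⊆ zr P F := by
    intro s hs
    rw [Finset.mem_inter] at hs
    refine mem_zr.2 ⟨Finset.mem_of_mem_erase hs.1, ?_⟩
    have hs := hs.2
    simp only [st, Finset.mem_union, Finset.mem_image, Finset.mem_range] at hs
    rcases hs with ⟨i, hi, rfl⟩ | ⟨i, hi, rfl⟩
    · exact hFa i (by omega)
    · exact hFb i (by omega)
  have hT := hc.trans (Finset.card_le_card hst)
  obtain ⟨hFi, hF3⟩ := zr_three hB3 hB2 hcon hF0 hFd (by omega)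
  refine ⟨F, hFi, hF3, ?_, p0, M, a, b, c, hM, hS, ?_, hFa, hFb, hFc⟩
  · have h1 : ((zr P F).card - 50) * (P \ zr P F).card ≤ 51 * (C0 * n) := by
      refine avg (P := P) (f := fun r => 51 * BB P r) Finset.sdiff_subset ?_ ?_
      · rw [← Finset.mul_sum]; omega
      · intro s hs
        rw [Finset.mem_sdiff] at hs
        have := cubic_out hP hFi hF3 hs.1 hs.2
        omega
    by_contra hcc
    push Not at hcc
    have h2 : n ≤ E * ((zr P F).card - 50) := by
      have : E * (K + 1) ≤ E * (2 * ((zr P F).card - 50)) := Nat.mul_le_mul_left _ (by omega)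
      nlinarith
    have h3 : n * (51 * C0 * E + 51) ≤ E * (51 * (C0 * n)) := by
      calc n * (51 * C0 * E + 51) ≤ (E * ((zr P F).card - 50)) * (P \ zr P F).card := Nat.mul_le_mul h2 (by omega)
        _ = E * (((zr P F).card - 50) * (P \ zr P F).card) := by ring
        _ ≤ _ := Nat.mul_le_mul_left _ h1
    have h4 : n * (51 * C0 * E + 51) = E * (51 * (C0 * n)) + 51 * n := by ring
    omega
  · have h1 : K ≤ 2 * (M + 1) := by
      refine hc.trans ((Finset.card_le_card Finset.inter_subset_right).trans ?_)
      refine (Finset.card_union_le _ _).trans ?_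
      have h1 := Finset.card_image_le (s := Finset.range (M+1)) (f := a)
      have h2 := Finset.card_image_le (s := Finset.range (M+1)) (f := b)
      rw [Finset.card_range] at h1 h2
      omega
    have : E * (K + 1) ≤ E * (8 * M) := Nat.mul_le_mul_left _ (by omega)
    have h4 : E * (8 * M) = 8 * (E * M) := by ring
    omega

end Orch

namespace Orch
open scoped Classical
open MvPolynomial

/-- cubic form -/
def cu (f : ℕ → ℕ → ℝ) (p : Pt) : ℝ := f 0 0 + f 1 0 * p.1 + f 0 1 * p.2 + f 2 0 * p.1^2 + f 1 1 * p.1 * p.2 + f 0 2 * p.2^2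
  + f 3 0 * p.1^3 + f 2 1 * p.1^2 * p.2 + f 1 2 * p.1 * p.2^2 + f 0 3 * p.2^3
/-- cubic part -/
def cC (f : ℕ → ℕ → ℝ) (p : Pt) : ℝ := f 3 0 * p.1^3 + f 2 1 * p.1^2 * p.2 + f 1 2 * p.1 * p.2^2 + f 0 3 * p.2^3
/-- linear part at a point -/
def cL (f : ℕ → ℕ → ℝ) (a d : Pt) : ℝ :=
  (f 1 0 + 2 * f 2 0 * a.1 + f 1 1 * a.2 + 3 * f 3 0 * a.1^2 + 2 * f 2 1 * a.1 * a.2 + f 1 2 * a.2^2) * d.1 +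
  (f 0 1 + 2 * f 0 2 * a.2 + f 1 1 * a.1 + 3 * f 0 3 * a.2^2 + 2 * f 1 2 * a.1 * a.2 + f 2 1 * a.1^2) * d.2
/-- quadratic part at a point -/
def cQ (f : ℕ → ℕ → ℝ) (a d : Pt) : ℝ :=
  (f 2 0 + 3 * f 3 0 * a.1 + f 2 1 * a.2) * d.1^2 + (f 1 1 + 2 * f 2 1 * a.1 + 2 * f 1 2 * a.2) * d.1 * d.2
  + (f 0 2 + 3 * f 0 3 * a.2 + f 1 2 * a.1) * d.2^2

theorem cu_expand (f : ℕ → ℕ → ℝ) (a d : Pt) (s : ℝ) :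
    cu f (a + s • d) = cu f a + s * cL f a d + s^2 * cQ f a d + s^3 * cC f d := by
  simp only [cu, cL, cQ, cC, Prod.fst_add, Prod.snd_add, Prod.smul_fst, Prod.smul_snd, smul_eq_mul]
  ring

theorem cL_smul (f : ℕ → ℕ → ℝ) (a d : Pt) (s : ℝ) : cL f a (s • d) = s * cL f a d := by
  simp only [cL, Prod.smul_fst, Prod.smul_snd, smul_eq_mul]; ring
theorem cQ_smul (f : ℕ → ℕ → ℝ) (a d : Pt) (s : ℝ) : cQ f a (s • d) = s^2 * cQ f a d := by
  simp only [cQ, Prod.smul_fst, Prod.smul_snd, smul_eq_mul]; ring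
theorem cC_smul (f : ℕ → ℕ → ℝ) (d : Pt) (s : ℝ) : cC f (s • d) = s^3 * cC f d := by
  simp only [cC, Prod.smul_fst, Prod.smul_snd, smul_eq_mul]; ring
theorem cL_shift (f : ℕ → ℕ → ℝ) (a d : Pt) (s : ℝ) :
    cL f (a + s • d) d = cL f a d + 2 * s * cQ f a d + 3 * s^2 * cC f d := by
  simp only [cu, cL, cQ, cC, Prod.fst_add, Prod.snd_add, Prod.smul_fst, Prod.smul_snd, smul_eq_mul]
  ring

/-- the polynomial -/
noncomputable def cuP (f : ℕ → ℕ → ℝ) : Pol := C (f 0 0) + C (f 1 0) * X 0 + C (f 0 1) * X 1 + C (f 2 0) * X 0^2 + C (f 1 1) * X 0 * X 1 + C (f 0 2) * X 1^2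
  + C (f 3 0) * X 0^3 + C (f 2 1) * X 0^2 * X 1 + C (f 1 2) * X 0 * X 1^2 + C (f 0 3) * X 1^3

theorem cuP_add (f g : ℕ → ℕ → ℝ) : cuP (fun i j => f i j + g i j) = cuP f + cuP g := by
  simp only [cuP, C_add]; ring

theorem ev_cuP (f : ℕ → ℕ → ℝ) (p : Pt) : ev (cuP f) p = cu f p := by
  simp [cuP, cu]

theorem cubic_form {F : Pol} (hF : F.totalDegree ≤ 3) : ∃ f, F = cuP f := by
  rw [F.as_sum]
  apply Finset.sum_induction _ (fun G => ∃ f, G = cuP f)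
  · rintro _ _ ⟨f, rfl⟩ ⟨g, rfl⟩
    exact ⟨_, (cuP_add f g).symm⟩
  · exact ⟨fun _ _ => 0, by simp [cuP]⟩
  · intro m hm
    have h1 := le_totalDegree hm
    have h2 : m 0 + m 1 ≤ 3 := by
      rw [Finsupp.sum_fintype _ _ (by simp)] at h1
      simp at h1; omega
    generalize hc : coeff m F = c
    have h3 : (monomial m) c = C c * (X 0 ^ (m 0) * X 1 ^ (m 1) : Pol) := by
      rw [monomial_eq, Finsupp.prod_fintype _ _ (by simp)]
      simp
    rw [h3]
    refine ⟨fun i j => if i = m 0 ∧ j = m 1 then c else 0, ?_⟩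
    obtain ⟨x, hx⟩ : ∃ x, x = m 0 := ⟨_, rfl⟩
    obtain ⟨y, hy⟩ : ∃ y, y = m 1 := ⟨_, rfl⟩
    rw [← hx, ← hy] at h2 ⊢
    clear hx hy h3 hc h1
    have hx : x ≤ 3 := by omega
    have hy : y ≤ 3 := by omega
    interval_cases x <;> interval_cases y <;> first | omega | (simp [cuP]; try ring)

theorem deg_mono (c : ℝ) (i j : ℕ) (a b : ℝ) : (C c * (X 0 - C a) ^ i * (X 1 - C b) ^ j : Pol).totalDegree ≤ i + j := by
  refine (totalDegree_mul _ _).trans (Nat.add_le_add ?_ ?_)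
  · refine (totalDegree_mul _ _).trans ?_
    rw [totalDegree_C, zero_add]
    refine (totalDegree_pow _ _).trans ?_
    have : (X 0 - C a : Pol).totalDegree ≤ 1 := (totalDegree_sub_C_le _ _).trans (totalDegree_X _).le
    nlinarith
  · refine (totalDegree_pow _ _).trans ?_
    have : (X 1 - C b : Pol).totalDegree ≤ 1 := (totalDegree_sub_C_le _ _).trans (totalDegree_X _).le
    nlinarith

/-- functions given by polynomials of degree at most 3 -/
def P3 (g : Pt → ℝ) : Prop := ∃ G : Pol, G.totalDegree ≤ 3 ∧ ∀ p, ev G p = g p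

theorem P3.add {g h : Pt → ℝ} (hg : P3 g) (hh : P3 h) : P3 (fun p => g p + h p) := by
  obtain ⟨G, h1, h2⟩ := hg
  obtain ⟨H, h3, h4⟩ := hh
  exact ⟨G + H, (totalDegree_add _ _).trans (max_le h1 h3), fun p => by simp [← h2, ← h4]⟩

theorem P3.mul {g : Pt → ℝ} (hg : P3 g) (c : ℝ) : P3 (fun p => c * g p) := by
  obtain ⟨G, h1, h2⟩ := hg
  exact ⟨C c * G, (totalDegree_mul _ _).trans (by rw [totalDegree_C]; omega), fun p => by simp [← h2]⟩

theorem P3.mono (a : Pt) (c : ℝ) (i j : ℕ) (h : i + j ≤ 3) : P3 (fun p => c * (p.1 - a.1)^i * (p.2 - a.2)^j) :=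
  ⟨_, (deg_mono c i j a.1 a.2).trans h, fun p => by simp⟩

theorem P3_cC (f : ℕ → ℕ → ℝ) (a : Pt) : P3 (fun p => cC f (p - a)) := by
  convert (((P3.mono a (f 3 0) 3 0 (by norm_num)).add (P3.mono a (f 2 1) 2 1 (by norm_num))).add
    (P3.mono a (f 1 2) 1 2 (by norm_num))).add (P3.mono a (f 0 3) 0 3 (by norm_num)) using 2 with p
  simp [cC]

theorem P3_cL (f : ℕ → ℕ → ℝ) (a : Pt) : P3 (fun p => cL f a (p - a)) := by
  convert (P3.mono a (cL f a (1,0)) 1 0 (by norm_num)).add (P3.mono a (cL f a (0,1)) 0 1 (by norm_num)) using 2 with p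
  simp only [cL, Prod.fst_sub, Prod.snd_sub]; ring

theorem P3_cQ (f : ℕ → ℕ → ℝ) (a : Pt) : P3 (fun p => cQ f a (p - a)) := by
  convert ((P3.mono a (f 2 0 + 3 * f 3 0 * a.1 + f 2 1 * a.2) 2 0 (by norm_num)).add (P3.mono a (f 1 1 + 2 * f 2 1 * a.1 + 2 * f 1 2 * a.2) 1 1 (by norm_num))).add (P3.mono a (f 0 2 + 3 * f 0 3 * a.2 + f 1 2 * a.1) 0 2 (by norm_num)) using 2 with p
  simp only [cQ, Prod.fst_sub, Prod.snd_sub]; ring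

/-- irreducible cubic -/
structure Cub (f : ℕ → ℕ → ℝ) : Prop where
  irr : Irreducible (cuP f)
  deg : (cuP f).totalDegree = 3

theorem Cub.top {f : ℕ → ℕ → ℝ} (h : Cub f) : ∃ d, cC f d ≠ 0 := by
  by_contra hc
  push Not at hc
  have h1 := hc (1, 0)
  have h2 := hc (0, 1)
  have h3 := hc (1, 1)
  have h4 := hc (1, -1)
  simp [cC] at h1 h2 h3 h4
  have h5 : f 1 2 = 0 := by linarith
  have h6 : f 2 1 = 0 := by linarith
  have h7 := h.deg
  have m : ∀ c i j, i + j ≤ 2 → (C c * X 0 ^ i * X 1 ^ j : Pol).totalDegree ≤ 2 := fun c i j hij => by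
    have := deg_mono c i j 0 0; simp at this; omega
  have e : cuP f = C (f 0 0) * X 0 ^ 0 * X 1 ^ 0 + C (f 1 0) * X 0 ^ 1 * X 1 ^ 0 + C (f 0 1) * X 0 ^ 0 * X 1 ^ 1 + C (f 2 0) * X 0 ^ 2 * X 1 ^ 0
      + C (f 1 1) * X 0 ^ 1 * X 1 ^ 1 + C (f 0 2) * X 0 ^ 0 * X 1 ^ 2 := by
    simp only [cuP, h1, h2, h5, h6, C_0]; ring
  have ad : ∀ A B : Pol, A.totalDegree ≤ 2 → B.totalDegree ≤ 2 → (A + B).totalDegree ≤ 2 := fun A B h1 h2 => (totalDegree_add _ _).trans (max_le h1 h2)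
  have : (cuP f).totalDegree ≤ 2 := by
    rw [e]
    exact ad _ _ (ad _ _ (ad _ _ (ad _ _ (ad _ _ (m _ _ _ (by norm_num)) (m _ _ _ (by norm_num))) (m _ _ _ (by norm_num))) (m _ _ _ (by norm_num))) (m _ _ _ (by norm_num))) (m _ _ _ (by norm_num))
  omega

theorem Cub.fin {f : ℕ → ℕ → ℝ} (h : Cub f) {g : Pt → ℝ} (hg : P3 g) (hn : ¬ ∃ c : ℝ, ∀ p, g p = c * cu f p) (S : Finset Pt)
    (hS : ∀ p ∈ S, cu f p = 0 ∧ g p = 0) : S.card ≤ 9 := by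
  obtain ⟨G, h1, h2⟩ := hg
  have := bezout h.irr (G := G) (fun hd => hn ?_) h1 S (fun p hp => ⟨by rw [ev_cuP]; exact (hS p hp).1, by rw [h2]; exact (hS p hp).2⟩)
  · rw [h.deg] at this; omega
  · obtain ⟨H, rfl⟩ := hd
    have h3 : H.totalDegree ≤ 0 := deg_quot h.deg h.irr.ne_zero h1
    have h4 := totalDegree_eq_zero_iff_eq_C.1 (Nat.le_zero.1 h3)
    refine ⟨coeff 0 H, fun p => ?_⟩
    rw [← h2, h4, ← ev_cuP]
    simp [mul_comm]

theorem Cub.line {f : ℕ → ℕ → ℝ} (h : Cub f) {p q : Pt} (hpq : p ≠ q) (S : Finset Pt)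
    (hS : ∀ r ∈ S, Col p q r ∧ cu f r = 0) : S.card ≤ 3 := by
  have := irr_line h.irr (by rw [h.deg]; norm_num) hpq S (fun r hr => ⟨(hS r hr).1, by rw [ev_cuP]; exact (hS r hr).2⟩)
  rwa [h.deg] at this

theorem col_iff {p q r : Pt} (h : p ≠ q) : Col p q r ↔ ∃ s : ℝ, r = p + s • (q - p) := by
  constructor
  · intro hc
    unfold Col at hc
    rcases Pt.ne_iff.1 h with h1 | h1
    · refine ⟨(r.1 - p.1) / (q.1 - p.1), ?_⟩
      ext
      · simp; field_simp; ring
      · simp; field_simp; linarith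
    · refine ⟨(r.2 - p.2) / (q.2 - p.2), ?_⟩
      ext
      · simp; field_simp; linarith
      · simp; field_simp; ring
  · rintro ⟨s, rfl⟩
    unfold Col; simp; ring

theorem smul_pt {p d : Pt} (hd : d ≠ 0) {s t : ℝ} (h : p + s • d = p + t • d) : s = t := by
  have := add_left_cancel h
  exact smul_left_injective ℝ hd this

end Orch

namespace Orch
open scoped Classical
open MvPolynomial

/-- three distinct collinear points of the cubic -/
structure T3 (f : ℕ → ℕ → ℝ) (p q r : Pt) : Prop where
  hp : cu f p = 0
  hq : cu f q = 0
  hr : cu f r = 0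
  pq : p ≠ q
  pr : p ≠ r
  qr : q ≠ r
  col : Col p q r

section
variable {f : ℕ → ℕ → ℝ}

theorem T3.swap {p q r : Pt} (h : T3 f p q r) : T3 f q p r := ⟨h.hq, h.hp, h.hr, h.pq.symm, h.qr, h.pr, h.col.swap12⟩
theorem T3.swap23 {p q r : Pt} (h : T3 f p q r) : T3 f p r q := ⟨h.hp, h.hr, h.hq, h.pr, h.pq, h.qr.symm, h.col.swap23⟩
theorem T3.rot {p q r : Pt} (h : T3 f p q r) : T3 f q r p := h.swap.swap23

theorem T3.mem (hf : Cub f) {p q r s : Pt} (h : T3 f p q r) (hs : cu f s = 0) (hc : Col p q s) : s = p ∨ s = q ∨ s = r := by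
  by_contra hn
  push Not at hn
  have := hf.line h.pq {s, p, q, r} (by
    intro x hx
    simp only [Finset.mem_insert, Finset.mem_singleton] at hx
    rcases hx with rfl | rfl | rfl | rfl
    · exact ⟨hc, hs⟩
    · exact ⟨col_left _ _, h.hp⟩
    · exact ⟨col_right _ _, h.hq⟩
    · exact ⟨h.col, h.hr⟩)
  rw [Finset.card_insert_of_notMem (by simpa using hn), Finset.card_eq_three.2 ⟨_, _, _, h.pq, h.pr, h.qr, rfl⟩] at this
  omega

theorem T3.uniq (hf : Cub f) {p q r s : Pt} (h : T3 f p q r) (h' : T3 f p q s) : r = s := by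
  rcases h'.mem hf h.hr h.col with e | e | e
  · exact absurd e.symm h.pr
  · exact absurd e.symm h.qr
  · exact e

theorem Cub.noline (hf : Cub f) {p d : Pt} (hd : d ≠ 0) (h0 : cu f p = 0) (h1 : cL f p d = 0) (h2 : cQ f p d = 0) (h3 : cC f d = 0) : False := by
  have hall : ∀ s : ℝ, cu f (p + s • d) = 0 := fun s => by rw [cu_expand, h0, h1, h2, h3]; ring
  have hne : p ≠ p + d := by intro e; apply hd; simpa using e.symm
  have hcol : ∀ s : ℝ, Col p (p + d) (p + s • d) := fun s => (col_iff hne).2 ⟨s, by simp⟩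
  have := hf.line hne ((Finset.range 4).image (fun i : ℕ => p + (i : ℝ) • d)) (by
    intro r hr
    simp only [Finset.mem_image] at hr
    obtain ⟨i, _, rfl⟩ := hr
    exact ⟨hcol _, hall _⟩)
  rw [Finset.card_image_of_injective] at this
  · simp at this
  · intro i j e
    exact_mod_cast smul_pt hd e

/-- smooth points -/
def Sm (f : ℕ → ℕ → ℝ) (a : Pt) : Prop := cu f a = 0 ∧ ∃ d, cL f a d ≠ 0

theorem T3.sm (hf : Cub f) {p q r : Pt} (h : T3 f p q r) : Sm f p := by
  refine ⟨h.hp, ?_⟩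
  by_contra hn
  push Not at hn
  obtain ⟨s, hs⟩ := (col_iff h.pq).1 h.col
  have hd : q - p ≠ 0 := sub_ne_zero.2 h.pq.symm
  have hq : q = p + (1:ℝ) • (q - p) := by simp
  have e1 := h.hq
  rw [hq, cu_expand, h.hp, hn] at e1
  have e2 := h.hr
  rw [hs, cu_expand, h.hp, hn] at e2
  have s0 : s ≠ 0 := by rintro rfl; apply h.pr; rw [hs]; simp
  have s1 : s ≠ 1 := by rintro rfl; apply h.qr; rw [hs]; simp
  have e3 : cQ f p (q - p) + s * cC f (q - p) = 0 := by
    have : s^2 * (cQ f p (q - p) + s * cC f (q - p)) = 0 := by linarith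
    exact (mul_eq_zero.1 this).resolve_left (pow_ne_zero _ s0)
  have e4 : cC f (q - p) = 0 := by
    have : (s - 1) * cC f (q - p) = 0 := by linarith
    exact (mul_eq_zero.1 this).resolve_left (sub_ne_zero.2 s1)
  exact hf.noline hd h.hp (hn _) (by rw [e4] at e3; linarith) e4

theorem sing_unique (hf : Cub f) {a b : Pt} (ha : cu f a = 0) (hb : cu f b = 0) (ha' : ¬ Sm f a) (hb' : ¬ Sm f b) : a = b := by
  by_contra hab
  have la : ∀ d, cL f a d = 0 := by
    by_contra hn; push Not at hn; exact ha' ⟨ha, hn⟩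
  have lb : ∀ d, cL f b d = 0 := by
    by_contra hn; push Not at hn; exact hb' ⟨hb, hn⟩
  have hd : b - a ≠ 0 := sub_ne_zero.2 (Ne.symm hab)
  have hq : b = a + (1:ℝ) • (b - a) := by simp
  have e1 := cu_expand f a (b - a) 1
  rw [← hq, ha, hb, la] at e1
  have e2 := cL_shift f a (b - a) 1
  rw [← hq, la, lb] at e2
  exact hf.noline hd ha (la _) (by linarith) (by linarith)

/-- combination -/
def cb (f : ℕ → ℕ → ℝ) (x y z : ℝ) (a p : Pt) : ℝ := x * cL f a (p - a) + y * cQ f a (p - a) + z * cC f (p - a)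

theorem cb_fin (hf : Cub f) {x y z : ℝ} {a : Pt}
    (hn : ∀ c : ℝ, c * cu f a = 0 → (∀ d, x * cL f a d = c * cL f a d) → (∀ d, y * cQ f a d = c * cQ f a d) → (∀ d, z * cC f d = c * cC f d) → False)
    (S : Finset Pt) (hS : ∀ p ∈ S, cu f p = 0 ∧ cb f x y z a p = 0) : S.card ≤ 9 := by
  refine hf.fin (g := cb f x y z a) ((((P3_cL f a).mul x).add ((P3_cQ f a).mul y)).add ((P3_cC f a).mul z)) ?_ S hS
  rintro ⟨c, hc⟩
  have key : ∀ (d : Pt) (s : ℝ), x * (s * cL f a d) + y * (s^2 * cQ f a d) + z * (s^3 * cC f d) =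
      c * (cu f a + s * cL f a d + s^2 * cQ f a d + s^3 * cC f d) := by
    intro d s
    have := hc (a + s • d)
    rw [cu_expand] at this
    rw [← this, cb]
    simp only [add_sub_cancel_left, cL_smul, cQ_smul, cC_smul]
  have k0 : c * cu f a = 0 := by have := key 0 0; linarith
  have : ∀ d, x * cL f a d = c * cL f a d ∧ y * cQ f a d = c * cQ f a d ∧ z * cC f d = c * cC f d := by
    intro d
    have h1 := key d 1
    have h2 := key d (-1)
    have h3 := key d 2
    refine ⟨?_, ?_, ?_⟩ <;> linarith
  exact hn c k0 (fun d => (this d).1) (fun d => (this d).2.1) (fun d => (this d).2.2)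

theorem card3 (S : Finset Pt) (p q r : Pt → Prop) (h : ∀ x ∈ S, p x ∨ q x ∨ r x) : S.card ≤ (S.filter p).card + (S.filter q).card + (S.filter r).card := by
  have : S ⊆ S.filter p ∪ S.filter q ∪ S.filter r := by
    intro x hx
    have := h x hx
    simp only [Finset.mem_union, Finset.mem_filter]; tauto
  refine (Finset.card_le_card this).trans ((Finset.card_union_le _ _).trans ?_)
  have := Finset.card_union_le (S.filter p) (S.filter q)
  omega

theorem G1 (hf : Cub f) {a : Pt} (ha : Sm f a) (S : Finset Pt) (hS : ∀ x ∈ S, cu f x = 0 ∧ x ≠ a ∧ ¬ ∃ z, T3 f a x z) : S.card ≤ 27 := by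
  obtain ⟨ha0, d0, hd0⟩ := ha
  obtain ⟨d1, hd1⟩ := hf.top
  have h1 := cb_fin hf (x := 0) (y := 0) (z := 1) (a := a) (fun c _ hL _ hC => by
    have h1 := hL d0
    have h2 := hC d1
    have : c = 0 := by
      have : c * cL f a d0 = 0 := by linarith
      exact (mul_eq_zero.1 this).resolve_right hd0
    rw [this] at h2; apply hd1; linarith) (S.filter (fun x => cb f 0 0 1 a x = 0)) (by
      intro p hp; rw [Finset.mem_filter] at hp; exact ⟨(hS p hp.1).1, hp.2⟩)
  have h2 := cb_fin hf (x := 1) (y := 0) (z := 0) (a := a) (fun c _ hL _ hC => by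
    have h1 := hL d0
    have h2 := hC d1
    have : c = 0 := by
      have : c * cC f d1 = 0 := by linarith
      exact (mul_eq_zero.1 this).resolve_right hd1
    rw [this] at h1; apply hd0; linarith) (S.filter (fun x => cb f 1 0 0 a x = 0)) (by
      intro p hp; rw [Finset.mem_filter] at hp; exact ⟨(hS p hp.1).1, hp.2⟩)
  have h3 := cb_fin hf (x := 1) (y := 0) (z := -1) (a := a) (fun c _ hL _ hC => by
    have h1 := mul_right_cancel₀ hd0 (hL d0)
    have h2 := mul_right_cancel₀ hd1 (hC d1)
    linarith) (S.filter (fun x => cb f 1 0 (-1) a x = 0)) (by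
      intro p hp; rw [Finset.mem_filter] at hp; exact ⟨(hS p hp.1).1, hp.2⟩)
  have := card3 S (fun x => cb f 0 0 1 a x = 0) (fun x => cb f 1 0 0 a x = 0) (fun x => cb f 1 0 (-1) a x = 0) (by
    intro x hx
    obtain ⟨hx0, hxa, hn⟩ := hS x hx
    by_contra hc
    simp only [cb, not_or, zero_mul, one_mul, zero_add, add_zero] at hc
    obtain ⟨c1, c2, c3⟩ := hc
    apply hn
    have hd : x - a ≠ 0 := sub_ne_zero.2 hxa
    have hq : x = a + (1:ℝ) • (x - a) := by simp
    have e1 := cu_expand f a (x - a) 1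
    rw [← hq, ha0, hx0] at e1
    set L := cL f a (x - a) with hL
    set Q := cQ f a (x - a) with hQ
    set C' := cC f (x - a) with hC
    have s0 : L / C' ≠ 0 := div_ne_zero c2 c1
    have s1 : L / C' ≠ 1 := by rw [Ne, div_eq_one_iff_eq c1]; intro e; apply c3; rw [e]; ring
    refine ⟨a + (L / C') • (x - a), ha0, hx0, ?_, hxa.symm, ?_, ?_, ?_⟩
    · rw [cu_expand, ha0, ← hL, ← hQ, ← hC]
      have : Q = -L - C' := by linarith
      rw [this]; field_simp; ring
    · intro e
      exact s0 (smul_pt hd (s := L / C') (t := 0) (by rw [← e]; simp))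
    · intro e
      exact s1 (smul_pt (p := a) hd (s := L / C') (t := 1) (by rw [← e]; simp))
    · exact (col_iff hxa.symm).2 ⟨_, rfl⟩)
  omega

/-- exceptional directions at `r` -/
def Zr (f : ℕ → ℕ → ℝ) (r t : Pt) : Prop := cb f 0 0 1 r t = 0 ∨ cb f 1 2 3 r t = 0

theorem Zr_card (hf : Cub f) {r : Pt} (hr : cu f r ≠ 0) (S : Finset Pt) (hS : ∀ x ∈ S, cu f x = 0 ∧ Zr f r x) : S.card ≤ 18 := by
  obtain ⟨d1, hd1⟩ := hf.top
  have h1 := cb_fin hf (x := 0) (y := 0) (z := 1) (a := r) (fun c h0 _ _ hC => by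
    have h2 := hC d1
    rw [(mul_eq_zero.1 h0).resolve_right hr] at h2
    apply hd1; linarith) (S.filter (fun x => cb f 0 0 1 r x = 0)) (by
      intro p hp; rw [Finset.mem_filter] at hp; exact ⟨(hS p hp.1).1, hp.2⟩)
  have h2 := cb_fin hf (x := 1) (y := 2) (z := 3) (a := r) (fun c h0 _ _ hC => by
    have h2 := hC d1
    rw [(mul_eq_zero.1 h0).resolve_right hr] at h2
    apply hd1; linarith) (S.filter (fun x => cb f 1 2 3 r x = 0)) (by
      intro p hp; rw [Finset.mem_filter] at hp; exact ⟨(hS p hp.1).1, hp.2⟩)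
  have := card3 S (fun x => cb f 0 0 1 r x = 0) (fun x => cb f 1 2 3 r x = 0) (fun x => False) (by
    intro x hx
    have := (hS x hx).2
    unfold Zr at this; tauto)
  rw [Finset.filter_false, Finset.card_empty] at this
  omega

theorem degen (hf : Cub f) {r t t' : Pt} (hr : cu f r ≠ 0) (ht : cu f t = 0) (ht' : cu f t' = 0) (hne : t ≠ t') (hc : Col r t t')
    (hn : ¬ ∃ z, T3 f t t' z) : Zr f r t ∨ Zr f r t' := by
  have hrt : r ≠ t := by rintro rfl; exact hr ht
  obtain ⟨s, hs⟩ := (col_iff hrt).1 hc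
  have hd : t - r ≠ 0 := sub_ne_zero.2 hrt.symm
  have hq : t = r + (1:ℝ) • (t - r) := by simp
  have e1 := cu_expand f r (t - r) 1
  rw [← hq, ht] at e1
  have e2 := cu_expand f r (t - r) s
  rw [← hs, ht'] at e2
  have s1 : s ≠ 1 := by rintro rfl; apply hne; rw [hs]; simp
  have hts : t' - r = s • (t - r) := by rw [hs]; simp
  unfold Zr cb
  rw [hts, cL_smul, cQ_smul, cC_smul]
  set L := cL f r (t - r) with hL
  set Q := cQ f r (t - r) with hQ
  set C' := cC f (t - r) with hC
  set K := cu f r with hK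
  by_cases hC0 : C' = 0
  · left; left; rw [hC0]; ring
  have e3 : L + (s + 1) * Q + (s^2 + s + 1) * C' = 0 := by
    have : (s - 1) * (L + (s + 1) * Q + (s^2 + s + 1) * C') = 0 := by linear_combination e1 - e2
    exact (mul_eq_zero.1 this).resolve_left (sub_ne_zero.2 s1)
  obtain ⟨u, hu⟩ : ∃ u, Q = -C' * (u + 1 + s) := ⟨-Q / C' - 1 - s, by field_simp; ring⟩
  rw [hu] at e3
  have e4 : L = C' * (s + s * u + u) := by linear_combination e3
  have e5 : K = - C' * (s * u) := by rw [hu, e4] at e1; linear_combination -e1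
  by_cases u1 : u = 1
  · left; right; rw [e4, hu, u1]; ring
  by_cases us : u = s
  · right; right; rw [e4, hu, us]; ring
  exfalso
  apply hn
  refine ⟨r + u • (t - r), ht, ht', ?_, hne, ?_, ?_, ?_⟩
  · rw [cu_expand, ← hL, ← hQ, ← hC, ← hK, e5, e4, hu]; ring
  · intro e
    exact u1 (smul_pt (p := r) hd (s := u) (t := 1) (by rw [← e]; simp))
  · intro e
    exact us (smul_pt (p := r) hd (s := u) (t := s) (by rw [← e]; exact hs))
  · exact Col.trans4 hrt (col_right _ _) hc ((col_iff hrt).2 ⟨_, rfl⟩)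

theorem sing_col (hf : Cub f) {r t t' : Pt} (hr : cu f r = 0) (hs : ¬ Sm f r) (ht : cu f t = 0) (ht' : cu f t' = 0) (h1 : r ≠ t) (h2 : r ≠ t')
    (h3 : t ≠ t') : ¬ Col r t t' := fun hc => hs (T3.sm hf ⟨hr, ht, ht', h1, h2, h3, hc⟩)

theorem cubic_root1 (k l q : ℝ) : ∃ s : ℝ, k + s * l + s^2 * q + s^3 = 0 := by
  obtain ⟨B, hB⟩ : ∃ B, B = 1 + |k| + |l| + |q| := ⟨_, rfl⟩
  have hk := abs_nonneg k
  have hl := abs_nonneg l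
  have hq := abs_nonneg q
  have hB1 : 1 ≤ B := by linarith
  have hB2 : B ≤ B^2 := by nlinarith
  have hB3 : B^3 = B^2 + |k| * B^2 + |l| * B^2 + |q| * B^2 := by
    calc B^3 = B * B^2 := by ring
      _ = (1 + |k| + |l| + |q|) * B^2 := by rw [← hB]
      _ = _ := by ring
  have k1 : |k| ≤ |k| * B^2 := by nlinarith
  have l1 : |l| * B ≤ |l| * B^2 := by nlinarith
  have kn := neg_abs_le k
  have kp := le_abs_self k
  have ln : - (|l| * B) ≤ l * B := by nlinarith [neg_abs_le l]
  have lp : l * B ≤ |l| * B := by nlinarith [le_abs_self l]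
  have qn : - (|q| * B^2) ≤ q * B^2 := by nlinarith [neg_abs_le q]
  have qp : q * B^2 ≤ |q| * B^2 := by nlinarith [le_abs_self q]
  have hc : Continuous (fun s : ℝ => k + s * l + s^2 * q + s^3) := by fun_prop
  have h1 : k + (-B) * l + (-B)^2 * q + (-B)^3 ≤ 0 := by
    have : k + (-B) * l + (-B)^2 * q + (-B)^3 = k - l * B + q * B^2 - B^3 := by ring
    rw [this, hB3]; nlinarith
  have h2 : 0 ≤ k + B * l + B^2 * q + B^3 := by
    rw [hB3]; nlinarith
  exact mem_range_of_exists_le_of_exists_ge hc ⟨-B, h1⟩ ⟨B, h2⟩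

theorem cubic_root (k l q c : ℝ) (hc : c ≠ 0) : ∃ s : ℝ, k + s * l + s^2 * q + s^3 * c = 0 := by
  obtain ⟨s, hs⟩ := cubic_root1 (k / c) (l / c) (q / c)
  refine ⟨s, ?_⟩
  have : k + s * l + s^2 * q + s^3 * c = c * (k / c + s * (l / c) + s^2 * (q / c) + s^3) := by field_simp
  rw [this, hs, mul_zero]

theorem sm_infinite (hf : Cub f) : {x | Sm f x}.Infinite := by
  obtain ⟨d, hd⟩ := hf.top
  have hd0 : d ≠ 0 := by
    rintro rfl; apply hd; simp [cC]
  have hr : ∀ m : ℝ, ∃ s : ℝ, cu f (m • ((-d.2, d.1) : Pt) + s • d) = 0 := by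
    intro m
    obtain ⟨s, hs⟩ := cubic_root (cu f (m • ((-d.2, d.1) : Pt))) (cL f (m • ((-d.2, d.1) : Pt)) d) (cQ f (m • ((-d.2, d.1) : Pt)) d) (cC f d) hd
    exact ⟨s, by rw [cu_expand]; exact hs⟩
  choose s hs using hr
  have hinj : Function.Injective (fun m : ℝ => m • ((-d.2, d.1) : Pt) + s m • d) := by
    intro m m' e
    simp only [Prod.ext_iff, Prod.fst_add, Prod.snd_add, Prod.smul_fst, Prod.smul_snd, smul_eq_mul] at e
    have h1 : (m - m') * (d.1^2 + d.2^2) = 0 := by linear_combination d.1 * e.2 - d.2 * e.1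
    have h2 : d.1^2 + d.2^2 ≠ 0 := by
      intro h
      apply hd0
      have h3 : d.1 = 0 := by nlinarith [sq_nonneg d.1, sq_nonneg d.2]
      have h4 : d.2 = 0 := by nlinarith [sq_nonneg d.1, sq_nonneg d.2]
      exact Prod.ext h3 h4
    exact sub_eq_zero.1 ((mul_eq_zero.1 h1).resolve_right h2)
  have hinf : {x | cu f x = 0}.Infinite := (Set.infinite_range_of_injective hinj).mono (by rintro _ ⟨m, rfl⟩; exact hs m)
  have hfin : {x | cu f x = 0 ∧ ¬ Sm f x}.Finite := Set.Subsingleton.finite (fun a ha b hb => sing_unique hf ha.1 hb.1 ha.2 hb.2)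
  refine (hinf.diff hfin).mono ?_
  rintro x ⟨h1, h2⟩
  by_contra h3
  exact h2 ⟨h1, h3⟩
end
end Orch

namespace Orch
open scoped Classical
open MvPolynomial

section
variable {f : ℕ → ℕ → ℝ}

theorem Cub.noline2 (hf : Cub f) {p q : Pt} (hpq : p ≠ q) (hall : ∀ r, Col p q r → cu f r = 0) : False := by
  have hd : q - p ≠ 0 := sub_ne_zero.2 hpq.symm
  have hc : ∀ s : ℝ, Col p q (p + s • (q - p)) := fun s => (col_iff hpq).2 ⟨s, rfl⟩
  have := hf.line hpq ((Finset.range 4).image (fun i : ℕ => p + (i : ℝ) • (q - p))) (by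
    intro r hr
    simp only [Finset.mem_image] at hr
    obtain ⟨i, _, rfl⟩ := hr
    exact ⟨hc _, hall _ (hc _)⟩)
  rw [Finset.card_image_of_injective] at this
  · simp at this
  · intro i j e
    exact_mod_cast smul_pt hd e

/-- Chasles for an irreducible cubic -/
theorem chas (hf : Cub f) {u b y c e a x z : Pt} (h1 : T3 f u b y) (h2 : T3 f c e a) (h3 : T3 f u c x) (h4 : T3 f b e z) (hxz : x ≠ z)
    (hb : b ≠ c) (hb2 : b ≠ a) (hu : u ≠ e) (hu2 : u ≠ a) (hy : y ≠ c) (hy2 : y ≠ e) (hy3 : y ≠ a) :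
    (∀ p, cu f p = 0 → Col y a p → Col u b p ∨ Col c e p ∨ Col x z p) ∧
    (∀ p, cu f p = 0 → Col x z p → Col u c p ∨ Col b e p ∨ Col y a p) := by
  have key : ∀ p, cu f p = 0 → p ≠ u → p ≠ b → p ≠ y → ¬ Col u b p := by
    intro p hp q1 q2 q3 hc
    rcases h1.mem hf hp hc with h | h | h <;> contradiction
  have key2 : ∀ p, cu f p = 0 → p ≠ c → p ≠ e → p ≠ a → ¬ Col c e p := by
    intro p hp q1 q2 q3 hc
    rcases h2.mem hf hp hc with h | h | h <;> contradiction
  have nb : ¬ Col c e b := key2 b h1.hq hb h4.pq hb2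
  have nu : ¬ Col c e u := key2 u h1.hp h3.pq hu hu2
  have nc : ¬ Col u b c := key c h2.hp h3.pq.symm hb.symm hy.symm
  have ne : ¬ Col u b e := key e h2.hq hu.symm h4.pq.symm hy2.symm
  have na : ¬ Col u b a := key a h2.hr hu2.symm hb2.symm hy3.symm
  have nx : ¬ Col u b x := fun h => nc (Col.trans4 h3.pr (col_left _ _) h.swap23 h3.col.swap23)
  have nz : ¬ Col u b z := fun h => ne (Col.trans4 h4.pr h.rot (col_left _ _) h4.col.swap23)
  have nx2 : ¬ Col c e x := fun h => nu (Col.trans4 h3.qr (col_left _ _) h.swap23 h3.col.rot)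
  have nz2 : ¬ Col c e z := fun h => nb (Col.trans4 h4.qr h.rot (col_left _ _) h4.col.rot)
  obtain ⟨l, m, hF⟩ := chasles (F := cuP f) hf.deg.le h1.pq h1.pr h1.qr h1.col h2.pq h2.pr h2.qr h2.col hxz h3.col h4.col nc ne na nx nz nx2 nz2
    (by rw [ev_cuP, h1.hp]) (by rw [ev_cuP, h1.hq]) (by rw [ev_cuP, h1.hr]) (by rw [ev_cuP, h2.hp]) (by rw [ev_cuP, h2.hq]) (by rw [ev_cuP, h2.hr])
    (by rw [ev_cuP, h3.hr]) (by rw [ev_cuP, h4.hr])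
  have hev : ∀ p, cu f p = l * (ev (lineP u c) p * ev (lineP b e) p * ev (lineP y a) p) + m * (ev (lineP u b) p * ev (lineP c e) p * ev (lineP x z) p) := by
    intro p; rw [← ev_cuP, hF]; simp [ev]
  have hl : l ≠ 0 := by
    rintro rfl
    exact hf.noline2 h1.pq (fun r hr => by rw [hev, ev_lineP_iff.2 hr]; ring)
  have hm : m ≠ 0 := by
    rintro rfl
    exact hf.noline2 h3.pq (fun r hr => by rw [hev, ev_lineP_iff.2 hr]; ring)
  constructor
  · intro p hp hc
    rw [hev, ev_lineP_iff.2 hc] at hp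
    have : ev (lineP u b) p * ev (lineP c e) p * ev (lineP x z) p = 0 := by
      apply (mul_eq_zero.1 _).resolve_left hm; linarith
    rcases mul_eq_zero.1 this with h | h
    · rcases mul_eq_zero.1 h with h | h
      · exact Or.inl (ev_lineP_iff.1 h)
      · exact Or.inr (Or.inl (ev_lineP_iff.1 h))
    · exact Or.inr (Or.inr (ev_lineP_iff.1 h))
  · intro p hp hc
    rw [hev, ev_lineP_iff.2 hc] at hp
    have : ev (lineP u c) p * ev (lineP b e) p * ev (lineP y a) p = 0 := by
      apply (mul_eq_zero.1 _).resolve_left hl; linarith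
    rcases mul_eq_zero.1 this with h | h
    · rcases mul_eq_zero.1 h with h | h
      · exact Or.inl (ev_lineP_iff.1 h)
      · exact Or.inr (Or.inl (ev_lineP_iff.1 h))
    · exact Or.inr (Or.inr (ev_lineP_iff.1 h))

theorem T3.ninl (hf : Cub f) {p q r s : Pt} (h : T3 f p q r) (hs : cu f s = 0) (h1 : s ≠ p) (h2 : s ≠ q) (h3 : s ≠ r) : ¬ Col p q s := by
  intro hc
  rcases h.mem hf hs hc with h | h | h <;> contradiction

theorem assoc_key (hf : Cub f) {a b c e z x u y v w : Pt} (hace : T3 f a c e) (hebz : T3 f e b z) (hba : b ≠ a) (hbc : b ≠ c)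
    (hu : T3 f c x u) (hy : T3 f b u y) (hv : T3 f a y v) (hw : T3 f z x w)
    (gx : x ≠ a ∧ x ≠ b ∧ x ≠ c ∧ x ≠ e ∧ x ≠ z) (gu : u ≠ a ∧ u ≠ b ∧ u ≠ c ∧ u ≠ e ∧ u ≠ z) (gy : y ≠ a ∧ y ≠ b ∧ y ≠ c ∧ y ≠ e ∧ y ≠ z)
    (gv : v ≠ a ∧ v ≠ b ∧ v ≠ c ∧ v ≠ e ∧ v ≠ z) (gw : w ≠ a ∧ w ≠ b ∧ w ≠ c ∧ w ≠ e ∧ w ≠ z) : v = w := by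
  obtain ⟨x1, x2, x3, x4, x5⟩ := gx
  obtain ⟨u1, u2, u3, u4, u5⟩ := gu
  obtain ⟨y1, y2, y3, y4, y5⟩ := gy
  obtain ⟨v1, v2, v3, v4, v5⟩ := gv
  obtain ⟨w1, w2, w3, w4, w5⟩ := gw
  obtain ⟨C1, C2⟩ := chas hf hy.swap hace.rot hu.swap23.swap hebz.swap x5 hbc hba u4 u1 y3 y4 y1
  have hzb : z ≠ c := by
    rintro rfl
    exact hace.rot.ninl hf hebz.hq hbc hebz.pq.symm hba hebz.rot.rot.swap23.col.swap23
  have hza : z ≠ a := by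
    rintro rfl
    exact hace.swap23.ninl hf hebz.hq hba hebz.pq.symm hbc hebz.rot.rot.col
  rcases C1 v hv.hr hv.swap.col with h | h | h
  · rcases hy.swap.mem hf hv.hr h with h | h | h
    · subst h
      exact absurd hv.swap.rot.rot.col.swap23 (hy.rot.ninl hf hv.hp u1.symm hv.pq hba.symm |> fun h h2 => by
        exact h (by first | exact h2 | exact h2.swap12 | exact h2.rot | exact h2.rot.rot | exact h2.swap23 | exact h2.rot.swap12))
    · exact absurd h v2
    · exact absurd h hv.qr.symm
  · rcases hace.rot.mem hf hv.hr h with h | h | h <;> contradiction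
  · rcases hw.swap.mem hf hv.hr h with h | h | h
    · subst h
      rcases C2 w hw.hr hw.swap.col with h | h | h
      · rcases hu.swap23.swap.mem hf hw.hr h with h | h | h
        · subst h
          exfalso
          have := hu.rot.ninl hf hw.hp x5.symm u5.symm hzb
          exact this hw.rot.col
        · exact absurd h w3
        · exact h.symm
      · rcases hebz.swap.mem hf hw.hr h with h | h | h <;> contradiction
      · rcases hv.swap.mem hf hw.hr h with h | h | h
        · subst h
          exfalso
          have := hv.rot.ninl hf hw.hp y5.symm x5.symm hza
          exact this hw.rot.swap.col
        · exact absurd h w1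
        · exact h.symm
    · exact absurd h v5
    · exact h
end
end Orch

namespace Orch
open scoped Classical
open MvPolynomial

theorem abs_group {G Q : Type} [Infinite G] [Group Q] (T : G → G → G → Prop) (sw : ∀ {a b c}, T a b c → T b a c) (sw2 : ∀ {a b c}, T a b c → T a c b)
    (s : G → Equiv.Perm G) (gen : ∀ a, ∀ᶠ x in Filter.cofinite, T a x (s a x)) (S : G → Q) (S2 : ∀ a, S a * S a = 1)
    (R : ∀ a b c e z, T a c e → T e b z → S a * S b * S c = S z) (Sinj : Function.Injective S) :
    ∃ (A : Type) (_ : AddCommGroup A) (φ : G → A) (κ : A), Function.Injective φ ∧ ∀ a b c, T a b c → φ a + φ b + φ c = κ := by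
  have S2' : ∀ a x, S a * (S a * x) = x := fun a x => by rw [← mul_assoc, S2, one_mul]
  have Sinv : ∀ a, (S a)⁻¹ = S a := fun a => inv_eq_of_mul_eq_one_left (S2 a)
  have W : ∀ a b c e z, T a c e → T e b z → S a * S b * S c = S c * S b * S a := fun a b c e z h1 h2 => by
    rw [R a b c e z h1 h2, R c b a e z (sw h1) h2]
  have comm1 : ∀ a b c d e e' z z', T a c e → T e b z → T b d e' → T e' a z' → Commute (S a * S b) (S c * S d) := by
    intro a b c d e e' z z' h1 h2 h3 h4
    have w1 := W a b c e z h1 h2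
    have w2 := W b a d e' z' h3 h4
    show S a * S b * (S c * S d) = S c * S d * (S a * S b)
    calc S a * S b * (S c * S d) = S a * S b * S c * S d := by group
      _ = S c * (S b * S a * S d) := by rw [w1]; group
      _ = S c * S d * (S a * S b) := by rw [w2]; group
  have tend : ∀ a, Filter.Tendsto (s a) Filter.cofinite Filter.cofinite := fun a => (s a).injective.tendsto_cofinite
  have comm2 : ∀ a x c d z, T x d z → Commute (S a * S x) (S c * S d) := by
    intro a x c d e4 hxd
    obtain ⟨q, hq1, hq2⟩ := ((gen a).and (gen d)).exists
    obtain ⟨e, he⟩ : ∃ e, e = s a q := ⟨_, rfl⟩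
    obtain ⟨e2, he2⟩ : ∃ e2, e2 = s d q := ⟨_, rfl⟩
    rw [← he] at hq1
    rw [← he2] at hq2
    obtain ⟨p, h1, h2, h3, h4, h5, h6, h7⟩ := ((gen e).and ((gen c).and (((tend c).eventually (gen q)).and ((gen e2).and
      (((tend e).eventually (gen c)).and (((tend e).eventually ((tend c).eventually (gen x))).and ((tend e).eventually (gen e4)))))))).exists
    obtain ⟨r, hr⟩ : ∃ r, r = s e p := ⟨_, rfl⟩
    rw [← hr] at h1 h5 h6 h7
    have hRR : S p * S q * S r = S a := R p q r e a (sw2 (sw h1)) (by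
      exact sw (sw2 (sw hq1)))
    have : S a * S x = (S p * S q) * (S r * S x) := by rw [← hRR]; group
    rw [this]
    apply Commute.mul_left
    · exact comm1 p q c d _ e2 _ _ (sw h2) (sw h3) (sw hq2) h4
    · exact comm1 r x c d _ e4 _ _ (sw h5) (sw h6) hxd h7
  have comm3 : ∀ a b c d, Commute (S a * S b) (S c * S d) := by
    intro a b c d
    obtain ⟨x, hx⟩ := (gen d).exists
    have h1 := comm2 a x c d _ (sw hx)
    have h2 := (comm2 b x c d _ (sw hx)).inv_left
    rw [mul_inv_rev, Sinv, Sinv] at h2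
    have : S a * S b = (S a * S x) * (S x * S b) := by rw [mul_assoc, S2']
    rw [this]
    exact h1.mul_left h2
  have W' : ∀ a b c, S a * S b * S c = S c * S b * S a := by
    intro a b c
    have h : S a * S b * (S c * S a) = S c * S a * (S a * S b) := comm3 a b c a
    have h2 : S c * S a * (S a * S b) = S c * S b := by rw [mul_assoc, S2']
    rw [h2] at h
    calc S a * S b * S c = (S a * S b * (S c * S a)) * S a := by rw [← mul_assoc, mul_assoc _ (S a) (S a), S2, mul_one]
      _ = _ := by rw [h]
  obtain ⟨K, hK⟩ : ∃ K : Set Q, K = Set.range (fun ab : G × G => S ab.1 * S ab.2) := ⟨_, rfl⟩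
  have hKc : ∀ x ∈ K, ∀ y ∈ K, x * y = y * x := by
    subst hK
    rintro _ ⟨⟨a, b⟩, rfl⟩ _ ⟨⟨c, d⟩, rfl⟩
    exact comm3 a b c d
  letI : CommGroup (Subgroup.closure K) := Subgroup.closureCommGroupOfComm hKc
  obtain ⟨o⟩ : Nonempty G := inferInstance
  have hmem : ∀ a, S o * S a ∈ Subgroup.closure K := fun a => Subgroup.subset_closure (by subst hK; exact ⟨(o, a), rfl⟩)
  obtain ⟨φ, hφ⟩ : ∃ φ : G → Additive (Subgroup.closure K), ∀ a, φ a = Additive.ofMul ⟨S o * S a, hmem a⟩ := ⟨_, fun _ => rfl⟩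
  have hadd : ∀ a b c d, S a * S o * S b = S c * S o * S d → φ a + φ b = φ c + φ d := by
    intro a b c d h
    rw [hφ, hφ, hφ, hφ, ← ofMul_mul, ← ofMul_mul]
    congr 1
    apply Subtype.ext
    show S o * S a * (S o * S b) = S o * S c * (S o * S d)
    calc S o * S a * (S o * S b) = S o * (S a * S o * S b) := by group
      _ = _ := by rw [h]; group
  have hsum : ∀ a b c u z, T a b c → T a u z → φ b + φ c = φ u + φ z := by
    intro a b c u z h1 h2
    apply hadd
    have := R b u c a z (sw2 (sw h1)) h2
    rw [← this]
    calc S b * S o * S c = S b * S o * S u * (S u * S c) := by rw [mul_assoc _ (S u), S2']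
      _ = S u * S o * S b * (S u * S c) := by rw [W' b o u]
      _ = _ := by group
  obtain ⟨g0, hg0⟩ := (gen o).exists
  refine ⟨Additive (Subgroup.closure K), inferInstance, φ, φ o + φ g0 + φ (s o g0), ?_, ?_⟩
  · intro a b h
    rw [hφ, hφ] at h
    have h2 := congrArg Subtype.val (Additive.ofMul.injective h)
    exact Sinj (mul_left_cancel h2)
  · intro a b c h
    obtain ⟨g, h1, h2⟩ := ((gen a).and (gen o)).exists
    rw [add_assoc, hsum a b c _ _ h h1, add_assoc (φ o), hsum o _ _ _ _ hg0 h2]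
    have := hsum g _ _ _ _ (sw h1) (sw h2)
    rw [← add_assoc, add_comm (φ a), add_assoc, this]
    abel

section
variable {f : ℕ → ℕ → ℝ}

theorem group_law (hf : Cub f) : ∃ (A : Type) (_ : AddCommGroup A) (φ : Pt → A) (κ : A), Set.InjOn φ {x | Sm f x} ∧
    ∀ a b c, T3 f a b c → φ a + φ b + φ c = κ := by
  let G := {x : Pt // Sm f x}
  haveI : Infinite G := (sm_infinite hf).to_subtype
  obtain ⟨t, ht1, ht2⟩ : ∃ t : G → G → G, (∀ a x, (∃ z, T3 f a.1 x.1 z) → T3 f a.1 x.1 (t a x).1) ∧ (∀ a x, (¬ ∃ z, T3 f a.1 x.1 z) → t a x = x) := by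
    refine ⟨fun a x => if h : ∃ z, T3 f a.1 x.1 z then ⟨h.choose, h.choose_spec.rot.rot.sm hf⟩ else x, ?_, ?_⟩
    · intro a x h
      simp only [h, dif_pos]
      exact h.choose_spec
    · intro a x h
      simp only [h, dif_neg, not_false_eq_true]
  have hinv : ∀ a, Function.Involutive (t a) := by
    intro a x
    by_cases h : ∃ z, T3 f a.1 x.1 z
    · have h1 := ht1 a x h
      have h2 := ht1 a (t a x) ⟨_, h1.swap23⟩
      exact Subtype.ext (T3.uniq hf h2 h1.swap23)
    · rw [ht2 a x h, ht2 a x h]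
  let s : G → Equiv.Perm G := fun a => (hinv a).toPerm
  have hst : ∀ a x, s a x = t a x := fun a x => rfl
  have gen : ∀ a, ∀ᶠ x in Filter.cofinite, T3 f a.1 x.1 (s a x).1 := by
    intro a
    have hfin : {x : G | ¬ ∃ z, T3 f a.1 x.1 z}.Finite := by
      by_contra hinf
      obtain ⟨U, hU, hUc⟩ := Set.Infinite.exists_subset_card_eq hinf 29
      have := G1 hf a.2 ((U.erase a).image Subtype.val) (by
        intro x hx
        simp only [Finset.mem_image, Finset.mem_erase] at hx
        obtain ⟨y, ⟨hy1, hy2⟩, rfl⟩ := hx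
        exact ⟨y.2.1, fun h => hy1 (Subtype.ext h), hU hy2⟩)
      rw [Finset.card_image_of_injective _ Subtype.val_injective] at this
      have h3 := Finset.pred_card_le_card_erase (s := U) (a := a)
      omega
    rw [Filter.eventually_cofinite]
    refine hfin.subset ?_
    intro x hx h
    exact hx (ht1 a x h)
  let N : Subgroup (Equiv.Perm G) :=
    { carrier := {σ | ∀ᶠ x in Filter.cofinite, σ x = x}
      mul_mem' := by
        intro σ τ h1 h2
        filter_upwards [h2, τ.injective.tendsto_cofinite.eventually h1] with x h3 h4
        show σ (τ x) = x
        rw [h4, h3]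
      one_mem' := by
        show ∀ᶠ x in Filter.cofinite, (1 : Equiv.Perm G) x = x
        exact Filter.Eventually.of_forall (fun x => rfl)
      inv_mem' := by
        intro σ h
        show ∀ᶠ x in Filter.cofinite, σ⁻¹ x = x
        change ∀ᶠ x in Filter.cofinite, σ x = x at h
        filter_upwards [h] with x h1
        exact Equiv.Perm.inv_eq_iff_eq.2 h1.symm }
  haveI : N.Normal := ⟨by
    intro n hn g
    have := (g⁻¹).injective.tendsto_cofinite.eventually hn
    filter_upwards [this] with x hx
    show g (n (g⁻¹ x)) = x
    rw [hx]; simp⟩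
  have mk_eq : ∀ σ τ : Equiv.Perm G, (∀ᶠ x in Filter.cofinite, σ x = τ x) ↔ (QuotientGroup.mk σ : Equiv.Perm G ⧸ N) = QuotientGroup.mk τ := by
    intro σ τ
    rw [QuotientGroup.eq]
    show _ ↔ ∀ᶠ x in Filter.cofinite, (σ⁻¹ * τ) x = x
    apply Filter.eventually_congr
    apply Filter.Eventually.of_forall
    intro x
    show _ ↔ σ⁻¹ (τ x) = x
    rw [Equiv.Perm.inv_eq_iff_eq, eq_comm]
  have ne : ∀ a : G, ∀ᶠ x : G in Filter.cofinite, x.1 ≠ a.1 := by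
    intro a
    rw [Filter.eventually_cofinite]
    refine (Set.finite_singleton a).subset ?_
    intro x hx
    simp only [Set.mem_setOf_eq, not_not] at hx
    exact Subtype.ext hx
  have S2 : ∀ a, (QuotientGroup.mk (s a) : Equiv.Perm G ⧸ N) * QuotientGroup.mk (s a) = 1 := by
    intro a
    rw [← QuotientGroup.mk_mul, ← QuotientGroup.mk_one, ← mk_eq]
    exact Filter.Eventually.of_forall (fun x => hinv a x)
  have tend : ∀ a, Filter.Tendsto (s a) Filter.cofinite Filter.cofinite := fun a => (s a).injective.tendsto_cofinite
  obtain ⟨A, iA, φ, κ, h1, h2⟩ := abs_group (G := G) (Q := Equiv.Perm G ⧸ N) (fun a b c => T3 f a.1 b.1 c.1) (fun h => h.swap) (fun h => h.swap23)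
    s gen (fun a => QuotientGroup.mk (s a)) S2 (by
      intro a b c e z hace hebz
      by_cases hba : b = a
      · subst hba
        have : z = c := Subtype.ext (T3.uniq hf hebz hace.swap23.swap)
        rw [S2, one_mul, this]
      by_cases hbc : b = c
      · subst hbc
        have : z = a := Subtype.ext (T3.uniq hf hebz hace.rot.swap)
        rw [mul_assoc, S2, mul_one, this]
      rw [← QuotientGroup.mk_mul, ← QuotientGroup.mk_mul, ← mk_eq]
      have g5 : ∀ᶠ x : G in Filter.cofinite, x.1 ≠ a.1 ∧ x.1 ≠ b.1 ∧ x.1 ≠ c.1 ∧ x.1 ≠ e.1 ∧ x.1 ≠ z.1 :=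
        (ne a).and ((ne b).and ((ne c).and ((ne e).and (ne z))))
      have tb := (tend b).comp (tend c)
      have ta := (tend a).comp tb
      filter_upwards [gen c, (tend c).eventually (gen b), tb.eventually (gen a), gen z, g5, (tend c).eventually g5, tb.eventually g5,
        ta.eventually g5, (tend z).eventually g5] with x k1 k2 k3 k4 k5 k6 k7 k8 k9
      exact Subtype.ext (assoc_key hf hace hebz (fun h => hba (Subtype.ext h)) (fun h => hbc (Subtype.ext h)) k1 k2 k3 k4 k5 k6 k7 k8 k9)) (by
      intro a b hab
      by_contra hne
      have hab2 := (mk_eq _ _).2 hab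
      obtain ⟨x, k1, k2, k3, k4⟩ := (hab2.and ((gen a).and ((gen b).and (gen a)))).exists
      rw [← k1] at k3
      exact hne (Subtype.ext (T3.uniq hf k2.rot k3.rot)))
  refine ⟨A, iA, fun p => if h : Sm f p then φ ⟨p, h⟩ else κ, κ, ?_, ?_⟩
  · intro p hp q hq h
    simp only [Set.mem_setOf_eq] at hp hq
    simp only [hp, hq, dif_pos] at h
    exact congrArg Subtype.val (h1 h)
  · intro a b c h
    have ha := h.sm hf
    have hb := h.swap.sm hf
    have hc := h.rot.rot.sm hf
    simp only [ha, hb, hc, dif_pos]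
    exact h2 ⟨a, ha⟩ ⟨b, hb⟩ ⟨c, hc⟩ h
end
end Orch

namespace Orch
open scoped Classical
open MvPolynomial

theorem near_coset {A : Type} [AddCommGroup A] (S : Finset A) (κ : A) (K : ℕ) (hm : 100 * K + 1 ≤ S.card)
    (hD : ((S ×ˢ S).filter (fun p => κ - p.1 - p.2 ∉ S)).card ≤ K * S.card) :
    ∃ (H : AddSubgroup A) (C : Finset A) (a0 : A), (∀ x, x ∈ C ↔ x - a0 ∈ H) ∧ κ - a0 - a0 - a0 ∈ H ∧ (S \ C).card ≤ 8 * K ∧ (C \ S).card ≤ 2 * K := by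
  obtain ⟨m, hmm⟩ : ∃ m, m = S.card := ⟨_, rfl⟩
  rw [← hmm] at hm hD
  obtain ⟨d, hd⟩ : ∃ d : A → ℕ, ∀ x, d x = (S.filter (fun y => κ - x - y ∉ S)).card := ⟨_, fun _ => rfl⟩
  have hsum : ∑ x ∈ S, d x ≤ K * m := by
    refine le_trans (le_of_eq ?_) hD
    rw [Finset.card_filter, Finset.sum_product]
    apply Finset.sum_congr rfl
    intro x _
    rw [hd, Finset.card_filter]
  obtain ⟨T, hT⟩ : ∃ T, T = S.filter (fun x => 8 * d x ≤ m) := ⟨_, rfl⟩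
  have hTS : T ⊆ S := hT ▸ Finset.filter_subset _ _
  have hTd : ∀ x ∈ T, 8 * d x ≤ m := fun x hx => by rw [hT] at hx; exact (Finset.mem_filter.1 hx).2
  have hST : (S \ T).card ≤ 8 * K := by
    have h1 : ∑ x ∈ S \ T, m ≤ ∑ x ∈ S \ T, 8 * d x := Finset.sum_le_sum (fun x hx => by
      rw [hT, Finset.mem_sdiff, Finset.mem_filter] at hx
      by_contra h
      exact hx.2 ⟨hx.1, by omega⟩)
    have h2 : ∑ x ∈ S \ T, 8 * d x ≤ ∑ x ∈ S, 8 * d x := Finset.sum_le_sum_of_subset Finset.sdiff_subset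
    have h2' : ∑ x ∈ S, 8 * d x = 8 * ∑ x ∈ S, d x := (Finset.mul_sum _ _ _).symm
    rw [Finset.sum_const, smul_eq_mul] at h1
    by_contra h3
    have : (8 * K + 1) * m ≤ (S \ T).card * m := Nat.mul_le_mul_right _ (by omega)
    have hm0 : 0 < m := by omega
    nlinarith
  have hTc : m ≤ T.card + 8 * K := by
    have := Finset.card_sdiff_add_card_eq_card hTS
    omega
  have hT0 : T.Nonempty := by rw [← Finset.card_pos]; omega
  obtain ⟨a0, ha0⟩ := hT0
  obtain ⟨Hf, hHf⟩ : ∃ Hf, Hf = (T ×ˢ T).image (fun p => p.1 - p.2) := ⟨_, rfl⟩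
  have memH : ∀ x ∈ T, ∀ y ∈ T, x - y ∈ Hf := fun x hx y hy => by
    rw [hHf]; exact Finset.mem_image.2 ⟨(x, y), Finset.mem_product.2 ⟨hx, hy⟩, rfl⟩
  -- shifts
  have shift : ∀ h ∈ Hf, 4 * (S.filter (fun z => z + h ∉ S)).card ≤ m := by
    intro h hh
    rw [hHf, Finset.mem_image] at hh
    obtain ⟨⟨x, x'⟩, hx, rfl⟩ := hh
    rw [Finset.mem_product] at hx
    have h1 := hTd x hx.1
    have h2 := hTd x' hx.2
    rw [hd] at h1 h2
    have g1 : (S.filter (fun y => κ - x - y ∈ S)).card + (S.filter (fun y => κ - x - y ∉ S)).card = m := by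
      rw [hmm]; exact Finset.card_filter_add_card_filter_not _
    have g2 : (S.filter (fun z => z + (x - x') ∈ S)).card + (S.filter (fun z => z + (x - x') ∉ S)).card = m := by
      rw [hmm]; exact Finset.card_filter_add_card_filter_not _
    have g3 : (S.filter (fun y => κ - x - y ∈ S)).card ≤ (S.filter (fun y => κ - x' - y ∉ S)).card + (S.filter (fun z => z + (x - x') ∈ S)).card := by
      have : ((S.filter (fun y => κ - x - y ∈ S)).filter (fun y => κ - x' - y ∈ S)).card ≤ (S.filter (fun z => z + (x - x') ∈ S)).card := by
        apply Finset.card_le_card_of_injOn (fun y => κ - x - y)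
        · intro y hy
          simp only [Finset.coe_filter, Finset.mem_filter, Set.mem_setOf_eq] at hy ⊢
          refine ⟨hy.1.2, ?_⟩
          have : κ - x - y + (x - x') = κ - x' - y := by abel
          rw [this]; exact hy.2
        · intro y _ y' _ h
          simpa using h
      have h4 := Finset.card_filter_add_card_filter_not (s := S.filter (fun y => κ - x - y ∈ S)) (fun y => κ - x' - y ∈ S)
      have h5 : ((S.filter (fun y => κ - x - y ∈ S)).filter (fun y => ¬ κ - x' - y ∈ S)).card ≤ (S.filter (fun y => κ - x' - y ∉ S)).card :=
        Finset.card_le_card (Finset.filter_subset_filter _ (Finset.filter_subset _ _))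
      omega
    show 4 * (S.filter (fun z => z + (x - x') ∉ S)).card ≤ m
    omega
  -- points sent outside T
  have shiftT : ∀ h ∈ Hf, 4 * (S.filter (fun z => z + h ∉ T)).card ≤ m + 32 * K := by
    intro h hh
    have h1 := shift h hh
    have h2 : (S.filter (fun z => z + h ∉ T)).card ≤ (S.filter (fun z => z + h ∉ S)).card + (S \ T).card := by
      have : ((S.filter (fun z => z + h ∉ T)).filter (fun z => z + h ∈ S)).card ≤ (S \ T).card := by
        apply Finset.card_le_card_of_injOn (fun z => z + h)
        · intro z hz
          simp only [Finset.coe_filter, Finset.mem_filter, Set.mem_setOf_eq, Finset.coe_sdiff, Set.mem_diff, Finset.mem_coe] at hz ⊢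
          exact ⟨hz.2, hz.1.2⟩
        · intro y _ y' _ h
          simpa using h
      have h4 := Finset.card_filter_add_card_filter_not (s := S.filter (fun z => z + h ∉ T)) (fun z => z + h ∈ S)
      have h5 : ((S.filter (fun z => z + h ∉ T)).filter (fun z => ¬ z + h ∈ S)).card ≤ (S.filter (fun z => z + h ∉ S)).card :=
        Finset.card_le_card (Finset.filter_subset_filter _ (Finset.filter_subset _ _))
      omega
    omega
  have exists_z : ∀ U V : Finset A, U.card + V.card < m → ∃ z ∈ S, z ∉ U ∧ z ∉ V := by
    intro U V h
    by_contra hn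
    push Not at hn
    have : S ⊆ U ∪ V := by
      intro z hz
      rw [Finset.mem_union]
      by_cases hp : z ∈ U
      · exact Or.inl hp
      · exact Or.inr (hn z hz hp)
    have h2 := (Finset.card_le_card this).trans (Finset.card_union_le _ _)
    omega
  have subH : ∀ h1 ∈ Hf, ∀ h2 ∈ Hf, h1 - h2 ∈ Hf := by
    intro h1 k1 h2 k2
    have e1 := shiftT h1 k1
    have e2 := shiftT h2 k2
    obtain ⟨z, hz, z1, z2⟩ := exists_z _ _ (show (S.filter (fun z => z + h1 ∉ T)).card + (S.filter (fun z => z + h2 ∉ T)).card < m by omega)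
    rw [Finset.mem_filter, not_and, not_not] at z1 z2
    replace z1 := z1 hz
    replace z2 := z2 hz
    have := memH _ z1 _ z2
    have e : z + h1 - (z + h2) = h1 - h2 := by abel
    rwa [e] at this
  have zeroH : (0 : A) ∈ Hf := by have := memH a0 ha0 a0 ha0; simpa using this
  have negH : ∀ h ∈ Hf, -h ∈ Hf := fun h hh => by have := subH 0 zeroH h hh; simpa using this
  have addH : ∀ h ∈ Hf, ∀ h' ∈ Hf, h + h' ∈ Hf := fun h hh h' hh' => by
    have := subH h hh (-h') (negH h' hh'); simpa using this
  let H : AddSubgroup A :=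
    { carrier := {x | x ∈ Hf}
      add_mem' := fun {a b} ha hb => addH a ha b hb
      zero_mem' := zeroH
      neg_mem' := fun {a} ha => negH a ha }
  have hHmem : ∀ x, x ∈ H ↔ x ∈ Hf := fun x => Iff.rfl
  obtain ⟨C, hC⟩ : ∃ C, C = Hf.image (fun h => a0 + h) := ⟨_, rfl⟩
  have hCmem : ∀ x, x ∈ C ↔ x - a0 ∈ H := by
    intro x
    rw [hC, Finset.mem_image, hHmem]
    constructor
    · rintro ⟨h, hh, rfl⟩; simpa using hh
    · intro h; exact ⟨_, h, by abel⟩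
  have hTC : T ⊆ C := fun x hx => (hCmem x).2 (memH x hx a0 ha0)
  have hSC : (S \ C).card ≤ 8 * K := (Finset.card_le_card (Finset.sdiff_subset_sdiff le_rfl hTC)).trans hST
  have hCH : C.card = Hf.card := by rw [hC]; exact Finset.card_image_of_injective _ (fun x y h => by simpa using h)
  have hk : κ - a0 - a0 - a0 ∈ H := by
    have e1 := hTd a0 ha0
    rw [hd] at e1
    obtain ⟨y, hy, y1⟩ : ∃ y ∈ T, κ - a0 - y ∈ T := by
      by_contra hn
      push Not at hn
      have h1 : T.card ≤ (T.filter (fun y => κ - a0 - y ∈ S)).card + (S.filter (fun y => κ - a0 - y ∉ S)).card := by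
        have h4 := Finset.card_filter_add_card_filter_not (s := T) (fun y => κ - a0 - y ∈ S)
        have h5 : (T.filter (fun y => ¬ κ - a0 - y ∈ S)).card ≤ (S.filter (fun y => κ - a0 - y ∉ S)).card :=
          Finset.card_le_card (Finset.filter_subset_filter _ hTS)
        omega
      have h2 : (T.filter (fun y => κ - a0 - y ∈ S)).card ≤ (S \ T).card := by
        apply Finset.card_le_card_of_injOn (fun y => κ - a0 - y)
        · intro y hy
          simp only [Finset.coe_filter, Set.mem_setOf_eq, Finset.coe_sdiff, Set.mem_diff, Finset.mem_coe] at hy ⊢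
          exact ⟨hy.2, hn y hy.1⟩
        · intro y _ y' _ h
          simpa using h
      omega
    have h1 := memH y hy a0 ha0
    have h2 := memH _ y1 a0 ha0
    have h3 := addH _ h1 _ h2
    have e : y - a0 + (κ - a0 - y - a0) = κ - a0 - a0 - a0 := by abel
    rw [e] at h3
    exact h3
  refine ⟨H, C, a0, hCmem, hk, hSC, ?_⟩
  have hHcard : 3 * Hf.card ≤ 4 * m := by
    have h1 : ∑ h ∈ Hf, (S.filter (fun z => z + h ∈ S)).card ≤ m * m := by
      rw [← Finset.card_sigma, hmm, ← Finset.card_product]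
      apply Finset.card_le_card_of_injOn (fun p => (p.2, p.2 + p.1))
      · rintro ⟨h, z⟩ hp
        simp only [Finset.coe_sigma, Set.mem_sigma_iff, Finset.mem_coe, Finset.mem_filter] at hp
        simp only [Finset.coe_product, Set.mem_prod, Finset.mem_coe]
        exact hp.2
      · rintro ⟨h, z⟩ _ ⟨h', z'⟩ _ e
        simp only [Prod.mk.injEq] at e
        obtain ⟨rfl, e⟩ := e
        simp only [add_right_inj] at e
        rw [e]
    have h2 : ∑ h ∈ Hf, 3 * m ≤ ∑ h ∈ Hf, 4 * (S.filter (fun z => z + h ∈ S)).card := Finset.sum_le_sum (fun h hh => by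
      have g1 := shift h hh
      have g2 : (S.filter (fun z => z + h ∈ S)).card + (S.filter (fun z => z + h ∉ S)).card = m := by
        rw [hmm]; exact Finset.card_filter_add_card_filter_not _
      omega)
    rw [Finset.sum_const, smul_eq_mul, ← Finset.mul_sum] at h2
    have hm0 : 0 < m := by omega
    have : Hf.card * 3 * m ≤ 4 * m * m := by nlinarith
    have := Nat.le_of_mul_le_mul_right this hm0
    omega
  have hdec1 : (S \ C).card + (S ∩ C).card = m := by rw [hmm, add_comm]; exact Finset.card_inter_add_card_sdiff _ _
  have hdec2 : (C \ S).card + (S ∩ C).card = C.card := by rw [Finset.inter_comm, add_comm]; exact Finset.card_inter_add_card_sdiff _ _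
  have hflip : ∀ s ∈ C, ∀ y ∈ C, κ - s - y ∈ C := by
    intro s hs y hy
    rw [hCmem] at *
    have := H.sub_mem (H.sub_mem hk hs) hy
    have e : κ - a0 - a0 - a0 - (s - a0) - (y - a0) = κ - s - y - a0 := by abel
    rwa [e] at this
  have hbig : ∑ s ∈ C \ S, ((S ∩ C).filter (fun y => κ - s - y ∈ S)).card ≤ K * m := by
    refine le_trans ?_ hD
    rw [← Finset.card_sigma]
    apply Finset.card_le_card_of_injOn (fun p => (p.2, κ - p.1 - p.2))
    · rintro ⟨s, y⟩ hp
      simp only [Finset.coe_sigma, Set.mem_sigma_iff, Finset.mem_coe, Finset.mem_filter, Finset.mem_sdiff, Finset.mem_inter] at hp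
      simp only [Finset.coe_filter, Finset.mem_product, Set.mem_setOf_eq]
      refine ⟨⟨hp.2.1.1, hp.2.2⟩, ?_⟩
      have : κ - y - (κ - s - y) = s := by abel
      rw [this]; exact hp.1.2
    · rintro ⟨s, y⟩ _ ⟨s', y'⟩ _ e
      simp only [Prod.mk.injEq] at e
      obtain ⟨rfl, e⟩ := e
      simp only [sub_left_inj, sub_right_inj] at e
      rw [e]
  have hlow : ∀ s ∈ C \ S, (S ∩ C).card ≤ ((S ∩ C).filter (fun y => κ - s - y ∈ S)).card + (C \ S).card := by
    intro s hs
    have h1 : ((S ∩ C).filter (fun y => ¬ κ - s - y ∈ S)).card ≤ (C \ S).card := by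
      apply Finset.card_le_card_of_injOn (fun y => κ - s - y)
      · intro y hy
        simp only [Finset.coe_filter, Set.mem_setOf_eq, Finset.coe_sdiff, Set.mem_diff, Finset.mem_coe, Finset.mem_inter] at hy ⊢
        exact ⟨hflip s (Finset.mem_sdiff.1 hs).1 y hy.1.2, hy.2⟩
      · intro y _ y' _ h
        simpa using h
    have h4 := Finset.card_filter_add_card_filter_not (s := S ∩ C) (fun y => κ - s - y ∈ S)
    omega
  have h2 : ∑ s ∈ C \ S, m ≤ ∑ s ∈ C \ S, 2 * ((S ∩ C).filter (fun y => κ - s - y ∈ S)).card := Finset.sum_le_sum (fun s hs => by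
    have := hlow s hs
    omega)
  rw [← Finset.mul_sum, Finset.sum_const, smul_eq_mul] at h2
  have hm0 : 0 < m := by omega
  have : (C \ S).card * m ≤ 2 * K * m := by nlinarith
  exact Nat.le_of_mul_le_mul_right this hm0
end Orch

namespace Orch
open scoped Classical
open MvPolynomial

/-! Sylvester–Gallai (Kelly) -/
noncomputable def kD (a b p : Pt) : ℝ :=
  ((b.1 - a.1) * (p.2 - a.2) - (b.2 - a.2) * (p.1 - a.1))^2 / ((b.1 - a.1)^2 + (b.2 - a.2)^2)

theorem col_zero {a b p : Pt} : Col a b p ↔ (b.1 - a.1) * (p.2 - a.2) - (b.2 - a.2) * (p.1 - a.1) = 0 := by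
  unfold Col
  constructor <;> intro h <;> linarith

theorem nsq_pos {a b : Pt} (h : a ≠ b) : 0 < (b.1 - a.1)^2 + (b.2 - a.2)^2 := by
  by_contra hn
  apply h
  have h1 : b.1 - a.1 = 0 := by nlinarith [sq_nonneg (b.1 - a.1), sq_nonneg (b.2 - a.2)]
  have h2 : b.2 - a.2 = 0 := by nlinarith [sq_nonneg (b.1 - a.1), sq_nonneg (b.2 - a.2)]
  exact Prod.ext (by linarith) (by linarith)

theorem kelly_step {a b p x y : Pt} (hab : a ≠ b) (hp : ¬ Col a b p) {s t e n : ℝ} (hx : x = a + s • (b - a)) (hy : y = a + t • (b - a))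
    (hn : n = (b.1 - a.1)^2 + (b.2 - a.2)^2) (he : e = (p.1 - a.1) * (b.1 - a.1) + (p.2 - a.2) * (b.2 - a.2))
    (h : ((e - s * n) - (e - t * n))^2 ≤ (e - t * n)^2) : kD p y x < kD a b p := by
  have hn0 : 0 < n := hn ▸ nsq_pos hab
  have hpy : p ≠ y := by
    rintro rfl
    exact hp ((col_iff hab).2 ⟨t, hy⟩)
  have hq0 := nsq_pos hpy
  obtain ⟨k, hk⟩ : ∃ k, k = (b.1 - a.1) * (p.2 - a.2) - (b.2 - a.2) * (p.1 - a.1) := ⟨_, rfl⟩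
  have hk0 : k ≠ 0 := fun h0 => hp (col_zero.2 (hk ▸ h0))
  have hk2 : 0 < k^2 := by positivity
  have x1 : x.1 = a.1 + s * (b.1 - a.1) := by rw [hx]; simp
  have x2 : x.2 = a.2 + s * (b.2 - a.2) := by rw [hx]; simp
  have y1 : y.1 = a.1 + t * (b.1 - a.1) := by rw [hy]; simp
  have y2 : y.2 = a.2 + t * (b.2 - a.2) := by rw [hy]; simp
  obtain ⟨q, hq⟩ : ∃ q, q = (y.1 - p.1)^2 + (y.2 - p.2)^2 := ⟨_, rfl⟩
  rw [← hq] at hq0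
  have lag : q * n = (e - t * n)^2 + k^2 := by
    rw [hq, he, hk, y1, y2, hn]; ring
  have cr : ((y.1 - p.1) * (x.2 - p.2) - (y.2 - p.2) * (x.1 - p.1))^2 = (s - t)^2 * k^2 := by
    rw [x1, x2, y1, y2, hk]; ring
  unfold kD
  rw [cr, ← hq, ← hk, ← hn, div_lt_div_iff₀ hq0 hn0]
  have h3 : (s - t)^2 * n < q := by
    have : (s - t)^2 * n * n < q * n := by rw [lag]; nlinarith
    exact lt_of_mul_lt_mul_right this hn0.le
  nlinarith

theorem two_real {x y : ℝ} (h : 0 ≤ x * y) : (x - y)^2 ≤ y^2 ∨ (y - x)^2 ≤ x^2 := by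
  by_contra hn
  push Not at hn
  have h1 : 2 * (x * y) < x^2 := by nlinarith
  have h2 : 2 * (x * y) < y^2 := by nlinarith
  have h3 : (2 * (x * y)) * (2 * (x * y)) ≤ x^2 * y^2 := mul_le_mul h1.le h2.le (by linarith) (sq_nonneg x)
  have h5 : x * y = 0 := by nlinarith
  have h6 : (x * y)^2 = 0 := by rw [h5]; ring
  have h4 : 0 < x^2 * y^2 := mul_pos (by linarith) (by linarith)
  nlinarith

theorem three_real (x y z : ℝ) : 0 ≤ x * y ∨ 0 ≤ x * z ∨ 0 ≤ y * z := by
  by_contra h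
  push Not at h
  nlinarith [mul_pos_of_neg_of_neg h.1 h.2.1, mul_neg_of_pos_of_neg (mul_pos_of_neg_of_neg h.1 h.2.1) h.2.2, sq_nonneg (x * y * z)]

theorem sylvester (F : Finset Pt) (hF : ∀ a ∈ F, ∀ b ∈ F, a ≠ b → ∃ c ∈ F, c ≠ a ∧ c ≠ b ∧ Col a b c) :
    ∀ a ∈ F, ∀ b ∈ F, ∀ c ∈ F, a ≠ b → Col a b c := by
  by_contra hcon
  push Not at hcon
  obtain ⟨a1, ha1, b1, hb1, c1, hc1, hne1, hcol1⟩ := hcon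
  let U := (F ×ˢ F ×ˢ F).filter (fun q => q.1 ≠ q.2.1 ∧ ¬ Col q.1 q.2.1 q.2.2)
  have hU : ∀ a b p, (a, b, p) ∈ U ↔ (a ∈ F ∧ b ∈ F ∧ p ∈ F) ∧ a ≠ b ∧ ¬ Col a b p := by
    intro a b p; simp only [U, Finset.mem_filter, Finset.mem_product]
  obtain ⟨⟨a, b, p⟩, hm, hmin⟩ := Finset.exists_min_image U (fun q => kD q.1 q.2.1 q.2.2) ⟨(a1, b1, c1), (hU _ _ _).2 ⟨⟨ha1, hb1, hc1⟩, hne1, hcol1⟩⟩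
  rw [hU] at hm
  obtain ⟨⟨ha, hb, hp⟩, hab, hcol⟩ := hm
  obtain ⟨c, hc, hca, hcb, hcc⟩ := hF a ha b hb hab
  obtain ⟨s, hs⟩ := (col_iff hab).1 hcc
  obtain ⟨n, hn⟩ : ∃ n, n = (b.1 - a.1)^2 + (b.2 - a.2)^2 := ⟨_, rfl⟩
  obtain ⟨e, he⟩ : ∃ e, e = (p.1 - a.1) * (b.1 - a.1) + (p.2 - a.2) * (b.2 - a.2) := ⟨_, rfl⟩
  have hnot : ∀ x ∈ F, ∀ y ∈ F, x ≠ y → Col a b x → Col a b y → ∀ s t : ℝ, x = a + s • (b - a) → y = a + t • (b - a) →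
      ¬ ((e - s * n) - (e - t * n))^2 ≤ (e - t * n)^2 := by
    intro x hx y hy hxy cx cy s t hxs hyt h
    have h1 := kelly_step hab hcol hxs hyt hn he h
    have hpy : p ≠ y := by rintro rfl; exact hcol cy
    have h2 := hmin (p, y, x) ((hU _ _ _).2 ⟨⟨hp, hy, hx⟩, hpy, fun h3 => by
      exact hcol (Col.trans4 hxy (Col.trans4 hab cx cy (col_left _ _)) (Col.trans4 hab cx cy (col_right _ _)) h3.rot.swap12)⟩)
    exact absurd h1 (not_lt.2 h2)
  have hdbl : ∀ x ∈ F, ∀ y ∈ F, x ≠ y → Col a b x → Col a b y → ∀ s t : ℝ, x = a + s • (b - a) → y = a + t • (b - a) →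
      ¬ 0 ≤ (e - s * n) * (e - t * n) := by
    intro x hx y hy hxy cx cy s t hxs hyt h
    rcases two_real h with h | h
    · exact hnot x hx y hy hxy cx cy s t hxs hyt h
    · exact hnot y hy x hx hxy.symm cy cx t s hyt hxs h
  have pa : a = a + (0 : ℝ) • (b - a) := by simp
  have pb : b = a + (1 : ℝ) • (b - a) := by simp
  rcases three_real (e - 0 * n) (e - 1 * n) (e - s * n) with h | h | h
  · exact hdbl a ha b hb hab (col_left _ _) (col_right _ _) 0 1 pa pb h
  · exact hdbl a ha c hc hca.symm (col_left _ _) hcc 0 s pa hs h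
  · exact hdbl b hb c hc hcb.symm (col_right _ _) hcc 1 s pb hs h

section
variable {f : ℕ → ℕ → ℝ}

theorem third_fun (hf : Cub f) : ∃ s : {x : Pt // Sm f x} → Equiv.Perm {x : Pt // Sm f x}, ∀ a, ∀ᶠ x : {x : Pt // Sm f x} in Filter.cofinite, T3 f a.1 x.1 (s a x).1 := by
  let G := {x : Pt // Sm f x}
  obtain ⟨t, ht1, ht2⟩ : ∃ t : G → G → G, (∀ a x, (∃ z, T3 f a.1 x.1 z) → T3 f a.1 x.1 (t a x).1) ∧ (∀ a x, (¬ ∃ z, T3 f a.1 x.1 z) → t a x = x) := by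
    refine ⟨fun a x => if h : ∃ z, T3 f a.1 x.1 z then ⟨h.choose, h.choose_spec.rot.rot.sm hf⟩ else x, ?_, ?_⟩
    · intro a x h
      simp only [h, dif_pos]
      exact h.choose_spec
    · intro a x h
      simp only [h, dif_neg, not_false_eq_true]
  have hinv : ∀ a, Function.Involutive (t a) := by
    intro a x
    by_cases h : ∃ z, T3 f a.1 x.1 z
    · have h1 := ht1 a x h
      have h2 := ht1 a (t a x) ⟨_, h1.swap23⟩
      exact Subtype.ext (T3.uniq hf h2 h1.swap23)
    · rw [ht2 a x h, ht2 a x h]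
  refine ⟨fun a => (hinv a).toPerm, ?_⟩
  intro a
  have hfin : {x : G | ¬ ∃ z, T3 f a.1 x.1 z}.Finite := by
    by_contra hinf
    obtain ⟨U, hU, hUc⟩ := Set.Infinite.exists_subset_card_eq hinf 29
    have := G1 hf a.2 ((U.erase a).image Subtype.val) (by
      intro x hx
      simp only [Finset.mem_image, Finset.mem_erase] at hx
      obtain ⟨y, ⟨hy1, hy2⟩, rfl⟩ := hx
      exact ⟨y.2.1, fun h => hy1 (Subtype.ext h), hU hy2⟩)
    rw [Finset.card_image_of_injective _ Subtype.val_injective] at this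
    have h3 := Finset.pred_card_le_card_erase (s := U) (a := a)
    omega
  rw [Filter.eventually_cofinite]
  refine hfin.subset ?_
  intro x hx h
  exact hx (ht1 a x h)

theorem col_of_sum (hf : Cub f) {A : Type} [AddCommGroup A] {φ : Pt → A} {κ : A} (hφ : Set.InjOn φ {x | Sm f x})
    (hk : ∀ a b c, T3 f a b c → φ a + φ b + φ c = κ) {a b c : Pt} (ha : Sm f a) (hb : Sm f b) (hc : Sm f c) (hab : a ≠ b)
    (hs : φ a + φ b + φ c = κ) : Col a b c := by
  haveI : Infinite {x : Pt // Sm f x} := (sm_infinite hf).to_subtype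
  obtain ⟨s, gen⟩ := third_fun hf
  have tend : ∀ a, Filter.Tendsto (s a) Filter.cofinite Filter.cofinite := fun a => (s a).injective.tendsto_cofinite
  have ne : ∀ a : {x : Pt // Sm f x}, ∀ᶠ x : {x : Pt // Sm f x} in Filter.cofinite, x.1 ≠ a.1 := by
    intro a
    rw [Filter.eventually_cofinite]
    refine (Set.finite_singleton a).subset ?_
    intro x hx
    simp only [Set.mem_setOf_eq, not_not] at hx
    exact Subtype.ext hx
  let a₀ : {x : Pt // Sm f x} := ⟨a, ha⟩
  let b₀ : {x : Pt // Sm f x} := ⟨b, hb⟩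
  let c₀ : {x : Pt // Sm f x} := ⟨c, hc⟩
  obtain ⟨u, u1, u2, u3, u4, u5⟩ := ((gen a₀).and ((ne b₀).and ((ne c₀).and (((tend a₀).eventually (ne b₀)).and ((tend a₀).eventually (ne c₀)))))).exists
  obtain ⟨a', ha'⟩ : ∃ a', a' = s a₀ u := ⟨_, rfl⟩
  rw [← ha'] at u1 u4 u5
  have tb := tend b₀
  obtain ⟨v, v1, v2, v3, v4, v5, v6, v7, v8, v9, v10⟩ := ((gen b₀).and ((gen u).and ((tb.eventually (gen a')).and
    (((tend u).eventually (gen c₀)).and ((ne a').and ((ne a₀).and ((ne c₀).and ((tb.eventually (ne u)).and ((tb.eventually (ne a₀)).and (tb.eventually (ne c₀))))))))))).exists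
  obtain ⟨b', hb'⟩ : ∃ b', b' = s b₀ v := ⟨_, rfl⟩
  rw [← hb'] at v1 v3 v8 v9 v10
  obtain ⟨w, hw⟩ : ∃ w, w = s u v := ⟨_, rfl⟩
  rw [← hw] at v2 v4
  obtain ⟨c', hc'⟩ : ∃ c', c' = s a' b' := ⟨_, rfl⟩
  rw [← hc'] at v3
  have e : (s c₀ w).1 = c'.1 := by
    apply hφ (s c₀ w).2 c'.2
    have k1 : φ a + φ u.1 + φ a'.1 = κ := hk _ _ _ u1
    have k2 : φ b + φ v.1 + φ b'.1 = κ := hk _ _ _ v1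
    have k3 := hk _ _ _ v2
    have k4 := hk _ _ _ v3
    have k5 : φ c + φ w.1 + φ (s c₀ w).1 = κ := hk _ _ _ v4
    have e5 : φ (s c₀ w).1 = κ - φ c - φ w.1 := by rw [← k5]; abel
    have e4 : φ c'.1 = κ - φ a'.1 - φ b'.1 := by rw [← k4]; abel
    have e1 : φ a'.1 = κ - φ a - φ u.1 := by rw [← k1]; abel
    have e2 : φ b'.1 = κ - φ b - φ v.1 := by rw [← k2]; abel
    have e3 : φ w.1 = κ - φ u.1 - φ v.1 := by rw [← k3]; abel
    have e0 : φ c = κ - φ a - φ b := by rw [← hs]; abel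
    rw [e5, e4, e3, e2, e1, e0]; abel
  rw [e] at v4
  obtain ⟨_, C2⟩ := chas hf u1.rot v1.rot v2 v3 v4.qr v5.symm u4 v8.symm u2 v6.symm v9.symm hab
  rcases C2 c hc.1 v4.rot.col with h | h | h
  · rcases v2.mem hf hc.1 h with h | h | h
    · exact absurd h.symm u3
    · exact absurd h.symm v7
    · exact absurd h v4.pq
  · rcases v3.mem hf hc.1 h with h | h | h
    · exact absurd h.symm u5
    · exact absurd h.symm v10
    · exact absurd h v4.pr
  · exact h
end
end Orch

namespace Orch
open scoped Classical
open MvPolynomial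

theorem cnt {P : Finset Pt} {y : Pt} (W U : Finset Pt) (hU : ∀ t ∈ U, ∃ w ∈ W, Tri P y t w) : U.card ≤ W.card := by
  choose! w hw ht using hU
  apply Finset.card_le_card_of_injOn w
  · intro t h; exact hw t h
  · intro t h t' h' e
    have h1 := (ht t h).swap23
    have h2 := (ht t' h').swap23
    rw [← e] at h2
    rcases h1.all t' h2.hz h2.col with h | h | h
    · exact absurd h.symm h2.hxz
    · exact absurd h.symm h2.hyz
    · exact h.symm

noncomputable def Tm (P : Finset Pt) (f : ℕ → ℕ → ℝ) : Finset Pt := P.filter (fun t => Sm f t)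
noncomputable def Rm (P : Finset Pt) (f : ℕ → ℕ → ℝ) : Finset Pt := P.filter (fun t => ¬ Sm f t)
noncomputable def Vm (P : Finset Pt) (f : ℕ → ℕ → ℝ) (r : Pt) : Finset Pt := (Tm P f).filter (fun t => ∃ t' ∈ Tm P f, Tri P t t' r)

theorem mem_Tm {P : Finset Pt} {f : ℕ → ℕ → ℝ} {t : Pt} : t ∈ Tm P f ↔ t ∈ P ∧ Sm f t := by simp [Tm]
theorem mem_Rm {P : Finset Pt} {f : ℕ → ℕ → ℝ} {t : Pt} : t ∈ Rm P f ↔ t ∈ P ∧ ¬ Sm f t := by simp [Rm]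
theorem mem_Vm {P : Finset Pt} {f : ℕ → ℕ → ℝ} {r t : Pt} : t ∈ Vm P f r ↔ t ∈ Tm P f ∧ ∃ t' ∈ Tm P f, Tri P t t' r := by simp [Vm]

theorem TR {P : Finset Pt} {f : ℕ → ℕ → ℝ} {t : Pt} (h : t ∈ P) : t ∈ Tm P f ∨ t ∈ Rm P f := by
  rw [mem_Tm, mem_Rm]; tauto

theorem TR_card (P : Finset Pt) (f : ℕ → ℕ → ℝ) : (Tm P f).card + (Rm P f).card = P.card :=
  Finset.card_filter_add_card_filter_not _

theorem tri3 {P : Finset Pt} {f : ℕ → ℕ → ℝ} {t u w : Pt} (h : Tri P t u w) (ht : t ∈ Tm P f) (hu : u ∈ Tm P f) (hw : w ∈ Tm P f) : T3 f t u w :=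
  ⟨(mem_Tm.1 ht).2.1, (mem_Tm.1 hu).2.1, (mem_Tm.1 hw).2.1, h.hxy, h.hxz, h.hyz, h.col⟩

structure Ctx {A : Type} [AddCommGroup A] (P : Finset Pt) (f : ℕ → ℕ → ℝ) (φ : Pt → A) (κ : A) (H : AddSubgroup A) (C : Finset A) (a0 : A) (K : ℕ) : Prop where
  hf : Cub f
  inj : Set.InjOn φ {x | Sm f x}
  sum : ∀ a b c, T3 f a b c → φ a + φ b + φ c = κ
  hC : ∀ x, x ∈ C ↔ x - a0 ∈ H
  hk : κ - a0 - a0 - a0 ∈ H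
  hSC : ((Tm P f).image φ \ C).card ≤ 8 * K
  hCS : (C \ (Tm P f).image φ).card ≤ 2 * K

noncomputable def T1 {A : Type} (P : Finset Pt) (f : ℕ → ℕ → ℝ) (φ : Pt → A) (C : Finset A) : Finset Pt := (Tm P f).filter (fun t => φ t ∈ C)
noncomputable def Ym {A : Type} (P : Finset Pt) (f : ℕ → ℕ → ℝ) (φ : Pt → A) (C : Finset A) : Finset Pt := (Tm P f).filter (fun t => φ t ∉ C)

section
variable {A : Type} [AddCommGroup A] {P : Finset Pt} {f : ℕ → ℕ → ℝ} {φ : Pt → A} {κ : A} {H : AddSubgroup A} {C : Finset A} {a0 : A} {K : ℕ}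

theorem mem_T1 {t : Pt} : t ∈ T1 P f φ C ↔ t ∈ Tm P f ∧ φ t ∈ C := by simp [T1]
theorem mem_Ym {t : Pt} : t ∈ Ym P f φ C ↔ t ∈ Tm P f ∧ φ t ∉ C := by simp [Ym]

theorem T1_card (P : Finset Pt) (f : ℕ → ℕ → ℝ) (φ : Pt → A) (C : Finset A) : (T1 P f φ C).card + (Ym P f φ C).card = (Tm P f).card :=
  Finset.card_filter_add_card_filter_not _

namespace Ctx



theorem injT (c : Ctx P f φ κ H C a0 K) {s t : Pt} (hs : s ∈ Tm P f) (ht : t ∈ Tm P f) (h : φ s = φ t) : s = t := c.inj (mem_Tm.1 hs).2 (mem_Tm.1 ht).2 h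

theorem flip (c : Ctx P f φ κ H C a0 K) {x y : A} (hx : x ∈ C) (hy : y ∈ C) : κ - x - y ∈ C := by
  rw [c.hC] at *
  have := H.sub_mem (H.sub_mem c.hk hx) hy
  have e : κ - a0 - a0 - a0 - (x - a0) - (y - a0) = κ - x - y - a0 := by abel
  rwa [e] at this

theorem third_eq (c : Ctx P f φ κ H C a0 K) {x y z : Pt} (h : T3 f x y z) : φ z = κ - φ x - φ y := by rw [← c.sum x y z h]; abel

theorem Ycard (c : Ctx P f φ κ H C a0 K) : (Ym P f φ C).card ≤ 8 * K := by
  refine le_trans ?_ c.hSC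
  apply Finset.card_le_card_of_injOn φ
  · intro t ht
    have ht' := mem_Ym.1 ht
    simp only [Finset.coe_sdiff, Set.mem_diff, Finset.mem_coe]
    exact ⟨Finset.mem_image_of_mem _ ht'.1, ht'.2⟩
  · intro t ht t' ht' e
    exact c.injT (mem_Ym.1 ht).1 (mem_Ym.1 ht').1 e

theorem Ccard (c : Ctx P f φ κ H C a0 K) : C.card ≤ (T1 P f φ C).card + 2 * K := by
  have h1 : (C ∩ (Tm P f).image φ).card ≤ (T1 P f φ C).card := by
    refine le_trans (Finset.card_le_card (t := (T1 P f φ C).image φ) ?_) Finset.card_image_le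
    intro x hx
    rw [Finset.mem_inter, Finset.mem_image] at hx
    obtain ⟨h1, t, ht, rfl⟩ := hx
    exact Finset.mem_image_of_mem _ (mem_T1.2 ⟨ht, h1⟩)
  have h2 := Finset.card_inter_add_card_sdiff C ((Tm P f).image φ)
  have h3 := c.hCS
  omega

theorem Vcard (c : Ctx P f φ κ H C a0 K) {r : Pt} (hr : r ∈ Rm P f) : (Vm P f r).card ≤ 36 + 20 * K := by
  have hr' := mem_Rm.1 hr
  have hf := c.hf
  by_cases hr0 : cu f r = 0
  · have : Vm P f r = ∅ := by
      apply Finset.eq_empty_of_forall_notMem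
      intro t ht
      obtain ⟨h1, t', h2, h3⟩ := mem_Vm.1 ht
      exact sing_col hf hr0 hr'.2 (mem_Tm.1 h1).2.1 (mem_Tm.1 h2).2.1 h3.hxz.symm h3.hyz.symm h3.hxy h3.col.rot.rot
    rw [this]; simp
  obtain ⟨W, hW⟩ : ∃ W, W = (Tm P f).filter (fun t => Zr f r t) ∪ Ym P f φ C := ⟨_, rfl⟩
  have hWc : W.card ≤ 18 + 8 * K := by
    rw [hW]
    refine (Finset.card_union_le _ _).trans (add_le_add ?_ c.Ycard)
    apply Zr_card hf hr0
    intro x hx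
    rw [Finset.mem_filter] at hx
    exact ⟨(mem_Tm.1 hx.1).2.1, hx.2⟩
  have hVex : ∀ t ∈ Vm P f r, ∃ t' ∈ Tm P f, Tri P t t' r := fun t ht => (mem_Vm.1 ht).2
  choose! π hπ1 hπ2 using hVex
  have hVT : ∀ t ∈ Vm P f r, t ∈ Tm P f := fun t ht => (mem_Vm.1 ht).1
  obtain ⟨V2, hV2⟩ : ∃ V2, V2 = (Vm P f r).filter (fun t => π t ∈ W) := ⟨_, rfl⟩
  obtain ⟨V3, hV3⟩ : ∃ V3, V3 = (Vm P f r).filter (fun t => t ∉ W ∧ π t ∉ W) := ⟨_, rfl⟩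
  have hsub : Vm P f r ⊆ W ∪ V2 ∪ V3 := by
    intro t ht
    rw [Finset.mem_union, Finset.mem_union, hV2, hV3, Finset.mem_filter, Finset.mem_filter]
    tauto
  have h2 : V2.card ≤ W.card := by
    apply cnt (P := P) (y := r)
    intro t ht
    rw [hV2, Finset.mem_filter] at ht
    exact ⟨π t, ht.2, (hπ2 t ht.1).rot.rot⟩
  have hz : ∀ t ∈ V3, ∃ z, T3 f t (π t) z ∧ z ≠ r ∧ κ - φ t - φ (π t) ∈ C \ (Tm P f).image φ ∧ φ z = κ - φ t - φ (π t) ∧ Sm f z := by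
    intro t ht
    rw [hV3, Finset.mem_filter, hW, Finset.mem_union, Finset.mem_union, Finset.mem_filter, Finset.mem_filter, mem_Ym, mem_Ym] at ht
    obtain ⟨htV, ht1, ht2⟩ := ht
    have k1 := hVT t htV
    have k2 := hπ1 t htV
    have k3 := hπ2 t htV
    have hex : ∃ z, T3 f t (π t) z := by
      by_contra hn
      rcases degen hf hr0 (mem_Tm.1 k1).2.1 (mem_Tm.1 k2).2.1 k3.hxy k3.col.rot.rot hn with h | h
      · exact ht1 (Or.inl ⟨k1, h⟩)
      · exact ht2 (Or.inl ⟨k2, h⟩)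
    obtain ⟨z, hz⟩ := hex
    have hzr : z ≠ r := by rintro rfl; exact hr0 hz.hr
    have hzs := hz.rot.rot.sm hf
    have e := c.third_eq hz
    refine ⟨z, hz, hzr, ?_, e, hzs⟩
    rw [Finset.mem_sdiff]
    constructor
    · apply c.flip
      · by_contra h; exact ht1 (Or.inr ⟨k1, h⟩)
      · by_contra h; exact ht2 (Or.inr ⟨k2, h⟩)
    · rw [← e, Finset.mem_image]
      rintro ⟨w, hw, hwz⟩
      have : w = z := c.inj (mem_Tm.1 hw).2 hzs hwz
      subst this
      rcases k3.all w (mem_Tm.1 hw).1 hz.col with h | h | h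
      · exact hz.pr h.symm
      · exact hz.qr h.symm
      · exact hzr h
  have h3 : V3.card ≤ 2 * (C \ (Tm P f).image φ).card := by
    apply Finset.card_le_mul_card_image_of_maps_to (f := fun t => κ - φ t - φ (π t))
    · intro t ht
      obtain ⟨z, _, _, h, _⟩ := hz t ht
      exact h
    · intro s _
      by_cases hne : (V3.filter (fun t => κ - φ t - φ (π t) = s)).Nonempty
      · obtain ⟨t1, ht1⟩ := hne
        rw [Finset.mem_filter] at ht1
        obtain ⟨z, hz1, hz2, _, hz3, hz4⟩ := hz t1 ht1.1
        refine (Finset.card_le_card (t := {t1, π t1}) ?_).trans Finset.card_le_two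
        intro t ht
        rw [Finset.mem_filter] at ht
        obtain ⟨z', hz1', hz2', _, hz3', hz4'⟩ := hz t ht.1
        have : z' = z := c.inj hz4' hz4 (by rw [hz3, hz3', ht1.2, ht.2])
        subst this
        have q1 : t1 ∈ Vm P f r := by rw [hV3, Finset.mem_filter] at ht1; exact ht1.1.1
        have q2 : t ∈ Vm P f r := by rw [hV3, Finset.mem_filter] at ht; exact ht.1.1
        have b1 := (hπ2 t1 q1)
        have b2 := (hπ2 t q2)
        have e1 : Col z' r t1 := Col.trans4 hz1.pq hz1.col b1.col (col_left _ _)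
        have e2 : Col z' r (π t1) := Col.trans4 hz1.pq hz1.col b1.col (col_right _ _)
        have e3 : Col z' r t := Col.trans4 hz1'.pq hz1'.col b2.col (col_left _ _)
        rcases hz1.mem hf hz1'.hp (Col.trans4 hz2 e1 e2 e3) with h | h | h
        · simp [h]
        · simp [h]
        · exact absurd h hz1'.pr
      · rw [Finset.not_nonempty_iff_eq_empty] at hne
        rw [hne]; simp
  have h4 := (Finset.card_le_card hsub).trans (Finset.card_union_le _ _)
  have h5 := Finset.card_union_le W V2
  have h6 := c.hCS
  omega


end Ctx
end
end Orch

namespace Orch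
open scoped Classical
open MvPolynomial

section
variable {A : Type} [AddCommGroup A] {P : Finset Pt} {f : ℕ → ℕ → ℝ} {φ : Pt → A} {κ : A} {H : AddSubgroup A} {C : Finset A} {a0 : A} {K : ℕ}

/-- points whose `ψ`-partner gives a bad pair -/
noncomputable def Ep (P : Finset Pt) (f : ℕ → ℕ → ℝ) (φ : Pt → A) (C : Finset A) (ψ : A → A) : Finset Pt :=
  (T1 P f φ C).filter (fun t => ∃ u ∈ T1 P f φ C, φ u = ψ (φ t) ∧ u ≠ t ∧ (t, u) ∈ bad P)

theorem Ctx.pairs (c : Ctx P f φ κ H C a0 K) (ψ : A → A) (hψ : ∀ x ∈ C, ψ x ∈ C)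
    (h3 : ∀ t ∈ T1 P f φ C, ∀ u ∈ Tm P f, ∀ w ∈ Tm P f, φ u = ψ (φ t) → ¬ T3 f t u w) :
    (T1 P f φ C).card ≤ (Ep P f φ C ψ).card + ((T1 P f φ C).filter (fun t => ψ (φ t) ∈ C \ (Tm P f).image φ)).card
      + ((T1 P f φ C).filter (fun t => ψ (φ t) = φ t)).card + (Rm P f).card * (36 + 20 * K) := by
  have hsub : T1 P f φ C ⊆ Ep P f φ C ψ ∪ (T1 P f φ C).filter (fun t => ψ (φ t) ∈ C \ (Tm P f).image φ)
      ∪ (T1 P f φ C).filter (fun t => ψ (φ t) = φ t) ∪ (Rm P f).biUnion (Vm P f) := by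
    intro t ht
    rw [Finset.mem_union, Finset.mem_union, Finset.mem_union, Ep, Finset.mem_filter, Finset.mem_filter, Finset.mem_filter, Finset.mem_biUnion]
    by_contra hn
    push Not at hn
    obtain ⟨⟨⟨n1, n2⟩, n3⟩, n4⟩ := hn
    have n2 := n2 ht
    have ht' := mem_T1.1 ht
    rw [Finset.mem_sdiff, not_and, not_not, Finset.mem_image] at n2
    obtain ⟨u, hu, hue⟩ := n2 (hψ _ ht'.2)
    have hut : u ≠ t := by rintro rfl; exact n3 ht hue.symm
    have hu1 : u ∈ T1 P f φ C := mem_T1.2 ⟨hu, hue ▸ hψ _ ht'.2⟩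
    obtain ⟨w, hw⟩ := tri_of (mem_Tm.1 ht'.1).1 (mem_Tm.1 hu).1 hut.symm (n1 ht u hu1 hue hut)
    rcases TR (f := f) hw.hz with h | h
    · exact h3 t ht u hu w h hue (tri3 hw ht'.1 hu h)
    · exact n4 w h (mem_Vm.2 ⟨ht'.1, u, hu, hw⟩)
  have h1 := Finset.card_le_card hsub
  have h2 := Finset.card_union_le (Ep P f φ C ψ ∪ (T1 P f φ C).filter (fun t => ψ (φ t) ∈ C \ (Tm P f).image φ)
      ∪ (T1 P f φ C).filter (fun t => ψ (φ t) = φ t)) ((Rm P f).biUnion (Vm P f))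
  have h3 := Finset.card_union_le (Ep P f φ C ψ ∪ (T1 P f φ C).filter (fun t => ψ (φ t) ∈ C \ (Tm P f).image φ))
      ((T1 P f φ C).filter (fun t => ψ (φ t) = φ t))
  have h4 := Finset.card_union_le (Ep P f φ C ψ) ((T1 P f φ C).filter (fun t => ψ (φ t) ∈ C \ (Tm P f).image φ))
  have h5 : ((Rm P f).biUnion (Vm P f)).card ≤ (Rm P f).card * (36 + 20 * K) := Finset.card_biUnion_le_card_mul _ _ _ (fun r hr => c.Vcard hr)
  omega

/-- the tangent pairs -/
theorem Ctx.tangent (c : Ctx P f φ κ H C a0 K) :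
    (T1 P f φ C).card ≤ (Ep P f φ C (fun x => κ - x - x)).card + ((T1 P f φ C).filter (fun t => κ - φ t - φ t ∈ C \ (Tm P f).image φ)).card
      + ((T1 P f φ C).filter (fun t => κ - φ t - φ t = φ t)).card + (Rm P f).card * (36 + 20 * K) := by
  apply c.pairs (fun x => κ - x - x) (fun x hx => c.flip hx hx)
  intro t ht u hu w hw he h
  have h1 := c.third_eq h
  rw [he] at h1
  have h2 : φ w = φ t := by rw [h1]; abel
  exact h.pr (c.injT hw (mem_T1.1 ht).1 h2).symm

theorem Ctx.count (c : Ctx P f φ κ H C a0 K) (E : Finset (Pt × Pt)) (hE : E ⊆ bad P)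
    (hd : ∀ p q, (p, q) ∈ E → p ∈ T1 P f φ C → q ∈ T1 P f φ C → φ q ≠ κ - φ p - φ p ∧ φ p ≠ κ - φ q - φ q) :
    2 * (Ep P f φ C (fun x => κ - x - x)).card + E.card ≤ (bad P).card := by
  have hex : ∀ t ∈ Ep P f φ C (fun x => κ - x - x), ∃ u, u ∈ T1 P f φ C ∧ φ u = κ - φ t - φ t ∧ u ≠ t ∧ (t, u) ∈ bad P := by
    intro t ht
    rw [Ep, Finset.mem_filter] at ht
    exact ht.2
  have hT : ∀ t ∈ Ep P f φ C (fun x => κ - x - x), t ∈ T1 P f φ C := by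
    intro t ht
    rw [Ep, Finset.mem_filter] at ht
    exact ht.1
  choose! u hu1 hu2 hu3 hu4 using hex
  obtain ⟨B1, hB1⟩ : ∃ B1, B1 = (Ep P f φ C (fun x => κ - x - x)).image (fun t => (t, u t)) := ⟨_, rfl⟩
  obtain ⟨B2, hB2⟩ : ∃ B2, B2 = (Ep P f φ C (fun x => κ - x - x)).image (fun t => (u t, t)) := ⟨_, rfl⟩
  have c1 : B1.card = (Ep P f φ C (fun x => κ - x - x)).card := by
    rw [hB1]; exact Finset.card_image_of_injective _ (fun x y h => (Prod.mk.inj h).1)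
  have c2 : B2.card = (Ep P f φ C (fun x => κ - x - x)).card := by
    rw [hB2]; exact Finset.card_image_of_injective _ (fun x y h => (Prod.mk.inj h).2)
  have d12 : Disjoint B1 B2 := by
    rw [Finset.disjoint_left]
    rintro ⟨p, q⟩ h1 h2
    rw [hB1, Finset.mem_image] at h1
    rw [hB2, Finset.mem_image] at h2
    obtain ⟨t, ht, e1⟩ := h1
    obtain ⟨t', ht', e2⟩ := h2
    simp only [Prod.mk.injEq] at e1 e2
    obtain ⟨rfl, rfl⟩ := e1
    obtain ⟨e2, rfl⟩ := e2
    have k1 := hu2 t ht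
    have k2 := hu2 (u t) ht'
    rw [e2] at k2
    have : φ (u t) = φ t := by
      have : φ (u t) - φ t = φ (u t) - φ t + (φ (u t) - φ t) := by
        nth_rw 1 [k1]; nth_rw 1 [k2]; abel
      have := left_eq_add.1 this
      exact sub_eq_zero.1 this
    exact hu3 t ht (c.injT (mem_T1.1 (hu1 t ht)).1 (mem_T1.1 (hT t ht)).1 this)
  have d1 : Disjoint (B1 ∪ B2) E := by
    rw [Finset.disjoint_left]
    rintro ⟨p, q⟩ h1 h2
    rw [Finset.mem_union, hB1, hB2, Finset.mem_image, Finset.mem_image] at h1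
    rcases h1 with ⟨t, ht, e1⟩ | ⟨t, ht, e1⟩
    · simp only [Prod.mk.injEq] at e1
      obtain ⟨rfl, rfl⟩ := e1
      exact (hd _ _ h2 (hT _ ht) (hu1 _ ht)).1 (hu2 _ ht)
    · simp only [Prod.mk.injEq] at e1
      obtain ⟨rfl, rfl⟩ := e1
      exact (hd _ _ h2 (hu1 _ ht) (hT _ ht)).2 (hu2 _ ht)
  have hbs : ∀ p q, (p, q) ∈ bad P → (q, p) ∈ bad P := by
    intro p q h
    by_contra hn
    have h' := mem_bad.1 h
    obtain ⟨r, hr⟩ := tri_of h'.2.1 h'.1 h'.2.2.1.symm hn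
    exact hr.swap.not_bad h
  have hsub : B1 ∪ B2 ∪ E ⊆ bad P := by
    apply Finset.union_subset _ hE
    apply Finset.union_subset
    · rw [hB1]
      intro x hx
      obtain ⟨t, ht, rfl⟩ := Finset.mem_image.1 hx
      exact hu4 t ht
    · rw [hB2]
      intro x hx
      obtain ⟨t, ht, rfl⟩ := Finset.mem_image.1 hx
      exact hbs _ _ (hu4 t ht)
  have := Finset.card_le_card hsub
  rw [Finset.card_union_of_disjoint d1, Finset.card_union_of_disjoint d12] at this
  omega

/-- extra pairs from a point off the curve -/
theorem Ctx.extraR (c : Ctx P f φ κ H C a0 K) {r : Pt} (hr : r ∈ Rm P f) :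
    2 * (Ep P f φ C (fun x => κ - x - x)).card + (Tm P f).card ≤ (bad P).card + (36 + 20 * K) + (Rm P f).card := by
  obtain ⟨U, hU⟩ : ∃ U, U = (Tm P f).filter (fun t => (r, t) ∈ bad P) := ⟨_, rfl⟩
  obtain ⟨W, hW⟩ : ∃ W, W = (Tm P f).filter (fun t => ∃ w ∈ Rm P f, Tri P r t w) := ⟨_, rfl⟩
  have hsub : Tm P f ⊆ U ∪ Vm P f r ∪ W := by
    intro t ht
    rw [Finset.mem_union, Finset.mem_union, hU, hW, Finset.mem_filter, Finset.mem_filter]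
    by_cases hb : (r, t) ∈ bad P
    · exact Or.inl (Or.inl ⟨ht, hb⟩)
    have hne : r ≠ t := by rintro rfl; exact (mem_Rm.1 hr).2 (mem_Tm.1 ht).2
    obtain ⟨w, hw⟩ := tri_of (mem_Rm.1 hr).1 (mem_Tm.1 ht).1 hne hb
    rcases TR (f := f) hw.hz with h | h
    · exact Or.inl (Or.inr (mem_Vm.2 ⟨ht, w, h, hw.rot⟩))
    · exact Or.inr ⟨ht, w, h, hw⟩
  have h1 := Finset.card_le_card hsub
  have h2 := Finset.card_union_le (U ∪ Vm P f r) W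
  have h3 := Finset.card_union_le U (Vm P f r)
  have h4 := c.Vcard hr
  have h5 : W.card ≤ (Rm P f).card := cnt (P := P) (y := r) _ _ (fun t ht => by rw [hW, Finset.mem_filter] at ht; exact ht.2)
  have h6 := c.count (U.image (fun t => (r, t))) (by
    intro x hx
    obtain ⟨t, ht, rfl⟩ := Finset.mem_image.1 hx
    rw [hU, Finset.mem_filter] at ht
    exact ht.2) (by
    intro p q hpq hp hq
    obtain ⟨t, ht, e⟩ := Finset.mem_image.1 hpq
    simp only [Prod.mk.injEq] at e
    rw [← e.1] at hp
    exact absurd (mem_Tm.1 (mem_T1.1 hp).1).2 (mem_Rm.1 hr).2)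
  rw [Finset.card_image_of_injective _ (fun x y h => (Prod.mk.inj h).2)] at h6
  omega

/-- extra pairs from a curve point off the coset -/
theorem Ctx.extraY (c : Ctx P f φ κ H C a0 K) {y : Pt} (hy : y ∈ Ym P f φ C) :
    2 * (Ep P f φ C (fun x => κ - x - x)).card + (T1 P f φ C).card ≤ (bad P).card + 8 * K + (Rm P f).card := by
  have hy' := mem_Ym.1 hy
  obtain ⟨U, hU⟩ : ∃ U, U = (T1 P f φ C).filter (fun t => (y, t) ∈ bad P) := ⟨_, rfl⟩
  obtain ⟨W, hW⟩ : ∃ W, W = (T1 P f φ C).filter (fun t => ∃ w ∈ Ym P f φ C ∪ Rm P f, Tri P y t w) := ⟨_, rfl⟩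
  have hsub : T1 P f φ C ⊆ U ∪ W := by
    intro t ht
    rw [Finset.mem_union, hU, hW, Finset.mem_filter, Finset.mem_filter]
    have ht' := mem_T1.1 ht
    by_cases hb : (y, t) ∈ bad P
    · exact Or.inl ⟨ht, hb⟩
    have hne : y ≠ t := by rintro rfl; exact hy'.2 ht'.2
    obtain ⟨w, hw⟩ := tri_of (mem_Tm.1 hy'.1).1 (mem_Tm.1 ht'.1).1 hne hb
    refine Or.inr ⟨ht, w, ?_, hw⟩
    rw [Finset.mem_union]
    rcases TR (f := f) hw.hz with h | h
    · left
      rw [mem_Ym]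
      refine ⟨h, fun hwC => ?_⟩
      have h3 := tri3 hw hy'.1 ht'.1 h
      have := c.third_eq h3.rot
      exact hy'.2 (this ▸ c.flip ht'.2 hwC)
    · exact Or.inr h
  have h1 := Finset.card_le_card hsub
  have h2 := Finset.card_union_le U W
  have h5 : W.card ≤ (Ym P f φ C ∪ Rm P f).card := cnt (P := P) (y := y) _ _ (fun t ht => by rw [hW, Finset.mem_filter] at ht; exact ht.2)
  have h4 := Finset.card_union_le (Ym P f φ C) (Rm P f)
  have h7 := c.Ycard
  have h6 := c.count (U.image (fun t => (y, t))) (by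
    intro x hx
    obtain ⟨t, ht, rfl⟩ := Finset.mem_image.1 hx
    rw [hU, Finset.mem_filter] at ht
    exact ht.2) (by
    intro p q hpq hp hq
    obtain ⟨t, ht, e⟩ := Finset.mem_image.1 hpq
    simp only [Prod.mk.injEq] at e
    rw [← e.1] at hp
    exact absurd (mem_T1.1 hp).2 hy'.2)
  rw [Finset.card_image_of_injective _ (fun x y h => (Prod.mk.inj h).2)] at h6
  omega

/-- extra pairs from a hole of the coset -/
theorem Ctx.extraX (c : Ctx P f φ κ H C a0 K) {s : A} (hs : s ∈ C \ (Tm P f).image φ) :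
    2 * (Ep P f φ C (fun x => κ - x - x)).card + (T1 P f φ C).card ≤ (bad P).card + 2 * K
      + ((T1 P f φ C).filter (fun t => κ - s - φ t = φ t)).card + (Rm P f).card * (36 + 20 * K) := by
  rw [Finset.mem_sdiff] at hs
  have h1 := c.pairs (fun x => κ - s - x) (fun x hx => c.flip hs.1 hx) (by
    intro t ht u hu w hw he h
    have h1 := c.third_eq h
    rw [he] at h1
    have h2 : φ w = s := by rw [h1]; abel
    exact hs.2 (h2 ▸ Finset.mem_image_of_mem _ hw))
  have h2 : ((T1 P f φ C).filter (fun t => κ - s - φ t ∈ C \ (Tm P f).image φ)).card ≤ 2 * K := by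
    refine le_trans ?_ c.hCS
    apply Finset.card_le_card_of_injOn (fun t => κ - s - φ t)
    · intro t ht
      exact (Finset.mem_filter.1 ht).2
    · intro t ht t' ht' e
      simp only [sub_right_inj] at e
      exact c.injT (mem_T1.1 (Finset.mem_filter.1 ht).1).1 (mem_T1.1 (Finset.mem_filter.1 ht').1).1 e
  have hex : ∀ t ∈ Ep P f φ C (fun x => κ - s - x), ∃ u, u ∈ T1 P f φ C ∧ φ u = κ - s - φ t ∧ u ≠ t ∧ (t, u) ∈ bad P := by
    intro t ht
    rw [Ep, Finset.mem_filter] at ht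
    exact ht.2
  choose! u hu1 hu2 hu3 hu4 using hex
  have h6 := c.count ((Ep P f φ C (fun x => κ - s - x)).image (fun t => (t, u t))) (by
    intro x hx
    obtain ⟨t, ht, rfl⟩ := Finset.mem_image.1 hx
    exact hu4 t ht) (by
    intro p q hpq hp hq
    obtain ⟨t, ht, e⟩ := Finset.mem_image.1 hpq
    simp only [Prod.mk.injEq] at e
    obtain ⟨rfl, rfl⟩ := e
    have k := hu2 t ht
    constructor
    · intro e
      rw [k] at e
      have : φ t = s := by
        have e2 : κ - s - φ t + φ t + s - κ + φ t = κ - φ t - φ t + φ t + s - κ + φ t := by rw [e]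
        have e3 : κ - s - φ t + φ t + s - κ + φ t = φ t := by abel
        have e4 : κ - φ t - φ t + φ t + s - κ + φ t = s := by abel
        rw [e3, e4] at e2; exact e2
      exact hs.2 (this ▸ Finset.mem_image_of_mem _ (mem_T1.1 hp).1)
    · intro e
      have e' : φ t = κ - s - φ (u t) := by rw [k]; abel
      rw [e'] at e
      have : φ (u t) = s := by
        have e2 : κ - s - φ (u t) + φ (u t) + s - κ + φ (u t) = κ - φ (u t) - φ (u t) + φ (u t) + s - κ + φ (u t) := by rw [e]
        have e3 : κ - s - φ (u t) + φ (u t) + s - κ + φ (u t) = φ (u t) := by abel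
        have e4 : κ - φ (u t) - φ (u t) + φ (u t) + s - κ + φ (u t) = s := by abel
        rw [e3, e4] at e2; exact e2
      exact hs.2 (this ▸ Finset.mem_image_of_mem _ (mem_T1.1 hq).1))
  rw [Finset.card_image_of_injective _ (fun x y h => (Prod.mk.inj h).1)] at h6
  omega
end
end Orch

namespace Orch
open scoped Classical
open MvPolynomial

theorem tors {A : Type} [AddCommGroup A] {H : AddSubgroup A} {C : Finset A} {a0 : A} (hC : ∀ x, x ∈ C ↔ x - a0 ∈ H)
    {g : A} (hg : g ∈ H) (j G : ℕ) (hj : 1 ≤ j) (hgk : ∀ k, 1 ≤ k → k ≤ j * G → k • g ≠ 0)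
    (Q : Finset A) (hQ : Q ⊆ C) (v : A) (hv : ∀ x ∈ Q, j • x = v) : G * Q.card ≤ C.card := by
  have key : ∀ i i' : ℕ, i < i' → i' < G → ∀ x ∈ Q, ∀ y ∈ Q, x + i • g = y + i' • g → False := by
    intro i i' h h' x hx y hy e
    have e2 := congrArg (fun z => j • z) e
    simp only [smul_add, hv x hx, hv y hy] at e2
    have e3 := add_left_cancel e2
    obtain ⟨d, rfl⟩ := Nat.exists_eq_add_of_lt h
    have e4 : (j * (d + 1)) • g = 0 := by
      have : j • ((i + d + 1) • g) = j • (i • g) + (j * (d + 1)) • g := by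
        rw [mul_smul, ← smul_add, ← add_smul]; congr 2
      rw [this] at e3
      exact (left_eq_add.1 e3)
    refine hgk _ ?_ ?_ e4
    · exact Nat.mul_pos hj (by omega)
    · exact Nat.mul_le_mul_left _ (by omega)
  have : (Finset.range G ×ˢ Q).card ≤ C.card := by
    apply Finset.card_le_card_of_injOn (fun p => p.2 + p.1 • g)
    · rintro ⟨i, x⟩ h
      simp only [Finset.coe_product, Set.mem_prod, Finset.mem_coe] at h
      have h1 := (hC x).1 (hQ h.2)
      simp only [Finset.mem_coe]
      rw [hC]
      have : x + i • g - a0 = (x - a0) + i • g := by abel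
      rw [this]
      exact H.add_mem h1 (H.nsmul_mem hg _)
    · rintro ⟨i, x⟩ h ⟨i', x'⟩ h' e
      simp only [Finset.coe_product, Set.mem_prod, Finset.mem_coe, Finset.mem_range] at h h' e
      rcases lt_trichotomy i i' with l | l | l
      · exact (key i i' l h'.1 x h.2 x' h'.2 e).elim
      · subst l
        rw [add_right_cancel e]
      · exact (key i' i l h.1 x' h'.2 x h.2 e.symm).elim
  simpa using this

section
variable {A : Type} [AddCommGroup A] {P : Finset Pt} {f : ℕ → ℕ → ℝ} {φ : Pt → A} {κ : A} {H : AddSubgroup A} {C : Finset A} {a0 : A} {K : ℕ}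

theorem Ctx.tors1 (c : Ctx P f φ κ H C a0 K) {g : A} (hg : g ∈ H) (j G : ℕ) (hj : 1 ≤ j) (hgk : ∀ k, 1 ≤ k → k ≤ j * G → k • g ≠ 0)
    (U : Finset Pt) (hU : U ⊆ T1 P f φ C) (v : A) (hv : ∀ t ∈ U, j • φ t = v) : G * U.card ≤ C.card := by
  have h := tors c.hC hg j G hj hgk (U.image φ) (by
    intro x hx
    obtain ⟨t, ht, rfl⟩ := Finset.mem_image.1 hx
    exact (mem_T1.1 (hU ht)).2) v (by
    intro x hx
    obtain ⟨t, ht, rfl⟩ := Finset.mem_image.1 hx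
    exact hv t ht)
  rwa [Finset.card_image_of_injOn] at h
  intro t ht u hu e
  exact c.injT (mem_T1.1 (hU ht)).1 (mem_T1.1 (hU hu)).1 e

theorem Ctx.small (c : Ctx P f φ κ H C a0 K) {g : A} (hg : g ∈ H) (hgk : ∀ k, 1 ≤ k → k ≤ 3 * (100 * (2 * K + 1)) → k • g ≠ 0) :
    100 * (((T1 P f φ C).filter (fun t => κ - φ t - φ t ∈ C \ (Tm P f).image φ)).card
      + ((T1 P f φ C).filter (fun t => κ - φ t - φ t = φ t)).card) ≤ C.card ∧
    ∀ s : A, 100 * ((T1 P f φ C).filter (fun t => κ - s - φ t = φ t)).card ≤ C.card := by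
  have hgk2 : ∀ k, 1 ≤ k → k ≤ 2 * (100 * (2 * K + 1)) → k • g ≠ 0 := fun k h1 h2 => hgk k h1 (by omega)
  have h2 : ∀ s : A, (100 * (2 * K + 1)) * ((T1 P f φ C).filter (fun t => κ - φ t - φ t = s)).card ≤ C.card := by
    intro s
    apply c.tors1 hg 2 _ (by norm_num) hgk2 _ (Finset.filter_subset _ _) (κ - s)
    intro t ht
    rw [← (Finset.mem_filter.1 ht).2]; abel
  have h3 : (100 * (2 * K + 1)) * ((T1 P f φ C).filter (fun t => κ - φ t - φ t = φ t)).card ≤ C.card := by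
    apply c.tors1 hg 3 _ (by norm_num) hgk _ (Finset.filter_subset _ _) κ
    intro t ht
    have e := (Finset.mem_filter.1 ht).2
    calc 3 • φ t = φ t + φ t + φ t := by abel
      _ = (κ - φ t - φ t) + φ t + φ t := by rw [e]
      _ = κ := by abel
  constructor
  · have hb : ((T1 P f φ C).filter (fun t => κ - φ t - φ t ∈ C \ (Tm P f).image φ)) ⊆
        (C \ (Tm P f).image φ).biUnion (fun s => (T1 P f φ C).filter (fun t => κ - φ t - φ t = s)) := by
      intro t ht
      rw [Finset.mem_filter] at ht
      exact Finset.mem_biUnion.2 ⟨_, ht.2, Finset.mem_filter.2 ⟨ht.1, rfl⟩⟩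
    have hb2 := (Finset.card_le_card hb).trans Finset.card_biUnion_le
    have hb3 : (100 * (2 * K + 1)) * ∑ s ∈ C \ (Tm P f).image φ, ((T1 P f φ C).filter (fun t => κ - φ t - φ t = s)).card ≤ 2 * K * C.card := by
      rw [Finset.mul_sum]
      refine (Finset.sum_le_card_nsmul _ _ C.card (fun s _ => h2 s)).trans ?_
      rw [smul_eq_mul]
      exact Nat.mul_le_mul_right _ c.hCS
    have hb4 := (Nat.mul_le_mul_left (100 * (2 * K + 1)) hb2).trans hb3
    generalize ((T1 P f φ C).filter (fun t => κ - φ t - φ t ∈ C \ (Tm P f).image φ)).card = σ at *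
    generalize ((T1 P f φ C).filter (fun t => κ - φ t - φ t = φ t)).card = τ at *
    have : (2 * K + 1) * (100 * (σ + τ)) ≤ (2 * K + 1) * C.card := by nlinarith
    exact Nat.le_of_mul_le_mul_left this (by omega)
  · intro s
    have : (100 * (2 * K + 1)) * ((T1 P f φ C).filter (fun t => κ - s - φ t = φ t)).card ≤ C.card := by
      apply c.tors1 hg 2 _ (by norm_num) hgk2 _ (Finset.filter_subset _ _) (κ - s)
      intro t ht
      have e := (Finset.mem_filter.1 ht).2
      calc 2 • φ t = φ t + φ t := by abel
        _ = (κ - s - φ t) + φ t := by rw [e]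
        _ = κ - s := by abel
    refine le_trans ?_ this
    nlinarith

theorem Ctx.clean (c : Ctx P f φ κ H C a0 K) (hR : Rm P f = ∅) (hY : Ym P f φ C = ∅) (hX : C \ (Tm P f).image φ = ∅) :
    2 * P.card ≤ (bad P).card + 6 := by
  have h1 := c.tangent
  have h2 := c.count ∅ (Finset.empty_subset _) (by intro p q h; simp at h)
  have h3 := T1_card P f φ C
  have h4 := TR_card P f
  rw [hX] at h1
  simp only [Finset.notMem_empty, Finset.filter_false, Finset.card_empty] at h1 h2
  rw [hR, Finset.card_empty] at h1 h4
  rw [hY, Finset.card_empty] at h3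
  obtain ⟨F, hF⟩ : ∃ F, F = (T1 P f φ C).filter (fun t => κ - φ t - φ t = φ t) := ⟨_, rfl⟩
  rw [← hF] at h1
  have hmem : ∀ t, t ∈ F ↔ t ∈ T1 P f φ C ∧ κ - φ t - φ t = φ t := by intro t; rw [hF, Finset.mem_filter]
  have third : ∀ a ∈ F, ∀ b ∈ F, a ≠ b → ∃ d ∈ F, d ≠ a ∧ d ≠ b ∧ Col a b d := by
    intro a ha b hb hab
    have ha' := (hmem a).1 ha
    have hb' := (hmem b).1 hb
    have a1 := mem_T1.1 ha'.1
    have b1 := mem_T1.1 hb'.1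
    have hc := c.flip a1.2 b1.2
    have hc2 : κ - φ a - φ b ∈ (Tm P f).image φ := by
      by_contra hn
      have : κ - φ a - φ b ∈ C \ (Tm P f).image φ := Finset.mem_sdiff.2 ⟨hc, hn⟩
      rw [hX] at this; simp at this
    obtain ⟨d, hd, hde⟩ := Finset.mem_image.1 hc2
    have hka : κ = φ a + φ a + φ a := by
      have := ha'.2
      calc κ = (κ - φ a - φ a) + φ a + φ a := by abel
        _ = _ := by rw [this]
    have hkb : κ = φ b + φ b + φ b := by
      have := hb'.2
      calc κ = (κ - φ b - φ b) + φ b + φ b := by abel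
        _ = _ := by rw [this]
    refine ⟨d, (hmem d).2 ⟨mem_T1.2 ⟨hd, by rw [hde]; exact hc⟩, ?_⟩, ?_, ?_, ?_⟩
    · rw [hde]
      have e : κ - (κ - φ a - φ b) - (κ - φ a - φ b) = (φ a + φ a + φ a) + (φ b + φ b + φ b) - κ - φ a - φ b := by abel
      rw [e, ← hka, ← hkb]; abel
    · rintro rfl
      have : φ b = φ d := by
        have e : φ b = κ - φ d - (κ - φ d - φ b) := by abel
        rw [← hde] at e
        rw [e, ha'.2]
      exact hab (c.injT b1.1 a1.1 this).symm
    · rintro rfl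
      have : φ a = φ d := by
        have e : φ a = κ - (κ - φ a - φ d) - φ d := by abel
        rw [← hde] at e
        rw [e, hb'.2]
      exact hab (c.injT a1.1 b1.1 this)
    · apply col_of_sum c.hf c.inj c.sum (mem_Tm.1 a1.1).2 (mem_Tm.1 b1.1).2 (mem_Tm.1 hd).2 hab
      rw [hde]; abel
  have hF3 : F.card ≤ 3 := by
    by_cases h : F.card ≤ 1
    · omega
    push Not at h
    obtain ⟨a, ha, b, hb, hab⟩ := Finset.one_lt_card.1 h
    apply c.hf.line hab
    intro r hr
    refine ⟨sylvester F third a ha b hb r hr hab, (mem_Tm.1 (mem_T1.1 ((hmem r).1 hr).1).1).2.1⟩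
  omega

theorem hDbound (hf : Cub f) (inj : Set.InjOn φ {x | Sm f x}) (sum : ∀ a b c, T3 f a b c → φ a + φ b + φ c = κ) :
    ((((Tm P f).image φ) ×ˢ ((Tm P f).image φ)).filter (fun p => κ - p.1 - p.2 ∉ (Tm P f).image φ)).card
      ≤ (Tm P f).card + (bad P).card + (Tm P f).card * (Rm P f).card := by
  obtain ⟨D, hD⟩ : ∃ D, D = (Tm P f).image (fun t => (t, t)) ∪ bad P ∪
    (Tm P f).biUnion (fun t => ((Tm P f).filter (fun u => ∃ w ∈ Rm P f, Tri P t u w)).image (fun u => (t, u))) := ⟨_, rfl⟩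
  have h1 : D.card ≤ (Tm P f).card + (bad P).card + (Tm P f).card * (Rm P f).card := by
    rw [hD]
    refine (Finset.card_union_le _ _).trans (add_le_add ((Finset.card_union_le _ _).trans (add_le_add Finset.card_image_le le_rfl)) ?_)
    apply Finset.card_biUnion_le_card_mul
    intro t ht
    refine Finset.card_image_le.trans ?_
    apply cnt (P := P) (y := t)
    intro u hu
    exact (Finset.mem_filter.1 hu).2
  refine le_trans (le_trans (Finset.card_le_card (t := D.image (fun p => (φ p.1, φ p.2))) ?_) Finset.card_image_le) h1
  rintro ⟨x, y⟩ h
  rw [Finset.mem_filter, Finset.mem_product] at h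
  obtain ⟨⟨hx, hy⟩, hn⟩ := h
  obtain ⟨t, ht, rfl⟩ := Finset.mem_image.1 hx
  obtain ⟨u, hu, rfl⟩ := Finset.mem_image.1 hy
  refine Finset.mem_image.2 ⟨(t, u), ?_, rfl⟩
  rw [hD, Finset.mem_union, Finset.mem_union]
  by_cases htu : t = u
  · subst htu
    exact Or.inl (Or.inl (Finset.mem_image.2 ⟨t, ht, rfl⟩))
  by_cases hb : (t, u) ∈ bad P
  · exact Or.inl (Or.inr hb)
  obtain ⟨w, hw⟩ := tri_of (mem_Tm.1 ht).1 (mem_Tm.1 hu).1 htu hb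
  rcases TR (f := f) hw.hz with h | h
  · exfalso
    apply hn
    have := sum t u w (tri3 hw ht hu h)
    refine Finset.mem_image.2 ⟨w, h, ?_⟩
    simp only
    rw [← this]; abel
  · refine Or.inr (Finset.mem_biUnion.2 ⟨t, ht, Finset.mem_image.2 ⟨u, Finset.mem_filter.2 ⟨hu, w, h, hw⟩, rfl⟩⟩)

theorem Ctx.step (c : Ctx P f φ κ H C a0 K) {p : Pt} {M : ℕ} {a b : ℕ → Pt} {d : ℤ → Pt} (S : Strip P p M a b d)
    (hM : 16 * K + 2 ≤ M) (ha : ∀ i ≤ M, cu f (a i) = 0) (hb : ∀ i ≤ M, cu f (b i) = 0) (hd : ∀ k : ℤ, -3 ≤ k → k ≤ 3 → cu f (d k) = 0) :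
    ∃ g ∈ H, ∀ k, 1 ≤ k → k ≤ M → k • g ≠ 0 := by
  have t3 : ∀ i ≤ M, ∀ j ≤ M, ∀ k : ℤ, -3 ≤ k → k ≤ 3 → (j : ℤ) = i + k → T3 f (a i) (b j) (d k) := by
    intro i hi j hj k h1 h2 h3
    have h := S.tri i hi j hj k h1 h2 h3
    exact ⟨ha i hi, hb j hj, hd k h1 h2, h.hxy, h.hxz, h.hyz, h.col⟩
  have hT : ∀ i ≤ M, a i ∈ Tm P f := by
    intro i hi
    exact mem_Tm.2 ⟨(S.tri i hi i hi 0 (by norm_num) (by norm_num) (by simp)).hx,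
      (t3 i hi i hi 0 (by norm_num) (by norm_num) (by simp)).sm c.hf⟩
  obtain ⟨g, hg⟩ : ∃ g, g = φ (d 1) - φ (d 0) := ⟨_, rfl⟩
  have hs : ∀ i, i + 1 ≤ M → φ (a (i + 1)) = φ (a i) + g := by
    intro i hi
    have e1 := c.sum _ _ _ (t3 i (by omega) (i + 1) hi 1 (by norm_num) (by norm_num) (by push_cast; ring))
    have e2 := c.sum _ _ _ (t3 (i + 1) hi (i + 1) hi 0 (by norm_num) (by norm_num) (by simp))
    have : φ (a (i + 1)) = κ - φ (b (i + 1)) - φ (d 0) := by rw [← e2]; abel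
    rw [this, ← e1, hg]; abel
  have hi : ∀ i, i ≤ M → φ (a i) = φ (a 0) + i • g := by
    intro i
    induction i with
    | zero => intro _; simp
    | succ k ih => intro h; rw [hs k h, ih (by omega), add_smul, one_smul, add_assoc]
  refine ⟨g, ?_, ?_⟩
  · by_contra hgH
    have hno : ∀ i, i + 1 ≤ M → ∃ j, (j = i ∨ j = i + 1) ∧ a j ∈ Ym P f φ C := by
      intro i him
      by_contra hn
      push Not at hn
      have m1 : φ (a i) ∈ C := by
        by_contra h
        exact hn i (Or.inl rfl) (mem_Ym.2 ⟨hT i (by omega), h⟩)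
      have m2 : φ (a (i + 1)) ∈ C := by
        by_contra h
        exact hn (i + 1) (Or.inr rfl) (mem_Ym.2 ⟨hT (i + 1) him, h⟩)
      rw [c.hC] at m1 m2
      apply hgH
      have := H.sub_mem m2 m1
      rw [hs i him] at this
      have e : φ (a i) + g - a0 - (φ (a i) - a0) = g := by abel
      rwa [e] at this
    have hno2 : ∀ i ∈ Finset.range (8 * K + 1), ∃ j, (j = 2 * i ∨ j = 2 * i + 1) ∧ a j ∈ Ym P f φ C := by
      intro i h
      rw [Finset.mem_range] at h
      exact hno (2 * i) (by omega)
    choose! q hq hqY using hno2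
    have hcard : (Finset.range (8 * K + 1)).card ≤ (Ym P f φ C).card := by
      apply Finset.card_le_card_of_injOn (fun i => a (q i))
      · intro i h; exact hqY i h
      · intro i h i' h' e
        have l1 := Finset.mem_range.1 h
        have l2 := Finset.mem_range.1 h'
        have := hq i h
        have := hq i' h'
        have := S.ainj (q i) (by omega) (q i') (by omega) e
        omega
    rw [Finset.card_range] at hcard
    have := c.Ycard
    omega
  · intro k h1 h2 h0
    have e := hi k h2
    rw [h0, add_zero] at e
    have := S.ainj k h2 0 (by omega) (c.injT (hT k h2) (hT 0 (by omega)) e)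
    omega
end

theorem mainClaim : MainClaim := by
  obtain ⟨ρ, c₁, n₁, hD⟩ := partD
  obtain ⟨K, hK⟩ : ∃ K, K = ρ + 6 := ⟨_, rfl⟩
  obtain ⟨L, hL⟩ : ∃ L, L = (ρ + 1) * (36 + 20 * K) := ⟨_, rfl⟩
  refine ⟨n₁ + c₁ * (3 * (100 * (2 * K + 1)) + 16 * K + 10) + 1000 * (L + K + ρ + 100) + 1, fun P hP hn => ?_⟩
  by_contra hcon
  push Not at hcon
  obtain ⟨F, Firr, Fdeg, Fres, p, M, a, b, d, hM6, S, hM, ha, hb, hd⟩ := hD P hP (by omega) (by omega)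
  obtain ⟨f, rfl⟩ := cubic_form (F := F) Fdeg.le
  simp only [ev_cuP] at ha hb hd
  have hf : Cub f := ⟨Firr, Fdeg⟩
  have hMb : 3 * (100 * (2 * K + 1)) + 16 * K + 10 < M := by
    have : c₁ * (3 * (100 * (2 * K + 1)) + 16 * K + 10) < c₁ * M := by omega
    exact Nat.lt_of_mul_lt_mul_left this
  have hRm : (Rm P f).card ≤ ρ + 1 := by
    have hsub : Rm P f ⊆ (P \ zr P (cuP f)) ∪ (Rm P f).filter (fun t => cu f t = 0) := by
      intro t ht
      rw [Finset.mem_union, Finset.mem_sdiff, mem_zr, Finset.mem_filter, ev_cuP]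
      have := (mem_Rm.1 ht).1
      tauto
    have h1 : ((Rm P f).filter (fun t => cu f t = 0)).card ≤ 1 := by
      rw [Finset.card_le_one]
      intro x hx y hy
      rw [Finset.mem_filter, mem_Rm] at hx hy
      exact sing_unique hf hx.2 hy.2 hx.1.2 hy.1.2
    have := (Finset.card_le_card hsub).trans (Finset.card_union_le _ _)
    omega
  have hTR := TR_card P f
  obtain ⟨A, _, φ, κ, inj, sum⟩ := group_law hf
  have hScard : ((Tm P f).image φ).card = (Tm P f).card :=
    Finset.card_image_of_injOn (fun x hx y hy e => inj (mem_Tm.1 hx).2 (mem_Tm.1 hy).2 e)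
  have hDb := hDbound (P := P) hf inj sum
  obtain ⟨H, C, a0, hC, hk, hSC, hCS⟩ := near_coset ((Tm P f).image φ) κ K (by rw [hScard]; omega) (by
    refine hDb.trans ?_
    rw [hScard, hK]
    have : (Tm P f).card * (Rm P f).card ≤ (Tm P f).card * (ρ + 1) := Nat.mul_le_mul_left _ hRm
    have h2 : (bad P).card ≤ 4 * (Tm P f).card := by omega
    nlinarith)
  have c : Ctx P f φ κ H C a0 K := ⟨hf, inj, sum, hC, hk, hSC, hCS⟩
  obtain ⟨g, hg, hgk⟩ := c.step S (by omega) ha hb hd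
  obtain ⟨s1, s2⟩ := c.small hg (fun k h1 h2 => hgk k h1 (by omega))
  have hTan := c.tangent
  have hCc := c.Ccard
  have hYc := c.Ycard
  have hT1 := T1_card P f φ C
  have hRL : (Rm P f).card * (36 + 20 * K) ≤ L := by rw [hL]; exact Nat.mul_le_mul_right _ hRm
  have hR : Rm P f = ∅ := by
    by_contra h
    obtain ⟨r, hr⟩ := Finset.nonempty_iff_ne_empty.2 h
    have := c.extraR hr
    omega
  have hY : Ym P f φ C = ∅ := by
    by_contra h
    obtain ⟨r, hr⟩ := Finset.nonempty_iff_ne_empty.2 h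
    have := c.extraY hr
    omega
  have hX : C \ (Tm P f).image φ = ∅ := by
    by_contra h
    obtain ⟨r, hr⟩ := Finset.nonempty_iff_ne_empty.2 h
    have := c.extraX hr
    have := s2 r
    omega
  have := c.clean hR hY hX
  omega

end Orch

/-- The orchard problem for large `n`: a set of `n` points in the plane determines
at most `⌊n (n - 3) / 6⌋ + 1` lines containing exactly three of the points. -/
theorem orchard :
    ∃ n₀ : ℕ, 0 < n₀ ∧ ∀ n : ℕ, n₀ ≤ n →
      ∀ P : Set (ℝ × ℝ), P.Finite → P.ncard = n →
        numThreeRichLines P ≤ n * (n - 3) / 6 + 1 :=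
  Orch.reduction Orch.mainClaim
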